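/- Let d2, d3 be integers with 3 ≤ d2 ≤ d3. If 3 does not divide d2 and d3 cannot be written as 3a + b·d2 with natural numbers a, b, then there is no tame automorphism F of ℂ³ with multidegree mdeg F = (3, d2, d3). -/

import Mathlib

open MvPolynomial

/-- The multidegree of a polynomial automorphism of `ℂⁿ`: the sequence of total degrees of the
images of the variables. -/
noncomputable def polyMdeg {n : ℕ} (F : MvPolynomial (Fin n) ℂ ≃ₐ[ℂ] MvPolynomial (Fin n) ℂ) :
    Fin n → ℕ := fun i => (F (X i)).totalDegree

/-- An automorphism is affine (linear) if it maps each variable to a polynomial of degree ≤ 1. -/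
def IsAffineAut {n : ℕ} (F : MvPolynomial (Fin n) ℂ ≃ₐ[ℂ] MvPolynomial (Fin n) ℂ) : Prop :=
  ∀ i, (F (X i)).totalDegree ≤ 1

/-- An automorphism is elementary (triangular) if it sends one variable `xᵢ` to `xᵢ + p`, where
`p` is a polynomial in the other variables, and fixes all other variables. -/
def IsElementaryAut {n : ℕ} (F : MvPolynomial (Fin n) ℂ ≃ₐ[ℂ] MvPolynomial (Fin n) ℂ) : Prop :=
  ∃ (i : Fin n) (p : MvPolynomial (Fin n) ℂ), degreeOf i p = 0 ∧
    F (X i) = X i + p ∧ ∀ j, j ≠ i → F (X j) = X j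

/-- A tame automorphism is a composition of affine and elementary automorphisms, i.e. an element
of the subgroup generated by these. -/
def IsTameAut {n : ℕ} (F : MvPolynomial (Fin n) ℂ ≃ₐ[ℂ] MvPolynomial (Fin n) ℂ) : Prop :=
  F ∈ Subgroup.closure {G : MvPolynomial (Fin n) ℂ ≃ₐ[ℂ] MvPolynomial (Fin n) ℂ |
    IsAffineAut G ∨ IsElementaryAut G}


abbrev P3 := MvPolynomial (Fin 3) ℂ

/-- Generic positive weights. -/
structure Wt where
  w : Fin 3 → ℝ
  one_le : ∀ i, 1 ≤ w i
  le : ∀ i, w i ≤ 11/10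
  inj : ∀ m n : Fin 3 →₀ ℕ, (∑ i, (m i : ℝ) * w i) = (∑ i, (n i : ℝ) * w i) → m = n

namespace Wt
variable (θ : Wt)

noncomputable def W (m : Fin 3 →₀ ℕ) : ℝ := ∑ i, (m i : ℝ) * θ.w i

lemma W_add (m n : Fin 3 →₀ ℕ) : θ.W (m + n) = θ.W m + θ.W n := by
  simp [W, add_mul, Finset.sum_add_distrib]

lemma W_zero : θ.W 0 = 0 := by simp [W]

lemma W_nonneg (m : Fin 3 →₀ ℕ) : 0 ≤ θ.W m :=
  Finset.sum_nonneg fun i _ => mul_nonneg (Nat.cast_nonneg _) (by linarith [θ.one_le i])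

lemma le_W (m : Fin 3 →₀ ℕ) (i : Fin 3) : (m i : ℝ) ≤ θ.W m := by
  have h1 : (m i : ℝ) ≤ (m i : ℝ) * θ.w i := by
    nlinarith [θ.one_le i, Nat.cast_nonneg (α := ℝ) (m i)]
  refine h1.trans ?_
  exact Finset.single_le_sum (f := fun i => (m i : ℝ) * θ.w i)
    (fun i _ => mul_nonneg (Nat.cast_nonneg _) (by linarith [θ.one_le i])) (Finset.mem_univ i)

lemma W_inj {m n : Fin 3 →₀ ℕ} (h : θ.W m = θ.W n) : m = n := θ.inj m n h

lemma one_le_W {m : Fin 3 →₀ ℕ} (h : m ≠ 0) : 1 ≤ θ.W m := by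
  obtain ⟨i, hi⟩ := Finsupp.ne_iff.1 h
  have : (1:ℝ) ≤ m i := by exact_mod_cast Nat.one_le_iff_ne_zero.2 (by simpa using hi)
  exact this.trans (θ.le_W m i)

/-- Weighted degree; zero has degree zero. -/
noncomputable def deg (f : P3) : ℝ := f.support.fold max 0 θ.W

lemma deg_nonneg (f : P3) : 0 ≤ θ.deg f := by
  unfold deg; rw [Finset.le_fold_max]; left; rfl

lemma le_deg {f : P3} {m} (h : m ∈ f.support) : θ.W m ≤ θ.deg f := by
  unfold deg; rw [Finset.le_fold_max]; right; exact ⟨m, h, le_rfl⟩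

lemma deg_le {f : P3} {r : ℝ} (h0 : 0 ≤ r) (h : ∀ m ∈ f.support, θ.W m ≤ r) : θ.deg f ≤ r := by
  unfold deg; rw [Finset.fold_max_le]; exact ⟨h0, h⟩

lemma exists_lead {f : P3} (hf : f ≠ 0) : ∃ m ∈ f.support, θ.W m = θ.deg f := by
  have hne : f.support.Nonempty := by
    rwa [Finset.nonempty_iff_ne_empty, Ne, MvPolynomial.support_eq_empty]
  obtain ⟨m, hm, hmax⟩ := Finset.exists_max_image f.support θ.W hne
  exact ⟨m, hm, le_antisymm (θ.le_deg hm) (θ.deg_le (θ.W_nonneg m) hmax)⟩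

lemma deg_zero : θ.deg 0 = 0 := by simp [deg]

lemma deg_C (c : ℂ) : θ.deg (C c) = 0 := by
  apply le_antisymm _ (θ.deg_nonneg _)
  apply θ.deg_le le_rfl
  intro m hm
  have : m = 0 := by
    rw [mem_support_iff, coeff_C] at hm
    by_contra h; simp [Ne.symm h] at hm
  simp [this, θ.W_zero]

lemma deg_one : θ.deg 1 = 0 := by simpa using θ.deg_C 1

lemma deg_add_le (f g : P3) : θ.deg (f + g) ≤ max (θ.deg f) (θ.deg g) := by
  apply θ.deg_le (le_max_of_le_left (θ.deg_nonneg f))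
  intro m hm
  have := MvPolynomial.support_add hm
  rcases Finset.mem_union.1 this with h | h
  · exact le_max_of_le_left (θ.le_deg h)
  · exact le_max_of_le_right (θ.le_deg h)

lemma deg_neg (f : P3) : θ.deg (-f) = θ.deg f := by simp [deg, support_neg]

lemma deg_sub_le (f g : P3) : θ.deg (f - g) ≤ max (θ.deg f) (θ.deg g) := by
  rw [sub_eq_add_neg, ← θ.deg_neg g]; exact θ.deg_add_le _ _

lemma deg_smul {c : ℂ} (hc : c ≠ 0) (f : P3) : θ.deg (c • f) = θ.deg f := by
  have : (c • f).support = f.support := by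
    ext m; simp [mem_support_iff, coeff_smul, hc]
  simp [deg, this]

lemma deg_smul_le (c : ℂ) (f : P3) : θ.deg (c • f) ≤ θ.deg f := by
  by_cases hc : c = 0
  · simp [hc, θ.deg_zero, θ.deg_nonneg]
  · rw [θ.deg_smul hc]

lemma deg_add_eq {f g : P3} (h : θ.deg g < θ.deg f) : θ.deg (f + g) = θ.deg f := by
  apply le_antisymm
  · exact (θ.deg_add_le f g).trans (max_le le_rfl h.le)
  · by_contra hlt
    push Not at hlt
    have h1 := θ.deg_sub_le (f + g) g
    rw [add_sub_cancel_right] at h1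
    have := max_lt hlt h
    linarith

lemma deg_add_eq' {f g : P3} (h : θ.deg f < θ.deg g) : θ.deg (f + g) = θ.deg g := by
  rw [add_comm]; exact θ.deg_add_eq h

lemma deg_sub_eq {f g : P3} (h : θ.deg g < θ.deg f) : θ.deg (f - g) = θ.deg f := by
  rw [sub_eq_add_neg]; exact θ.deg_add_eq (by rwa [θ.deg_neg])

lemma deg_mul_le (f g : P3) : θ.deg (f * g) ≤ θ.deg f + θ.deg g := by
  apply θ.deg_le (add_nonneg (θ.deg_nonneg f) (θ.deg_nonneg g))
  intro m hm
  have := MvPolynomial.support_mul f g hm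
  obtain ⟨a, ha, b, hb, rfl⟩ := Finset.mem_add.1 this
  rw [θ.W_add]
  exact add_le_add (θ.le_deg ha) (θ.le_deg hb)

lemma deg_mul {f g : P3} (hf : f ≠ 0) (hg : g ≠ 0) : θ.deg (f * g) = θ.deg f + θ.deg g := by
  apply le_antisymm (θ.deg_mul_le f g)
  obtain ⟨a, ha, hfa⟩ := θ.exists_lead hf
  obtain ⟨b, hb, hgb⟩ := θ.exists_lead hg
  rw [← hfa, ← hgb, ← θ.W_add]
  apply θ.le_deg
  rw [mem_support_iff, coeff_mul, Finset.sum_eq_single (a, b)]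
  · exact mul_ne_zero (mem_support_iff.1 ha) (mem_support_iff.1 hb)
  · rintro ⟨a', b'⟩ hab hne
    by_contra hcon
    have h1 : a' ∈ f.support := mem_support_iff.2 (left_ne_zero_of_mul hcon)
    have h2 : b' ∈ g.support := mem_support_iff.2 (right_ne_zero_of_mul hcon)
    have h3 := θ.le_deg h1
    have h4 := θ.le_deg h2
    have h5 : a' + b' = a + b := by simpa using hab
    have h6 := congrArg θ.W h5
    rw [θ.W_add, θ.W_add] at h6
    have e1 : a' = a := θ.W_inj (by linarith)
    have e2 : b' = b := θ.W_inj (by linarith)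
    exact hne (by rw [e1, e2])
  · intro h; simp at h

lemma deg_pow (f : P3) (n : ℕ) : θ.deg (f ^ n) = n * θ.deg f := by
  by_cases hf : f = 0
  · subst hf
    rcases n with _ | n
    · simp [θ.deg_one]
    · simp [θ.deg_zero]
  induction n with
  | zero => simp [θ.deg_one]
  | succ n ih => rw [pow_succ, θ.deg_mul (pow_ne_zero n hf) hf, ih]; push_cast; ring

lemma eq_C_of_deg_lt {f : P3} (h : θ.deg f < 1) : ∃ c, f = C c := by
  refine ⟨coeff 0 f, ?_⟩
  ext m
  rw [coeff_C]
  split_ifs with hm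
  · rw [hm]
  · by_contra hne
    have h1 := θ.le_deg (mem_support_iff.2 hne)
    have h2 := θ.one_le_W (Ne.symm hm)
    linarith

lemma deg_pos_iff_one_le {f : P3} (h : 0 < θ.deg f) : 1 ≤ θ.deg f := by
  by_contra hlt
  push Not at hlt
  obtain ⟨c, rfl⟩ := θ.eq_C_of_deg_lt hlt
  rw [θ.deg_C] at h
  exact lt_irrefl _ h

lemma ne_zero_of_deg_pos {f : P3} (h : 0 < θ.deg f) : f ≠ 0 := by
  rintro rfl; rw [θ.deg_zero] at h; exact lt_irrefl _ h

lemma exists_cancel {f g : P3} (h : θ.deg f = θ.deg g) (hpos : 0 < θ.deg f) :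
    ∃ c : ℂ, c ≠ 0 ∧ θ.deg (f - c • g) < θ.deg f := by
  have hf := θ.ne_zero_of_deg_pos hpos
  have hg := θ.ne_zero_of_deg_pos (h ▸ hpos)
  obtain ⟨a, ha, hfa⟩ := θ.exists_lead hf
  obtain ⟨b, hb, hgb⟩ := θ.exists_lead hg
  have hab : a = b := θ.W_inj (by rw [hfa, hgb, h])
  subst hab
  have ha' := mem_support_iff.1 ha
  have hb' := mem_support_iff.1 hb
  refine ⟨coeff a f / coeff a g, div_ne_zero ha' hb', ?_⟩
  set q := f - (coeff a f / coeff a g) • g with hq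
  by_cases hq0 : q = 0
  · rw [hq0, θ.deg_zero]; exact hpos
  obtain ⟨m, hm, hqm⟩ := θ.exists_lead hq0
  have hle : θ.deg q ≤ θ.deg f := by
    refine (θ.deg_sub_le _ _).trans (max_le le_rfl ?_)
    rw [h]; exact θ.deg_smul_le _ _
  refine lt_of_le_of_ne hle ?_
  intro heq
  have : m = a := θ.W_inj (by rw [hqm, hfa, heq])
  subst this
  apply mem_support_iff.1 hm
  rw [hq]
  simp [coeff_sub, coeff_smul, hb']

lemma deg_X (i : Fin 3) : θ.deg (X i) = θ.w i := by
  have : (X i : P3).support = {Finsupp.single i 1} := support_X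
  have h0 : 0 ≤ θ.w i := by linarith [θ.one_le i]
  have hW : θ.W (Finsupp.single i 1) = θ.w i := by
    simp [W, Finsupp.single_apply]
  apply le_antisymm
  · apply θ.deg_le h0
    intro m hm
    rw [this, Finset.mem_singleton] at hm
    rw [hm, hW]
  · rw [← hW]; apply θ.le_deg; rw [this]; simp

/-- well-foundedness: minimal degree elements exist. -/
lemma isWF : (Set.range θ.W).IsWF := by
  have h : (Set.univ : Set (Fin 3 →₀ ℕ)).IsPWO := Set.isPWO_of_wellQuasiOrderedLE _
  have := h.image_of_monotone (f := θ.W) (by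
    intro a b hab
    apply Finset.sum_le_sum
    intro i _
    exact mul_le_mul_of_nonneg_right (by exact_mod_cast hab i) (by linarith [θ.one_le i]))
  rw [Set.image_univ] at this
  exact this.isWF

lemma deg_mem_range (f : P3) : θ.deg f ∈ Set.range θ.W := by
  by_cases hf : f = 0
  · exact ⟨0, by rw [hf, θ.deg_zero, θ.W_zero]⟩
  · obtain ⟨m, _, h⟩ := θ.exists_lead hf
    exact ⟨m, h⟩

lemma exists_min (S : Set P3) (hS : S.Nonempty) : ∃ f ∈ S, ∀ g ∈ S, θ.deg f ≤ θ.deg g := by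
  have hwf : (θ.deg '' S).IsWF := θ.isWF.mono (by rintro _ ⟨f, _, rfl⟩; exact θ.deg_mem_range f)
  obtain ⟨f, hf, hfm⟩ := hwf.min_mem (hS.image _)
  refine ⟨f, hf, fun g hg => ?_⟩
  rw [hfm]
  exact hwf.min_le (hS.image _) ⟨g, hg, rfl⟩

end Wt


/-- Logarithmic derivations. -/
noncomputable def lD (i : Fin 3) : Derivation ℂ P3 P3 := (X i : P3) • pderiv i

lemma lD_apply (i : Fin 3) (f : P3) : lD i f = X i * pderiv i f := rfl

lemma lD_C (i : Fin 3) (c : ℂ) : lD i (C c) = 0 := by simp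

lemma coeff_lD (i : Fin 3) (f : P3) (m : Fin 3 →₀ ℕ) : coeff m (lD i f) = m i * coeff m f := by
  induction f using MvPolynomial.induction_on' with
  | monomial u a =>
    rw [lD_apply, pderiv_monomial, X, monomial_mul, coeff_monomial, coeff_monomial]
    by_cases hu : u i = 0
    · by_cases h : u = m
      · subst h; simp [hu]
      · simp [hu, h]
    · have : Finsupp.single i 1 + (u - Finsupp.single i 1) = u := by
        apply add_tsub_cancel_of_le
        rw [Finsupp.single_le_iff]; omega
      rw [this]
      by_cases h : u = m
      · subst h; simp [mul_comm]
      · simp [h]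
  | add p q hp hq => simp [map_add, hp, hq, mul_add]

noncomputable def Jc (f g : P3) : Fin 3 → P3 :=
  ![lD 1 f * lD 2 g - lD 2 f * lD 1 g, lD 2 f * lD 0 g - lD 0 f * lD 2 g,
    lD 0 f * lD 1 g - lD 1 f * lD 0 g]

lemma Jc_zero (f g : P3) : Jc f g 0 = lD 1 f * lD 2 g - lD 2 f * lD 1 g := rfl
lemma Jc_one (f g : P3) : Jc f g 1 = lD 2 f * lD 0 g - lD 0 f * lD 2 g := rfl
lemma Jc_two (f g : P3) : Jc f g 2 = lD 0 f * lD 1 g - lD 1 f * lD 0 g := rfl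

lemma ext3 {u v : Fin 3 → P3} (h0 : u 0 = v 0) (h1 : u 1 = v 1) (h2 : u 2 = v 2) : u = v := by
  funext p; fin_cases p <;> assumption

lemma Jc_swap (f g : P3) : Jc g f = - Jc f g := by
  apply ext3 <;> simp [Jc_zero, Jc_one, Jc_two] <;> ring
lemma Jc_self (f : P3) : Jc f f = 0 := by
  apply ext3 <;> simp [Jc_zero, Jc_one, Jc_two] <;> ring
lemma Jc_add_right (f g h : P3) : Jc f (g + h) = Jc f g + Jc f h := by
  apply ext3 <;> simp [Jc_zero, Jc_one, Jc_two] <;> ring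
lemma Jc_add_left (f g h : P3) : Jc (f + g) h = Jc f h + Jc g h := by
  apply ext3 <;> simp [Jc_zero, Jc_one, Jc_two] <;> ring
lemma Jc_smul_right (c : ℂ) (f g : P3) : Jc f (c • g) = c • Jc f g := by
  apply ext3 <;> simp [Jc_zero, Jc_one, Jc_two, smul_eq_C_mul] <;> ring
lemma Jc_smul_left (c : ℂ) (f g : P3) : Jc (c • f) g = c • Jc f g := by
  apply ext3 <;> simp [Jc_zero, Jc_one, Jc_two, smul_eq_C_mul] <;> ring
lemma Jc_sub_right (f g h : P3) : Jc f (g - h) = Jc f g - Jc f h := by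
  apply ext3 <;> simp [Jc_zero, Jc_one, Jc_two] <;> ring
lemma Jc_sub_left (f g h : P3) : Jc (f - g) h = Jc f h - Jc g h := by
  apply ext3 <;> simp [Jc_zero, Jc_one, Jc_two] <;> ring
lemma Jc_C_right (c : ℂ) (f : P3) : Jc f (C c) = 0 := by
  apply ext3 <;> simp [Jc_zero, Jc_one, Jc_two]
lemma Jc_C_left (c : ℂ) (f : P3) : Jc (C c) f = 0 := by
  apply ext3 <;> simp [Jc_zero, Jc_one, Jc_two]

/-- evaluation of a two-variable polynomial -/
noncomputable def ev (f g : P3) : MvPolynomial (Fin 2) ℂ →ₐ[ℂ] P3 := aeval ![f, g]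

@[simp] lemma ev_C (f g : P3) (c : ℂ) : ev f g (C c) = C c := by
  simp [ev, MvPolynomial.algebraMap_eq]
@[simp] lemma ev_X0 (f g : P3) : ev f g (X 0) = f := by simp [ev]
@[simp] lemma ev_X1 (f g : P3) : ev f g (X 1) = g := by simp [ev]

lemma ev_monomial (f g : P3) (u : Fin 2 →₀ ℕ) (a : ℂ) :
    ev f g (monomial u a) = a • (f ^ u 0 * g ^ u 1) := by
  rw [ev, aeval_monomial, Finsupp.prod_fintype _ _ (by simp)]
  simp [Algebra.smul_def]

lemma der_ev (d : Derivation ℂ P3 P3) (f g : P3) (φ : MvPolynomial (Fin 2) ℂ) :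
    d (ev f g φ) = ev f g (pderiv 0 φ) * d f + ev f g (pderiv 1 φ) * d g := by
  induction φ using MvPolynomial.induction_on with
  | C a => simp [← MvPolynomial.algebraMap_eq]
  | add p q hp hq => simp only [map_add, hp, hq]; ring
  | mul_X p n hp =>
    simp only [map_mul, Derivation.leibniz, hp, smul_eq_mul, map_add, smul_eq_mul]
    fin_cases n
    · simp; ring
    · simp; ring

lemma Jc_ev_left (f g h : P3) (φ : MvPolynomial (Fin 2) ℂ) :
    Jc (ev f g φ) h = ev f g (pderiv 0 φ) • Jc f h + ev f g (pderiv 1 φ) • Jc g h := by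
  apply ext3 <;> simp [Jc_zero, Jc_one, Jc_two, der_ev] <;> ring

lemma Jc_mul_left (f g h : P3) : Jc (f * g) h = f • Jc g h + g • Jc f h := by
  apply ext3 <;> simp [Jc_zero, Jc_one, Jc_two] <;> ring

/-- determinant -/
noncomputable def Det (a b c : P3) : P3 := Jc a b 0 * lD 0 c + Jc a b 1 * lD 1 c + Jc a b 2 * lD 2 c

def Tri (a b c : P3) : Prop := ∃ k : ℂ, k ≠ 0 ∧ Det a b c = C k * (X 0 * X 1 * X 2)

lemma Det_rot (a b c : P3) : Det b c a = Det a b c := by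
  simp [Det, Jc_zero, Jc_one, Jc_two]; ring
lemma Det_swap (a b c : P3) : Det b a c = - Det a b c := by
  simp [Det, Jc_zero, Jc_one, Jc_two]; ring

lemma Tri.rot {a b c : P3} (h : Tri a b c) : Tri b c a := by
  obtain ⟨k, hk, h⟩ := h
  exact ⟨k, hk, by rw [Det_rot, h]⟩
lemma Tri.swap {a b c : P3} (h : Tri a b c) : Tri b a c := by
  obtain ⟨k, hk, h⟩ := h
  exact ⟨-k, neg_ne_zero.2 hk, by rw [Det_swap, h]; simp⟩
lemma Tri.swap23 {a b c : P3} (h : Tri a b c) : Tri a c b := h.swap.rot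

lemma Tri.swap13 {a b c : P3} (h : Tri a b c) : Tri c b a := h.rot.swap

lemma Tri.ne {a b c : P3} (h : Tri a b c) : Det a b c ≠ 0 := by
  obtain ⟨k, hk, h⟩ := h
  rw [h]
  exact mul_ne_zero (by simpa using hk) (mul_ne_zero (mul_ne_zero (X_ne_zero _) (X_ne_zero _)) (X_ne_zero _))

lemma Tri.Jc_ne {a b c : P3} (h : Tri a b c) : Jc a b ≠ 0 := by
  intro h0
  apply h.ne
  simp [Det, h0]

lemma Tri.add_ev {a b c : P3} (h : Tri a b c) (φ : MvPolynomial (Fin 2) ℂ) : Tri a b (c + ev a b φ) := by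
  obtain ⟨k, hk, h⟩ := h
  refine ⟨k, hk, ?_⟩
  rw [← h]
  simp only [Det, Jc_zero, Jc_one, Jc_two, map_add, der_ev]; ring

lemma Det_eq (a b c : P3) : Det a b c = (Matrix.of fun i j => lD j (![a, b, c] i)).det := by
  rw [Matrix.det_fin_three]
  simp [Det, Jc_zero, Jc_one, Jc_two]; ring

/-- change of basis -/
lemma Det_lin (a b c : P3) (m : Fin 3 → Fin 3 → ℂ) (k0 k1 k2 : ℂ) :
    Det (m 0 0 • a + m 0 1 • b + m 0 2 • c + C k0) (m 1 0 • a + m 1 1 • b + m 1 2 • c + C k1)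
      (m 2 0 • a + m 2 1 • b + m 2 2 • c + C k2) = C ((Matrix.of m).det) * Det a b c := by
  rw [Det_eq, Det_eq, RingHom.map_det, ← Matrix.det_mul]
  congr 1
  refine Matrix.ext fun i j => ?_
  fin_cases i <;>
    simp [Matrix.mul_apply, Fin.sum_univ_three, smul_eq_C_mul]

namespace Wt
variable (θ : Wt)

lemma deg_lD_le (i : Fin 3) (f : P3) : θ.deg (lD i f) ≤ θ.deg f := by
  apply θ.deg_le (θ.deg_nonneg f)
  intro m hm
  apply θ.le_deg
  rw [mem_support_iff, coeff_lD] at *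
  exact right_ne_zero_of_mul hm

lemma exists_deg_lD {f : P3} (h : 0 < θ.deg f) : ∃ i, lD i f ≠ 0 ∧ θ.deg (lD i f) = θ.deg f := by
  obtain ⟨m, hm, e⟩ := θ.exists_lead (θ.ne_zero_of_deg_pos h)
  have hm0 : m ≠ 0 := by rintro rfl; rw [θ.W_zero] at e; linarith
  obtain ⟨i, hi⟩ := Finsupp.ne_iff.1 hm0
  have hs : m ∈ (lD i f).support := by
    rw [mem_support_iff, coeff_lD] at *
    exact mul_ne_zero (by exact_mod_cast hi) hm
  refine ⟨i, ?_, le_antisymm (θ.deg_lD_le i f) (e ▸ θ.le_deg hs)⟩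
  rintro h0; rw [h0] at hs; simp at hs

/-- Euler operator -/
noncomputable def Eu (f : P3) : P3 :=
  C (θ.w 0 : ℂ) * lD 0 f + C (θ.w 1 : ℂ) * lD 1 f + C (θ.w 2 : ℂ) * lD 2 f

lemma coeff_Eu (f : P3) (m) : coeff m (θ.Eu f) = (θ.W m : ℂ) * coeff m f := by
  simp only [Eu, coeff_add, coeff_C_mul, coeff_lD, W, Fin.sum_univ_three]
  push_cast; ring

lemma deg_Eu_le (f : P3) : θ.deg (θ.Eu f) ≤ θ.deg f := by
  apply θ.deg_le (θ.deg_nonneg f)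
  intro m hm
  apply θ.le_deg
  rw [mem_support_iff, coeff_Eu] at *
  exact right_ne_zero_of_mul hm

lemma deg_Eu {f : P3} (h : 0 < θ.deg f) : θ.Eu f ≠ 0 ∧ θ.deg (θ.Eu f) = θ.deg f := by
  obtain ⟨m, hm, e⟩ := θ.exists_lead (θ.ne_zero_of_deg_pos h)
  have hs : m ∈ (θ.Eu f).support := by
    rw [mem_support_iff, coeff_Eu] at *
    exact mul_ne_zero (by rw [e]; exact_mod_cast h.ne') hm
  refine ⟨?_, le_antisymm (θ.deg_Eu_le f) (e ▸ θ.le_deg hs)⟩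
  rintro h0; rw [h0] at hs; simp at hs

noncomputable def vdeg (v : Fin 3 → P3) : ℝ := max (max (θ.deg (v 0)) (θ.deg (v 1))) (θ.deg (v 2))

lemma vdeg_le_iff {v : Fin 3 → P3} {r : ℝ} : θ.vdeg v ≤ r ↔ ∀ p, θ.deg (v p) ≤ r := by
  simp [vdeg, Fin.forall_fin_succ, and_assoc]

lemma le_vdeg (v : Fin 3 → P3) (p : Fin 3) : θ.deg (v p) ≤ θ.vdeg v := θ.vdeg_le_iff.1 le_rfl p

lemma vdeg_nonneg (v : Fin 3 → P3) : 0 ≤ θ.vdeg v := (θ.deg_nonneg _).trans (θ.le_vdeg v 0)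

lemma exists_vdeg {v : Fin 3 → P3} (hv : v ≠ 0) : ∃ p, v p ≠ 0 ∧ θ.deg (v p) = θ.vdeg v := by
  by_cases h0 : θ.vdeg v = 0
  · obtain ⟨p, hp⟩ := Function.ne_iff.1 hv
    exact ⟨p, hp, le_antisymm (θ.le_vdeg v p) (h0 ▸ θ.deg_nonneg _)⟩
  · have hpos := lt_of_le_of_ne (θ.vdeg_nonneg v) (Ne.symm h0)
    have : ∃ p, θ.deg (v p) = θ.vdeg v := by
      by_contra hcon
      push Not at hcon
      have : θ.vdeg v < θ.vdeg v := by
        conv_lhs => unfold vdeg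
        have := fun p => lt_of_le_of_ne (θ.le_vdeg v p) (hcon p)
        exact max_lt (max_lt (this 0) (this 1)) (this 2)
      exact lt_irrefl _ this
    obtain ⟨p, hp⟩ := this
    exact ⟨p, θ.ne_zero_of_deg_pos (hp ▸ hpos), hp⟩

lemma vdeg_zero : θ.vdeg 0 = 0 := by simp [vdeg, θ.deg_zero]

lemma vdeg_neg (v : Fin 3 → P3) : θ.vdeg (-v) = θ.vdeg v := by simp [vdeg, θ.deg_neg]

lemma vdeg_add_le (u v : Fin 3 → P3) : θ.vdeg (u + v) ≤ max (θ.vdeg u) (θ.vdeg v) := by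
  rw [vdeg_le_iff]; intro p
  exact (θ.deg_add_le _ _).trans (max_le_max (θ.le_vdeg u p) (θ.le_vdeg v p))

lemma vdeg_sub_le (u v : Fin 3 → P3) : θ.vdeg (u - v) ≤ max (θ.vdeg u) (θ.vdeg v) := by
  rw [sub_eq_add_neg, ← θ.vdeg_neg v]; exact θ.vdeg_add_le _ _

lemma vdeg_add_eq {u v : Fin 3 → P3} (h : θ.vdeg v < θ.vdeg u) : θ.vdeg (u + v) = θ.vdeg u := by
  apply le_antisymm
  · exact (θ.vdeg_add_le u v).trans (max_le le_rfl h.le)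
  · by_contra hlt
    push Not at hlt
    have h1 := θ.vdeg_sub_le (u + v) v
    rw [add_sub_cancel_right] at h1
    have := max_lt hlt h
    linarith

lemma vdeg_smulC {c : ℂ} (hc : c ≠ 0) (v : Fin 3 → P3) : θ.vdeg (c • v) = θ.vdeg v := by
  simp [vdeg, θ.deg_smul hc]

lemma vdeg_smulC_le (c : ℂ) (v : Fin 3 → P3) : θ.vdeg (c • v) ≤ θ.vdeg v := by
  rw [vdeg_le_iff]; intro p
  exact (θ.deg_smul_le c _).trans (θ.le_vdeg v p)

lemma vdeg_smul_le (f : P3) (v : Fin 3 → P3) : θ.vdeg (f • v) ≤ θ.deg f + θ.vdeg v := by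
  rw [vdeg_le_iff]; intro p
  have := θ.le_vdeg v p
  refine (θ.deg_mul_le f (v p)).trans (by linarith)

lemma vdeg_smul {f : P3} {v : Fin 3 → P3} (hf : f ≠ 0) (hv : v ≠ 0) :
    θ.vdeg (f • v) = θ.deg f + θ.vdeg v := by
  apply le_antisymm (θ.vdeg_smul_le f v)
  obtain ⟨p, hp, e⟩ := θ.exists_vdeg hv
  rw [← e, ← θ.deg_mul hf hp]
  exact θ.le_vdeg (f • v) p

noncomputable def om (f g : P3) : ℝ := θ.vdeg (Jc f g)

lemma om_comm (f g : P3) : θ.om f g = θ.om g f := by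
  unfold om; rw [Jc_swap, θ.vdeg_neg]

lemma om_le (f g : P3) : θ.om f g ≤ θ.deg f + θ.deg g := by
  have key : ∀ i j, θ.deg (lD i f * lD j g) ≤ θ.deg f + θ.deg g := fun i j =>
    (θ.deg_mul_le _ _).trans (add_le_add (θ.deg_lD_le i f) (θ.deg_lD_le j g))
  have key2 : ∀ i j i' j', θ.deg (lD i f * lD j g - lD i' f * lD j' g) ≤ θ.deg f + θ.deg g :=
    fun i j i' j' => (θ.deg_sub_le _ _).trans (max_le (key _ _) (key _ _))
  unfold om; rw [vdeg_le_iff]; intro p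
  fin_cases p <;> exact key2 _ _ _ _

lemma two_le_of_dvd {f : P3} {i j : Fin 3} (hf : X i * X j ∣ f) (h0 : f ≠ 0) : 2 ≤ θ.deg f := by
  obtain ⟨g, rfl⟩ := hf
  have hg := right_ne_zero_of_mul h0
  rw [θ.deg_mul (left_ne_zero_of_mul h0) hg, θ.deg_mul (X_ne_zero _) (X_ne_zero _), θ.deg_X, θ.deg_X]
  linarith [θ.one_le i, θ.one_le j, θ.deg_nonneg g]

lemma two_le_om {f g : P3} (h : Jc f g ≠ 0) : 2 ≤ θ.om f g := by
  obtain ⟨p, hp, e⟩ := θ.exists_vdeg h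
  unfold om; rw [← e]
  fin_cases p
  · refine θ.two_le_of_dvd (i := 1) (j := 2) ?_ hp
    simp only [Fin.zero_eta, Jc_zero, lD_apply]
    exact ⟨pderiv 1 f * pderiv 2 g - pderiv 2 f * pderiv 1 g, by ring⟩
  · refine θ.two_le_of_dvd (i := 2) (j := 0) ?_ hp
    simp only [Fin.mk_one, Jc_one, lD_apply]
    exact ⟨pderiv 2 f * pderiv 0 g - pderiv 0 f * pderiv 2 g, by ring⟩
  · refine θ.two_le_of_dvd (i := 0) (j := 1) ?_ hp
    simp only [Fin.reduceFinMk, Jc_two, lD_apply]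
    exact ⟨pderiv 0 f * pderiv 1 g - pderiv 1 f * pderiv 0 g, by ring⟩

noncomputable def W0 : ℝ := θ.w 0 + θ.w 1 + θ.w 2

lemma W0_ge : 3 ≤ θ.W0 := by unfold W0; linarith [θ.one_le 0, θ.one_le 1, θ.one_le 2]
lemma W0_le : θ.W0 ≤ 33/10 := by unfold W0; linarith [θ.le 0, θ.le 1, θ.le 2]

lemma deg_Det {a b c : P3} (h : Tri a b c) : θ.deg (Det a b c) = θ.W0 := by
  obtain ⟨k, hk, e⟩ := h
  have hX : ∀ i : Fin 3, (X i : P3) ≠ 0 := fun i => X_ne_zero _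
  rw [e, θ.deg_mul (by simpa using hk) (mul_ne_zero (mul_ne_zero (hX 0) (hX 1)) (hX 2)),
    θ.deg_mul (mul_ne_zero (hX 0) (hX 1)) (hX 2), θ.deg_mul (hX 0) (hX 1), θ.deg_C, θ.deg_X, θ.deg_X, θ.deg_X]
  unfold W0; ring

lemma Tri_deg_pos {a b c : P3} (h : Tri a b c) : 0 < θ.deg a := by
  by_contra hcon
  push Not at hcon
  obtain ⟨k, rfl⟩ := θ.eq_C_of_deg_lt (f := a) (by linarith)
  exact h.Jc_ne (Jc_C_left _ _)

/-- two maxima -/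
lemma TM {a b c : P3} (h : Tri a b c) :
    θ.deg a + θ.om b c ≤ max (max (θ.deg b + θ.om a c) (θ.deg c + θ.om a b)) θ.W0 := by
  have hbc := h.rot.Jc_ne
  obtain ⟨p, hp, e⟩ := θ.exists_vdeg hbc
  obtain ⟨hE, hEd⟩ := θ.deg_Eu (θ.Tri_deg_pos h)
  have key : Jc b c p * θ.Eu a = C (θ.w p : ℂ) * Det a b c + (Jc a c p * θ.Eu b - Jc a b p * θ.Eu c) := by
    fin_cases p <;> simp [Det, Jc_zero, Jc_one, Jc_two, Eu] <;> ring
  have h1 : θ.deg (Jc b c p * θ.Eu a) = θ.om b c + θ.deg a := by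
    rw [θ.deg_mul hp hE, e, hEd]; rfl
  have h2 : θ.deg (C (θ.w p : ℂ) * Det a b c) ≤ θ.W0 := by
    refine (θ.deg_mul_le _ _).trans ?_
    rw [θ.deg_C, θ.deg_Det h]; linarith
  have h3 : θ.deg (Jc a c p * θ.Eu b) ≤ θ.deg b + θ.om a c := by
    refine (θ.deg_mul_le _ _).trans ?_
    have := θ.le_vdeg (Jc a c) p
    have := θ.deg_Eu_le b
    unfold om; linarith
  have h4 : θ.deg (Jc a b p * θ.Eu c) ≤ θ.deg c + θ.om a b := by
    refine (θ.deg_mul_le _ _).trans ?_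
    have := θ.le_vdeg (Jc a b) p
    have := θ.deg_Eu_le c
    unfold om; linarith
  rw [add_comm, ← h1, key]
  refine (θ.deg_add_le _ _).trans (max_le (h2.trans (le_max_right _ _)) ?_)
  exact ((θ.deg_sub_le _ _).trans (max_le_max h3 h4)).trans (le_max_left _ _)

lemma cross {a b c : P3} (h : Tri a b c) : θ.W0 + θ.deg a ≤ θ.om a b + θ.om a c := by
  obtain ⟨p, hp, e⟩ := θ.exists_deg_lD (θ.Tri_deg_pos h)
  have key : ∃ q r, Det a b c * lD p a = Jc a b q * Jc a c r - Jc a b r * Jc a c q := by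
    fin_cases p
    · refine ⟨1, 2, ?_⟩; simp [Det, Jc_zero, Jc_one, Jc_two]; ring
    · refine ⟨2, 0, ?_⟩; simp [Det, Jc_zero, Jc_one, Jc_two]; ring
    · refine ⟨0, 1, ?_⟩; simp [Det, Jc_zero, Jc_one, Jc_two]; ring
  obtain ⟨q, r, hqr⟩ := key
  have h1 : θ.deg (Det a b c * lD p a) = θ.W0 + θ.deg a := by
    rw [θ.deg_mul h.ne hp, θ.deg_Det h, e]
  rw [← h1, hqr]
  have hh : ∀ q r, θ.deg (Jc a b q * Jc a c r) ≤ θ.om a b + θ.om a c := fun q r =>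
    (θ.deg_mul_le _ _).trans (add_le_add (θ.le_vdeg _ q) (θ.le_vdeg _ r))
  exact (θ.deg_sub_le _ _).trans (max_le (hh _ _) (hh _ _))

end Wt


abbrev P2 := MvPolynomial (Fin 2) ℂ

lemma Jc_ne_left {f g : P3} (h : Jc f g ≠ 0) (c : ℂ) : f ≠ C c := by
  rintro rfl; exact h (Jc_C_left _ _)

lemma coeff_X_mul_pderiv (i : Fin 2) (f : P2) (m : Fin 2 →₀ ℕ) :
    coeff m (X i * pderiv i f) = m i * coeff m f := by
  induction f using MvPolynomial.induction_on' with
  | monomial u a =>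
    rw [pderiv_monomial, X, monomial_mul, coeff_monomial, coeff_monomial]
    by_cases hu : u i = 0
    · by_cases h : u = m
      · subst h; simp [hu]
      · simp [hu, h]
    · have : Finsupp.single i 1 + (u - Finsupp.single i 1) = u := by
        apply add_tsub_cancel_of_le
        rw [Finsupp.single_le_iff]; omega
      rw [this]
      by_cases h : u = m
      · subst h; simp [mul_comm]
      · simp [h]
  | add p q hp hq => simp [map_add, mul_add, hp, hq]

lemma coeff_pderiv' (i : Fin 2) (φ : P2) (m : Fin 2 →₀ ℕ) :
    coeff m (pderiv i φ) = ((m i + 1 : ℕ) : ℂ) * coeff (m + Finsupp.single i 1) φ := by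
  have := coeff_X_mul_pderiv i φ (m + Finsupp.single i 1)
  rw [add_comm m, coeff_X_mul] at this
  rw [this, add_comm m]
  congr 2
  simp; ring

lemma totalDegree_pderiv_le' (i : Fin 2) (φ : P2) (n : ℕ) (h : φ.totalDegree ≤ n + 1) :
    (pderiv i φ).totalDegree ≤ n := by
  apply Finset.sup_le
  intro m hm
  rw [mem_support_iff, coeff_pderiv'] at hm
  have h1 := le_totalDegree (mem_support_iff.2 (right_ne_zero_of_mul hm))
  rw [Finsupp.sum_add_index' (by simp) (by simp)] at h1
  simp at h1 ⊢
  omega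

namespace Wt
variable (θ : Wt)

lemma Jc_pos_left {f g : P3} (h : Jc f g ≠ 0) : 1 ≤ θ.deg f := by
  apply θ.deg_pos_iff_one_le
  by_contra hcon
  obtain ⟨c, hc⟩ := θ.eq_C_of_deg_lt (f := f) (by linarith)
  exact Jc_ne_left h c hc

lemma Jc_ne_swap {f g : P3} (h : Jc f g ≠ 0) : Jc g f ≠ 0 := by
  rw [Jc_swap]; exact neg_ne_zero.2 h

lemma Jc_pos_right {f g : P3} (h : Jc f g ≠ 0) : 1 ≤ θ.deg g := θ.Jc_pos_left (Jc_ne_swap h)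

/-- weight of a monomial in `f,g`. -/
noncomputable def mw (f g : P3) (u : Fin 2 →₀ ℕ) : ℝ := u 0 * θ.deg f + u 1 * θ.deg g

lemma mw_nonneg (f g : P3) (u) : 0 ≤ θ.mw f g u :=
  add_nonneg (mul_nonneg (Nat.cast_nonneg _) (θ.deg_nonneg f)) (mul_nonneg (Nat.cast_nonneg _) (θ.deg_nonneg g))

lemma deg_mon (f g : P3) (hf : f ≠ 0) (hg : g ≠ 0) (u : Fin 2 →₀ ℕ) {a : ℂ} (ha : a ≠ 0) :
    θ.deg (ev f g (monomial u a)) = θ.mw f g u := by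
  rw [ev_monomial, θ.deg_smul ha, θ.deg_mul (pow_ne_zero _ hf) (pow_ne_zero _ hg), θ.deg_pow, θ.deg_pow]; rfl

lemma deg_mon_le (f g : P3) (u : Fin 2 →₀ ℕ) (a : ℂ) :
    θ.deg (ev f g (monomial u a)) ≤ θ.mw f g u := by
  rw [ev_monomial]
  refine (θ.deg_smul_le _ _).trans ((θ.deg_mul_le _ _).trans ?_)
  rw [θ.deg_pow, θ.deg_pow]; rfl

lemma deg_sum_le {ι : Type*} (s : Finset ι) (F : ι → P3) {r : ℝ} (hr : 0 ≤ r)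
    (h : ∀ i ∈ s, θ.deg (F i) ≤ r) : θ.deg (∑ i ∈ s, F i) ≤ r := by
  classical
  induction s using Finset.induction_on with
  | empty => simpa [θ.deg_zero] using hr
  | insert a s ha ih =>
    rw [Finset.sum_insert ha]
    refine (θ.deg_add_le _ _).trans (max_le (h a (by simp)) (ih fun i hi => h i (by simp [hi])))

lemma deg_ev_le (f g : P3) (φ : P2) {r : ℝ} (hr : 0 ≤ r) (h : ∀ u ∈ φ.support, θ.mw f g u ≤ r) :
    θ.deg (ev f g φ) ≤ r := by
  conv_lhs => rw [φ.as_sum]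
  rw [map_sum]
  exact θ.deg_sum_le _ _ hr fun u hu => (θ.deg_mon_le f g u _).trans (h u hu)

lemma deg_ev_lt (f g : P3) (φ : P2) {r : ℝ} (hr : 0 < r) (h : ∀ u ∈ φ.support, θ.mw f g u < r) :
    θ.deg (ev f g φ) < r := by
  by_cases hs : φ.support.Nonempty
  · obtain ⟨m, hm, hmax⟩ := Finset.exists_max_image φ.support (θ.mw f g) hs
    exact lt_of_le_of_lt (θ.deg_ev_le f g φ (θ.mw_nonneg f g m) hmax) (h m hm)
  · rw [Finset.not_nonempty_iff_eq_empty, MvPolynomial.support_eq_empty] at hs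
    rw [hs, map_zero, θ.deg_zero]; exact hr

/-- unique top monomial -/
lemma deg_ev_top {f g : P3} (hf : f ≠ 0) (hg : g ≠ 0) {φ : P2} {u : Fin 2 →₀ ℕ} (hu : u ∈ φ.support)
    (h : ∀ v ∈ φ.support, v ≠ u → θ.mw f g v < θ.mw f g u) : θ.deg (ev f g φ) = θ.mw f g u := by
  rcases (θ.mw_nonneg f g u).eq_or_lt with h0 | hpos
  · rw [← h0]
    refine le_antisymm (θ.deg_ev_le f g φ le_rfl ?_) (θ.deg_nonneg _)
    intro v hv
    by_cases hvu : v = u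
    · rw [hvu, ← h0]
    · rw [h0]; exact (h v hv hvu).le
  have e : φ = monomial u (coeff u φ) + (φ - monomial u (coeff u φ)) := by ring
  have hd := θ.deg_mon f g hf hg u (mem_support_iff.1 hu)
  rw [e, map_add, θ.deg_add_eq, hd]
  rw [hd]
  apply θ.deg_ev_lt _ _ _ hpos
  intro v hv
  rw [mem_support_iff, coeff_sub, coeff_monomial] at hv
  by_cases hvu : u = v
  · subst hvu; simp at hv
  · simp only [hvu, if_false, sub_zero] at hv
    exact h v (mem_support_iff.2 hv) (Ne.symm hvu)

lemma deg_pd0 {f g : P3} (h : Jc f g ≠ 0) {φ : P2} (hφ : ev f g (pderiv 0 φ) ≠ 0) :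
    θ.deg (ev f g (pderiv 0 φ)) + θ.om f g ≤ θ.deg (ev f g φ) + θ.deg g := by
  have e : Jc (ev f g φ) g = ev f g (pderiv 0 φ) • Jc f g := by
    rw [Jc_ev_left, Jc_self, smul_zero, add_zero]
  have h1 := θ.vdeg_smul hφ h
  rw [← e] at h1
  have := θ.om_le (ev f g φ) g
  unfold om at *; linarith

lemma deg_pd1 {f g : P3} (h : Jc f g ≠ 0) {φ : P2} (hφ : ev f g (pderiv 1 φ) ≠ 0) :
    θ.deg (ev f g (pderiv 1 φ)) + θ.om f g ≤ θ.deg (ev f g φ) + θ.deg f := by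
  have e : Jc (ev f g φ) f = ev f g (pderiv 1 φ) • Jc g f := by
    rw [Jc_ev_left, Jc_self, smul_zero, zero_add]
  have h1 := θ.vdeg_smul hφ (Jc_ne_swap h)
  rw [← e] at h1
  have := θ.om_le (ev f g φ) f
  rw [θ.om_comm f g]
  unfold om at *; linarith

lemma mw_ext {f g : P3} (hg : 0 < θ.deg g) {u v : Fin 2 →₀ ℕ} (h : θ.mw f g u = θ.mw f g v)
    (h0 : u 0 = v 0) : u = v := by
  unfold mw at h
  rw [h0] at h
  have : (u 1 : ℝ) = v 1 := by
    have h1 : (u 1 : ℝ) * θ.deg g = v 1 * θ.deg g := by linarith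
    exact mul_right_cancel₀ hg.ne' h1
  ext i; fin_cases i
  · exact h0
  · exact_mod_cast this

open Classical in
/-- the Shestakov-Umirbaev type inequality -/
lemma su {f g : P3} (h : Jc f g ≠ 0) (n : ℕ) : ∀ (φ : P2) (L : ℝ), (∀ u ∈ φ.support, θ.mw f g u ≤ L) →
    (φ.support.filter fun u => θ.mw f g u = L).card = n + 1 →
    L ≤ θ.deg (ev f g φ) + n * (θ.deg f + θ.deg g - θ.om f g) := by
  have hf := θ.Jc_pos_left h
  have hg := θ.Jc_pos_right h
  have hf0 := θ.ne_zero_of_deg_pos (by linarith : 0 < θ.deg f)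
  have hg0 := θ.ne_zero_of_deg_pos (by linarith : 0 < θ.deg g)
  induction n with
  | zero =>
    intro φ L hL hT
    obtain ⟨u, hu⟩ := Finset.card_eq_one.1 hT
    have hu' : u ∈ φ.support.filter fun u => θ.mw f g u = L := by rw [hu]; simp
    rw [Finset.mem_filter] at hu'
    have := θ.deg_ev_top hf0 hg0 hu'.1 (by
      intro v hv hne
      rw [hu'.2]
      refine lt_of_le_of_ne (hL v hv) fun heq => hne ?_
      have : v ∈ φ.support.filter fun u => θ.mw f g u = L := Finset.mem_filter.2 ⟨hv, heq⟩
      rw [hu] at this; simpa using this)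
    rw [this, hu'.2]; simp
  | succ n ih =>
    intro φ L hL hT
    have hne : (φ.support.filter fun u => θ.mw f g u = L).Nonempty := by
      rw [← Finset.card_pos]; omega
    obtain ⟨u, hu⟩ := hne
    have hu' := Finset.mem_filter.1 hu
    set ψ : P2 := X 0 * pderiv 0 φ - C (u 0 : ℂ) * φ with hψ
    have hc : ∀ v, coeff v ψ = ((v 0 : ℂ) - u 0) * coeff v φ := by
      intro v; rw [hψ, coeff_sub, coeff_X_mul_pderiv, coeff_C_mul]; ring
    have hT' : (ψ.support.filter fun v => θ.mw f g v = L) = (φ.support.filter fun v => θ.mw f g v = L).erase u := by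
      ext v
      simp only [Finset.mem_filter, Finset.mem_erase, mem_support_iff, hc]
      constructor
      · rintro ⟨h1, h2⟩
        refine ⟨?_, right_ne_zero_of_mul h1, h2⟩
        rintro rfl; simp at h1
      · rintro ⟨h1, h2, h3⟩
        refine ⟨mul_ne_zero ?_ h2, h3⟩
        intro h4
        apply h1
        apply θ.mw_ext (by linarith : 0 < θ.deg g) (h3.trans hu'.2.symm)
        have : (v 0 : ℂ) = u 0 := sub_eq_zero.1 h4
        exact_mod_cast this
    have h1 := ih ψ L (by
      intro v hv
      rw [mem_support_iff, hc] at hv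
      exact hL v (mem_support_iff.2 (right_ne_zero_of_mul hv))) (by
      rw [hT', Finset.card_erase_of_mem hu, hT]; rfl)
    have homle := θ.om_le f g
    have h2 : θ.deg (ev f g ψ) ≤ θ.deg (ev f g φ) + (θ.deg f + θ.deg g - θ.om f g) := by
      rw [hψ, map_sub, map_mul, map_mul, ev_X0, ev_C]
      refine (θ.deg_sub_le _ _).trans (max_le ?_ ?_)
      · by_cases h0 : ev f g (pderiv 0 φ) = 0
        · rw [h0, mul_zero, θ.deg_zero]; linarith [θ.deg_nonneg (ev f g φ)]
        · rw [θ.deg_mul hf0 h0]; linarith [θ.deg_pd0 h h0]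
      · refine (θ.deg_mul_le _ _).trans ?_
        rw [θ.deg_C]; linarith
    push_cast
    linarith

/-- cancellation data -/
structure Canc (f g : P3) (φ : P2) (p q k i j : ℕ) (ε : ℝ) : Prop where
  cop : Nat.Coprime p q
  hp : 1 ≤ p
  hq : 1 ≤ q
  hk : 1 ≤ k
  hε : 0 < ε
  hf : θ.deg f = p * ε
  hg : θ.deg g = q * ε
  le : ∀ u ∈ φ.support, θ.mw f g u ≤ (k * p * q) * ε + i * θ.deg f + j * θ.deg g
  su : (k * p * q) * ε + i * θ.deg f + j * θ.deg g ≤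
    θ.deg (ev f g φ) + k * (θ.deg f + θ.deg g - θ.om f g)
  mem1 : ∃ u ∈ φ.support, u 0 = i ∧ u 1 = j + k * p
  mem2 : ∃ u ∈ φ.support, u 0 = i + k * q ∧ u 1 = j
  top : ∀ u ∈ φ.support, θ.mw f g u = (k * p * q) * ε + i * θ.deg f + j * θ.deg g →
    ∃ t ≤ k, u 0 = i + t * q ∧ u 1 = j + (k - t) * p

open Classical in
lemma su_cases {f g : P3} (h : Jc f g ≠ 0) (φ : P2) :
    (∀ u ∈ φ.support, θ.mw f g u ≤ θ.deg (ev f g φ)) ∨ ∃ p q k i j ε, θ.Canc f g φ p q k i j ε := by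
  have hf := θ.Jc_pos_left h
  have hg := θ.Jc_pos_right h
  by_cases hs : φ.support.Nonempty
  swap
  · left; intro u hu; exact absurd ⟨u, hu⟩ hs
  obtain ⟨m, hm, hmax⟩ := Finset.exists_max_image φ.support (θ.mw f g) hs
  set L := θ.mw f g m with hL
  set T := φ.support.filter fun u => θ.mw f g u = L with hT
  have hmT : m ∈ T := Finset.mem_filter.2 ⟨hm, rfl⟩
  have hcard : 1 ≤ T.card := Finset.card_pos.2 ⟨m, hmT⟩
  obtain ⟨n, hn⟩ : ∃ n, T.card = n + 1 := ⟨T.card - 1, by omega⟩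
  have hsu := θ.su h n φ L hmax hn
  rcases Nat.eq_zero_or_pos n with rfl | hnpos
  · left; intro u hu; refine (hmax u hu).trans ?_; simpa using hsu
  right
  obtain ⟨a, ha, hamin⟩ := Finset.exists_min_image T (fun u => u 0) ⟨m, hmT⟩
  obtain ⟨b, hb, hbmax⟩ := Finset.exists_max_image T (fun u => u 0) ⟨m, hmT⟩
  have hTL : ∀ u ∈ T, (u 0 : ℝ) * θ.deg f + u 1 * θ.deg g = L := fun u hu => (Finset.mem_filter.1 hu).2
  have hinj : Set.InjOn (fun u : Fin 2 →₀ ℕ => u 0) T := by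
    intro u hu v hv huv
    exact θ.mw_ext (by linarith : 0 < θ.deg g)
      ((Finset.mem_filter.1 hu).2.trans (Finset.mem_filter.1 hv).2.symm) huv
  have hab : a 0 < b 0 := by
    by_contra hcon
    push Not at hcon
    have hsub : T.card ≤ 1 := by
      rw [Finset.card_le_one]
      intro u hu v hv
      apply hinj hu hv
      have := hamin u hu; have := hamin v hv; have := hbmax u hu; have := hbmax v hv
      simp only at *; omega
    omega
  have eab : (b 0 - a 0 : ℝ) * θ.deg f = (a 1 - b 1 : ℝ) * θ.deg g := by
    have := hTL a ha; have := hTL b hb; linarith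
  have hab1 : b 1 < a 1 := by
    have h1 : (a 0 : ℝ) < b 0 := by exact_mod_cast hab
    have h2 : 0 < (b 0 - a 0 : ℝ) * θ.deg f := by apply mul_pos <;> linarith
    rw [eab] at h2
    have h3 : (0:ℝ) < a 1 - b 1 := by
      by_contra h3
      push Not at h3
      nlinarith
    have : (b 1 : ℝ) < a 1 := by linarith
    exact_mod_cast this
  obtain ⟨x, hx⟩ : ∃ x, b 0 = a 0 + x := ⟨b 0 - a 0, by omega⟩
  obtain ⟨y, hy⟩ : ∃ y, a 1 = b 1 + y := ⟨a 1 - b 1, by omega⟩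
  have hxpos : 0 < x := by omega
  have hypos : 0 < y := by omega
  have exy : (x : ℝ) * θ.deg f = y * θ.deg g := by
    rw [hx, hy] at eab; push_cast at eab; linarith
  obtain ⟨k, q, p, hkpos, hcop, exk, eyk⟩ : ∃ k q p, 0 < k ∧ Nat.Coprime q p ∧ x = q * k ∧ y = p * k := by
    obtain ⟨q, p, hc, e1, e2⟩ := Nat.exists_coprime x y
    exact ⟨_, q, p, Nat.gcd_pos_of_pos_left _ hxpos, hc, e1, e2⟩
  have hqpos : 0 < q := Nat.pos_of_ne_zero (by rintro rfl; omega)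
  have hppos : 0 < p := Nat.pos_of_ne_zero (by rintro rfl; omega)
  have epq : (q : ℝ) * θ.deg f = p * θ.deg g := by
    rw [exk, eyk] at exy; push_cast at exy
    have hk0 : (k : ℝ) ≠ 0 := by exact_mod_cast hkpos.ne'
    have : (k : ℝ) * (q * θ.deg f) = k * (p * θ.deg g) := by linarith
    exact mul_left_cancel₀ hk0 this
  have hq0 : (0 : ℝ) < q := by exact_mod_cast hqpos
  have hp0 : (0 : ℝ) < p := by exact_mod_cast hppos
  have hgε : θ.deg g = q * (θ.deg g / q) := by field_simp
  have hfε : θ.deg f = p * (θ.deg g / q) := by field_simp; linarith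
  set ε := θ.deg g / q with hε
  have hεpos : 0 < ε := div_pos (by linarith) hq0
  have hLeq : L = (k * p * q) * ε + a 0 * θ.deg f + b 1 * θ.deg g := by
    have := hTL a ha
    rw [hy, eyk] at this; push_cast at this
    rw [← this]; rw [hgε]; ring
  -- all elements of T lie on the lattice
  have hlat : ∀ u ∈ T, ∃ t ≤ k, u 0 = a 0 + t * q ∧ u 1 = b 1 + (k - t) * p := by
    intro u hu
    obtain ⟨z, hz⟩ : ∃ z, u 0 = a 0 + z := ⟨u 0 - a 0, by have := hamin u hu; omega⟩
    have h1 := hTL u hu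
    have h2 := hTL a ha
    have h3 : (p : ℝ) * z + q * u 1 = q * a 1 := by
      rw [← h2, hz, hfε, hgε] at h1; push_cast at h1
      have : ε * ((p : ℝ) * z + q * u 1) = ε * (q * a 1) := by linarith
      exact mul_left_cancel₀ hεpos.ne' this
    have h4 : p * z + q * u 1 = q * a 1 := by exact_mod_cast h3
    have h5 : q ∣ p * z := by
      have : q ∣ p * z + q * u 1 := ⟨a 1, h4⟩
      exact (Nat.dvd_add_left (dvd_mul_right q (u 1))).1 this
    have h6 : q ∣ z := hcop.dvd_of_dvd_mul_left h5
    obtain ⟨t, rfl⟩ := h6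
    have hzx : q * t ≤ q * k := by have := hbmax u hu; omega
    have htk : t ≤ k := Nat.le_of_mul_le_mul_left hzx hqpos
    refine ⟨t, htk, by rw [hz, mul_comm], ?_⟩
    have h7 : p * t + u 1 = a 1 := by
      have : q * (p * t + u 1) = q * a 1 := by rw [← h4]; ring
      exact Nat.eq_of_mul_eq_mul_left hqpos this
    obtain ⟨s, rfl⟩ := Nat.exists_eq_add_of_le htk
    rw [hy, eyk] at h7
    rw [Nat.add_sub_cancel_left]
    nlinarith
  have hnk : n ≤ k := by
    have : T.card ≤ (Finset.range (k + 1)).card := by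
      choose! t ht1 ht2 ht3 using hlat
      apply Finset.card_le_card_of_injOn t
      · intro u hu; simp; have := ht1 u hu; omega
      · intro u hu v hv huv
        apply hinj hu hv
        simp only [ht2 u hu, ht2 v hv, huv]
    rw [Finset.card_range] at this; omega
  refine ⟨p, q, k, a 0, b 1, ε, ⟨hcop.symm, hppos, hqpos, hkpos, hεpos, hfε, hgε, ?_, ?_, ?_, ?_, ?_⟩⟩
  · intro u hu; rw [← hLeq]; exact hmax u hu
  · rw [← hLeq]
    refine hsu.trans ?_
    have h1 := θ.om_le f g
    have h2 : (n : ℝ) ≤ k := by exact_mod_cast hnk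
    nlinarith
  · exact ⟨a, (Finset.mem_filter.1 ha).1, rfl, by rw [hy, eyk, mul_comm]⟩
  · exact ⟨b, (Finset.mem_filter.1 hb).1, by rw [hx, exk, mul_comm], rfl⟩
  · intro u hu he
    exact hlat u (Finset.mem_filter.2 ⟨hu, by rw [hLeq]; exact he⟩)


lemma ev_ne_zero {f g : P3} (h : Jc f g ≠ 0) : ∀ (n : ℕ) (φ : P2), φ.totalDegree ≤ n → φ ≠ 0 → ev f g φ ≠ 0 := by
  intro n
  induction n with
  | zero =>
    intro φ hn h0 h1
    rw [totalDegree_eq_zero_iff_eq_C.1 (Nat.le_zero.1 hn), ev_C] at h1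
    apply h0
    rw [totalDegree_eq_zero_iff_eq_C.1 (Nat.le_zero.1 hn)]
    have : coeff 0 φ = 0 := by simpa using h1
    rw [this]; simp
  | succ n ih =>
    intro φ hn h0 h1
    have hd0 : ev f g (pderiv 0 φ) • Jc f g = 0 := by
      have e : Jc (ev f g φ) g = ev f g (pderiv 0 φ) • Jc f g := by
        rw [Jc_ev_left, Jc_self, smul_zero, add_zero]
      rw [← e, h1, ← C_0, Jc_C_left]
    have hd1 : ev f g (pderiv 1 φ) • Jc g f = 0 := by
      have e : Jc (ev f g φ) f = ev f g (pderiv 1 φ) • Jc g f := by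
        rw [Jc_ev_left, Jc_self, smul_zero, zero_add]
      rw [← e, h1, ← C_0, Jc_C_left]
    have hz0 := (smul_eq_zero.1 hd0).resolve_right h
    have hz1 := (smul_eq_zero.1 hd1).resolve_right (Jc_ne_swap h)
    have hdeg : ∀ i, (pderiv i φ).totalDegree ≤ n := by
      intro i
      exact totalDegree_pderiv_le' i φ n hn
    have e0 : pderiv 0 φ = 0 := by
      by_contra hc; exact ih _ (hdeg 0) hc hz0
    have e1 : pderiv 1 φ = 0 := by
      by_contra hc; exact ih _ (hdeg 1) hc hz1
    have hc : ∀ m, m ≠ 0 → coeff m φ = 0 := by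
      intro m hm
      obtain ⟨i, hi⟩ := Finsupp.ne_iff.1 hm
      have h3 := coeff_X_mul_pderiv i φ m
      have : pderiv i φ = 0 := by fin_cases i <;> assumption
      rw [this, mul_zero, coeff_zero] at h3
      rcases mul_eq_zero.1 h3.symm with h4 | h4
      · exact absurd (by exact_mod_cast h4) hi
      · exact h4
    have hφ : φ = C (coeff 0 φ) := by
      ext m; rw [coeff_C]; split_ifs with hm
      · rw [hm]
      · exact hc m (Ne.symm hm)
    rw [hφ, ev_C] at h1
    have : coeff 0 φ = 0 := by simpa using h1
    apply h0; rw [hφ, this, C_0]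

lemma ev_inj {f g : P3} (h : Jc f g ≠ 0) {φ : P2} (hφ : φ ≠ 0) : ev f g φ ≠ 0 :=
  ev_ne_zero h _ φ le_rfl hφ

lemma pderiv_ne {φ : P2} {u : Fin 2 →₀ ℕ} (hu : u ∈ φ.support) {i : Fin 2} (hi : u i ≠ 0) : pderiv i φ ≠ 0 := by
  intro h0
  have h3 := coeff_X_mul_pderiv i φ u
  rw [h0, mul_zero, coeff_zero] at h3
  exact mul_ne_zero (by exact_mod_cast hi) (mem_support_iff.1 hu) h3.symm

variable {θ}

lemma Canc.ge {f g : P3} {φ : P2} {p q k i j : ℕ} {ε : ℝ} (c : θ.Canc f g φ p q k i j ε) :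
    (k : ℝ) * ((p * q - p - q) * ε + θ.om f g) + i * θ.deg f + j * θ.deg g ≤ θ.deg (ev f g φ) := by
  have h := c.su
  have e : (k : ℝ) * (θ.deg f + θ.deg g - θ.om f g) = k * (p * ε + q * ε - θ.om f g) := by
    rw [← c.hf, ← c.hg]
  rw [e] at h
  linarith

lemma Canc.pd0 {f g : P3} {φ : P2} {p q k i j : ℕ} {ε : ℝ} (c : θ.Canc f g φ p q k i j ε) : pderiv 0 φ ≠ 0 := by
  obtain ⟨u, hu, h0, -⟩ := c.mem2
  refine pderiv_ne hu (i := 0) ?_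
  have := Nat.mul_pos c.hk c.hq
  omega

lemma Canc.pd1 {f g : P3} {φ : P2} {p q k i j : ℕ} {ε : ℝ} (c : θ.Canc f g φ p q k i j ε) : pderiv 1 φ ≠ 0 := by
  obtain ⟨u, hu, -, h0⟩ := c.mem1
  refine pderiv_ne hu (i := 1) ?_
  have := Nat.mul_pos c.hk c.hp
  omega

lemma Canc.om_g {f g : P3} (h : Jc f g ≠ 0) {φ : P2} {p q k i j : ℕ} {ε : ℝ} (c : θ.Canc f g φ p q k i j ε) :
    θ.om f g - θ.deg g ≤ θ.deg (ev f g φ) := by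
  have h1 := ev_inj h c.pd0
  have h2 := θ.deg_pd0 h h1
  linarith [θ.deg_nonneg (ev f g (pderiv 0 φ))]

lemma Canc.om_f {f g : P3} (h : Jc f g ≠ 0) {φ : P2} {p q k i j : ℕ} {ε : ℝ} (c : θ.Canc f g φ p q k i j ε) :
    θ.om f g - θ.deg f ≤ θ.deg (ev f g φ) := by
  have h1 := ev_inj h c.pd1
  have h2 := θ.deg_pd1 h h1
  linarith [θ.deg_nonneg (ev f g (pderiv 1 φ))]

lemma mw_add_single0 (f g : P3) (m : Fin 2 →₀ ℕ) :
    θ.mw f g (m + Finsupp.single 0 1) = θ.mw f g m + θ.deg f := by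
  simp [mw]; ring
lemma mw_add_single1 (f g : P3) (m : Fin 2 →₀ ℕ) :
    θ.mw f g (m + Finsupp.single 1 1) = θ.mw f g m + θ.deg g := by
  simp [mw]; ring

lemma Canc.deg_pd0_eq {f g : P3} (h : Jc f g ≠ 0) {φ : P2} {p q : ℕ} {ε : ℝ}
    (c : θ.Canc f g φ p q 1 0 0 ε) : θ.deg (ev f g (pderiv 0 φ)) = (p * q - p) * ε := by
  have hf := θ.Jc_pos_left h
  have hg := θ.Jc_pos_right h
  have hf0 := θ.ne_zero_of_deg_pos (by linarith : 0 < θ.deg f)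
  have hg0 := θ.ne_zero_of_deg_pos (by linarith : 0 < θ.deg g)
  obtain ⟨u, hu, h0, h1⟩ := c.mem2
  have hq := c.hq
  obtain ⟨q', hq'⟩ : ∃ q', q = q' + 1 := ⟨q - 1, by omega⟩
  have hu' : u = Finsupp.single 0 q' + Finsupp.single 0 1 := by
    ext i; fin_cases i
    · simp [h0, hq']
    · simp [h1]
  have hmem : (Finsupp.single 0 q' : Fin 2 →₀ ℕ) ∈ (pderiv 0 φ).support := by
    rw [mem_support_iff, coeff_pderiv', ← hu']
    exact mul_ne_zero (Nat.cast_ne_zero.2 (Nat.succ_ne_zero _)) (mem_support_iff.1 hu)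
  have := θ.deg_ev_top hf0 hg0 hmem (by
    intro v hv hne
    rw [mem_support_iff, coeff_pderiv'] at hv
    have hv' := mem_support_iff.2 (right_ne_zero_of_mul hv)
    have hle := c.le _ hv'
    have e1 : (↑1 * p * q : ℝ) * ε + (0:ℕ) * θ.deg f + (0:ℕ) * θ.deg g = θ.mw f g (Finsupp.single 0 q') + θ.deg f := by
      simp [mw, c.hf, hq']; ring
    have hlt : θ.mw f g (v + Finsupp.single 0 1) < θ.mw f g (Finsupp.single 0 q') + θ.deg f := by
      rw [← e1]
      refine lt_of_le_of_ne (by simpa using hle) fun heq => hne ?_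
      obtain ⟨t, ht, h2, h3⟩ := c.top _ hv' (by simpa using heq)
      simp at h2 h3
      have ht1 : t = 1 := by
        rcases Nat.lt_or_ge t 1 with h | h
        · interval_cases t; omega
        · omega
      subst ht1
      ext i; fin_cases i
      · simp; omega
      · simp; simpa using h3
    rw [mw_add_single0] at hlt
    linarith)
  rw [this]; simp [mw, c.hf, hq']; ring

lemma Canc.deg_pd1_eq {f g : P3} (h : Jc f g ≠ 0) {φ : P2} {p q : ℕ} {ε : ℝ}
    (c : θ.Canc f g φ p q 1 0 0 ε) : θ.deg (ev f g (pderiv 1 φ)) = (p * q - q) * ε := by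
  have hf := θ.Jc_pos_left h
  have hg := θ.Jc_pos_right h
  have hf0 := θ.ne_zero_of_deg_pos (by linarith : 0 < θ.deg f)
  have hg0 := θ.ne_zero_of_deg_pos (by linarith : 0 < θ.deg g)
  obtain ⟨u, hu, h0, h1⟩ := c.mem1
  have hp := c.hp
  obtain ⟨p', hp'⟩ : ∃ p', p = p' + 1 := ⟨p - 1, by omega⟩
  have hu' : u = Finsupp.single 1 p' + Finsupp.single 1 1 := by
    ext i; fin_cases i
    · simp [h0]
    · simp [h1, hp']
  have hmem : (Finsupp.single 1 p' : Fin 2 →₀ ℕ) ∈ (pderiv 1 φ).support := by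
    rw [mem_support_iff, coeff_pderiv', ← hu']
    exact mul_ne_zero (Nat.cast_ne_zero.2 (Nat.succ_ne_zero _)) (mem_support_iff.1 hu)
  have := θ.deg_ev_top hf0 hg0 hmem (by
    intro v hv hne
    rw [mem_support_iff, coeff_pderiv'] at hv
    have hv' := mem_support_iff.2 (right_ne_zero_of_mul hv)
    have hle := c.le _ hv'
    have e1 : (↑1 * p * q : ℝ) * ε + (0:ℕ) * θ.deg f + (0:ℕ) * θ.deg g = θ.mw f g (Finsupp.single 1 p') + θ.deg g := by
      simp [mw, c.hg, hp']; ring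
    have hlt : θ.mw f g (v + Finsupp.single 1 1) < θ.mw f g (Finsupp.single 1 p') + θ.deg g := by
      rw [← e1]
      refine lt_of_le_of_ne (by simpa using hle) fun heq => hne ?_
      obtain ⟨t, ht, h2, h3⟩ := c.top _ hv' (by simpa using heq)
      simp at h2 h3
      have ht1 : t = 0 := by
        rcases Nat.lt_or_ge t 1 with h | h
        · omega
        · have : t = 1 := by omega
          subst this; omega
      subst ht1
      ext i; fin_cases i
      · simp; omega
      · simp; omega
    rw [mw_add_single1] at hlt
    linarith)
  rw [this]; simp [mw, c.hg, hp']; ring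

lemma ev_mem {f g : P3} {φ : P2} (M : Submodule ℂ P3) (h : ∀ u ∈ φ.support, f ^ u 0 * g ^ u 1 ∈ M) :
    ev f g φ ∈ M := by
  rw [φ.as_sum, map_sum]
  refine Submodule.sum_mem _ fun u hu => ?_
  rw [ev_monomial]
  exact M.smul_mem _ (h u hu)

end Wt


lemma C_smul_one (c : ℂ) : (C c : P3) = c • (1 : P3) := by rw [smul_eq_C_mul, mul_one]

noncomputable def Pl (a b : P3) : Submodule ℂ P3 := Submodule.span ℂ {1, a, b}
noncomputable def Sp (a b c : P3) : Submodule ℂ P3 := Submodule.span ℂ {1, a, b, c}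
noncomputable def Alg (a b : P3) : Subalgebra ℂ P3 := Algebra.adjoin ℂ {a, b}

lemma mem_Pl {a b x : P3} : x ∈ Pl a b ↔ ∃ α β κ : ℂ, x = α • a + β • b + κ • (1 : P3) := by
  rw [Pl, Submodule.mem_span_insert]
  constructor
  · rintro ⟨κ, z, hz, rfl⟩
    obtain ⟨α, β, rfl⟩ := Submodule.mem_span_pair.1 hz
    exact ⟨α, β, κ, by module⟩
  · rintro ⟨α, β, κ, rfl⟩
    exact ⟨κ, _, Submodule.mem_span_pair.2 ⟨α, β, rfl⟩, by module⟩

lemma mem_Sp {a b c x : P3} :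
    x ∈ Sp a b c ↔ ∃ α β γ κ : ℂ, x = α • a + β • b + γ • c + κ • (1 : P3) := by
  rw [Sp, Submodule.mem_span_insert]
  constructor
  · rintro ⟨κ, z, hz, rfl⟩
    obtain ⟨α, y, hy, rfl⟩ := Submodule.mem_span_insert.1 hz
    obtain ⟨β, γ, rfl⟩ := Submodule.mem_span_pair.1 hy
    exact ⟨α, β, γ, κ, by module⟩
  · rintro ⟨α, β, γ, κ, rfl⟩
    exact ⟨κ, _, Submodule.mem_span_insert.2 ⟨α, _, Submodule.mem_span_pair.2 ⟨β, γ, rfl⟩, rfl⟩, by module⟩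

lemma one_mem_Pl (a b : P3) : (1 : P3) ∈ Pl a b := Submodule.subset_span (by simp)
lemma left_mem_Pl (a b : P3) : a ∈ Pl a b := Submodule.subset_span (by simp)
lemma right_mem_Pl (a b : P3) : b ∈ Pl a b := Submodule.subset_span (by simp)
lemma one_mem_Sp (a b c : P3) : (1 : P3) ∈ Sp a b c := Submodule.subset_span (by simp)
lemma mem_Sp1 (a b c : P3) : a ∈ Sp a b c := Submodule.subset_span (by simp)
lemma mem_Sp2 (a b c : P3) : b ∈ Sp a b c := Submodule.subset_span (by simp)
lemma mem_Sp3 (a b c : P3) : c ∈ Sp a b c := Submodule.subset_span (by simp)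

lemma Pl_le {a b : P3} {M : Submodule ℂ P3} (h1 : 1 ∈ M) (ha : a ∈ M) (hb : b ∈ M) : Pl a b ≤ M := by
  rw [Pl, Submodule.span_le]
  rintro x hx
  simp only [Set.mem_insert_iff, Set.mem_singleton_iff] at hx
  rcases hx with rfl | rfl | rfl <;> assumption

lemma Sp_le {a b c : P3} {M : Submodule ℂ P3} (h1 : 1 ∈ M) (ha : a ∈ M) (hb : b ∈ M) (hc : c ∈ M) :
    Sp a b c ≤ M := by
  rw [Sp, Submodule.span_le]
  rintro x hx
  simp only [Set.mem_insert_iff, Set.mem_singleton_iff] at hx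
  rcases hx with rfl | rfl | rfl | rfl <;> assumption

lemma Pl_eq {a b x y : P3} (hx : x ∈ Pl a b) (hy : y ∈ Pl a b) (ha : a ∈ Pl x y) (hb : b ∈ Pl x y) :
    Pl x y = Pl a b :=
  le_antisymm (Pl_le (one_mem_Pl _ _) hx hy) (Pl_le (one_mem_Pl _ _) ha hb)

lemma Sp_eq {a b c x y z : P3} (hx : x ∈ Sp a b c) (hy : y ∈ Sp a b c) (hz : z ∈ Sp a b c)
    (ha : a ∈ Sp x y z) (hb : b ∈ Sp x y z) (hc : c ∈ Sp x y z) : Sp x y z = Sp a b c :=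
  le_antisymm (Sp_le (one_mem_Sp _ _ _) hx hy hz) (Sp_le (one_mem_Sp _ _ _) ha hb hc)

lemma Pl_le_Sp (a b c : P3) : Pl a b ≤ Sp a b c :=
  Pl_le (one_mem_Sp _ _ _) (mem_Sp1 _ _ _) (mem_Sp2 _ _ _)

lemma Pl_comm (a b : P3) : Pl a b = Pl b a :=
  Pl_eq (right_mem_Pl _ _) (left_mem_Pl _ _) (right_mem_Pl _ _) (left_mem_Pl _ _)

lemma Sp_rot (a b c : P3) : Sp a b c = Sp b c a :=
  Sp_eq (mem_Sp3 _ _ _) (mem_Sp1 _ _ _) (mem_Sp2 _ _ _) (mem_Sp2 _ _ _) (mem_Sp3 _ _ _) (mem_Sp1 _ _ _)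
lemma Sp_swap (a b c : P3) : Sp a b c = Sp b a c :=
  Sp_eq (mem_Sp2 _ _ _) (mem_Sp1 _ _ _) (mem_Sp3 _ _ _) (mem_Sp2 _ _ _) (mem_Sp1 _ _ _) (mem_Sp3 _ _ _)
lemma Sp_swap23 (a b c : P3) : Sp a b c = Sp a c b := by rw [Sp_swap, Sp_rot, Sp_rot, Sp_rot, Sp_rot]

lemma Sp_congr_Pl {a b f g : P3} (h : Pl f g = Pl a b) (c : P3) : Sp f g c = Sp a b c := by
  apply le_antisymm
  · exact Sp_le (one_mem_Sp _ _ _) (Pl_le_Sp a b c (h ▸ left_mem_Pl f g))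
      (Pl_le_Sp a b c (h ▸ right_mem_Pl f g)) (mem_Sp3 _ _ _)
  · exact Sp_le (one_mem_Sp _ _ _) (Pl_le_Sp f g c (h ▸ left_mem_Pl a b))
      (Pl_le_Sp f g c (h ▸ right_mem_Pl a b)) (mem_Sp3 _ _ _)

/-- modify the third by nonzero scalar and plane element -/
lemma Sp_third {a b c c' : P3} {k : ℂ} (hk : k ≠ 0) {x : P3} (hx : x ∈ Pl a b) (h : c' = k • c + x) :
    Sp a b c' = Sp a b c := by
  subst h
  apply Sp_eq (mem_Sp1 _ _ _) (mem_Sp2 _ _ _) _ (mem_Sp1 _ _ _) (mem_Sp2 _ _ _)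
  · have : c = k⁻¹ • (k • c + x) - k⁻¹ • x := by
      rw [smul_add, smul_smul, inv_mul_cancel₀ hk]; simp
    rw [this]
    have h1 := mem_Sp3 a b (k • c + x)
    have h2 := Pl_le_Sp a b (k • c + x) hx
    conv_lhs => rw [← this]
    rw [this]
    exact Submodule.sub_mem _ (Submodule.smul_mem _ _ (by rw [← this]; exact h1)) (Submodule.smul_mem _ _ (by rw [← this]; exact h2))
  · exact Submodule.add_mem _ (Submodule.smul_mem _ _ (mem_Sp3 _ _ _)) (Pl_le_Sp a b c hx)

lemma mem_Alg {a b x : P3} : x ∈ Alg a b ↔ ∃ φ, ev a b φ = x := by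
  have : ({a, b} : Set P3) = Set.range ![a, b] := by
    ext y; simp [eq_comm, or_comm]
  rw [Alg, this, Algebra.adjoin_range_eq_range_aeval]
  rfl

lemma left_mem_Alg (a b : P3) : a ∈ Alg a b := Algebra.subset_adjoin (by simp)
lemma right_mem_Alg (a b : P3) : b ∈ Alg a b := Algebra.subset_adjoin (by simp)

lemma Pl_le_Alg {a b x : P3} (h : x ∈ Pl a b) : x ∈ Alg a b := by
  obtain ⟨α, β, κ, rfl⟩ := mem_Pl.1 h
  exact add_mem (add_mem (Subalgebra.smul_mem _ (left_mem_Alg _ _) _) (Subalgebra.smul_mem _ (right_mem_Alg _ _) _))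
    (Subalgebra.smul_mem _ (one_mem _) _)

lemma Alg_le {a b f g : P3} (hf : f ∈ Alg a b) (hg : g ∈ Alg a b) : Alg f g ≤ Alg a b := by
  rw [Alg, Algebra.adjoin_le_iff]
  rintro x hx
  simp only [Set.mem_insert_iff, Set.mem_singleton_iff] at hx
  rcases hx with rfl | rfl <;> assumption

lemma Alg_congr {a b f g : P3} (h : Pl f g = Pl a b) : Alg f g = Alg a b := by
  apply le_antisymm
  · exact Alg_le (Pl_le_Alg (h ▸ left_mem_Pl f g)) (Pl_le_Alg (h ▸ right_mem_Pl f g))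
  · exact Alg_le (Pl_le_Alg (h ▸ left_mem_Pl a b)) (Pl_le_Alg (h ▸ right_mem_Pl a b))

lemma Alg_comm (a b : P3) : Alg a b = Alg b a := Alg_congr (Pl_comm a b)

lemma Tri.add_Alg {a b c x : P3} (h : Tri a b c) (hx : x ∈ Alg a b) : Tri a b (c + x) := by
  obtain ⟨φ, rfl⟩ := mem_Alg.1 hx
  exact h.add_ev φ

lemma Tri.of_sub_Alg {a b c c' : P3} (h : Tri a b c) (hx : c' - c ∈ Alg a b) : Tri a b c' := by
  have := h.add_Alg hx
  rwa [add_sub_cancel] at this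

lemma Tri.smul {a b c : P3} (h : Tri a b c) {k : ℂ} (hk : k ≠ 0) : Tri a b (k • c) := by
  obtain ⟨l, hl, e⟩ := h
  refine ⟨k * l, mul_ne_zero hk hl, ?_⟩
  rw [C_mul, mul_assoc, ← e]
  simp [Det, smul_eq_C_mul]; ring

lemma Det_lin' (a b c : P3) (m : Fin 3 → Fin 3 → ℂ) (k : Fin 3 → ℂ) :
    Det (m 0 0 • a + m 0 1 • b + m 0 2 • c + k 0 • (1 : P3)) (m 1 0 • a + m 1 1 • b + m 1 2 • c + k 1 • (1 : P3))
      (m 2 0 • a + m 2 1 • b + m 2 2 • c + k 2 • (1 : P3)) = C ((Matrix.of m).det) * Det a b c := by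
  rw [← Det_lin a b c m (k 0) (k 1) (k 2)]
  simp only [C_smul_one]

lemma Tri.mat {a b c x y z : P3} (h : Tri a b c) (hx : x ∈ Sp a b c) (hy : y ∈ Sp a b c) (hz : z ∈ Sp a b c)
    (h2 : Sp a b c ≤ Sp x y z) : ∃ (m : Fin 3 → Fin 3 → ℂ) (k : Fin 3 → ℂ), (Matrix.of m).det ≠ 0 ∧
      x = m 0 0 • a + m 0 1 • b + m 0 2 • c + k 0 • (1 : P3) ∧ 
      y = m 1 0 • a + m 1 1 • b + m 1 2 • c + k 1 • (1 : P3) ∧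
      z = m 2 0 • a + m 2 1 • b + m 2 2 • c + k 2 • (1 : P3) := by
  obtain ⟨x1, x2, x3, x0, ex⟩ := mem_Sp.1 hx
  obtain ⟨y1, y2, y3, y0, ey⟩ := mem_Sp.1 hy
  obtain ⟨z1, z2, z3, z0, ez⟩ := mem_Sp.1 hz
  obtain ⟨a1, a2, a3, a0, ea⟩ := mem_Sp.1 (h2 (mem_Sp1 a b c))
  obtain ⟨b1, b2, b3, b0, eb⟩ := mem_Sp.1 (h2 (mem_Sp2 a b c))
  obtain ⟨c1, c2, c3, c0, ec⟩ := mem_Sp.1 (h2 (mem_Sp3 a b c))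
  refine ⟨![![x1, x2, x3], ![y1, y2, y3], ![z1, z2, z3]], ![x0, y0, z0], ?_, ex, ey, ez⟩
  intro h0
  have e1 := Det_lin' a b c ![![x1, x2, x3], ![y1, y2, y3], ![z1, z2, z3]] ![x0, y0, z0]
  have e2 := Det_lin' x y z ![![a1, a2, a3], ![b1, b2, b3], ![c1, c2, c3]] ![a0, b0, c0]
  rw [h0, C_0, zero_mul] at e1
  simp only [Matrix.cons_val] at e1 e2
  rw [← ex, ← ey, ← ez] at e1
  rw [← ea, ← eb, ← ec, e1, mul_zero] at e2
  exact h.ne e2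

lemma Tri.of_Sp {a b c x y z : P3} (h : Tri a b c) (e : Sp x y z = Sp a b c) : Tri x y z := by
  obtain ⟨m, k, hm, hx, hy, hz⟩ := h.mat (x := x) (y := y) (z := z) (e ▸ mem_Sp1 _ _ _) (e ▸ mem_Sp2 _ _ _) (e ▸ mem_Sp3 _ _ _) e.ge
  obtain ⟨l, hl, hd⟩ := h
  refine ⟨(Matrix.of m).det * l, mul_ne_zero hm hl, ?_⟩
  rw [hx, hy, hz, Det_lin', hd, C_mul]; ring

lemma Tri.indep {a b c : P3} (h : Tri a b c) {α β γ κ : ℂ} (e : α • a + β • b + γ • c + κ • (1 : P3) = 0) :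
    α = 0 ∧ β = 0 ∧ γ = 0 := by
  have h1 : ∀ i, α • lD i a + β • lD i b + γ • lD i c = 0 := by
    intro i
    have := congrArg (lD i) e
    simpa using this
  have key : ∀ a b c : P3, Tri a b c → ∀ α β γ : ℂ, (∀ i, α • lD i a + β • lD i b + γ • lD i c = 0) → α = 0 := by
    intro a b c h α β γ h1
    have h2 : C α * Det a b c = 0 := by
      rw [← Det_rot]
      have e0 := h1 0; have e1 := h1 1; have e2 := h1 2
      simp only [smul_eq_C_mul] at e0 e1 e2
      simp only [Det, Jc_zero, Jc_one, Jc_two]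
      linear_combination (lD 1 b * lD 2 c - lD 2 b * lD 1 c) * e0 + (lD 2 b * lD 0 c - lD 0 b * lD 2 c) * e1 + (lD 0 b * lD 1 c - lD 1 b * lD 0 c) * e2
    rcases mul_eq_zero.1 h2 with h3 | h3
    · simpa using h3
    · exact absurd h3 h.ne
  refine ⟨key a b c h α β γ h1, key b c a h.rot β γ α fun i => ?_, key c a b h.rot.rot γ α β fun i => ?_⟩
  · rw [← h1 i]; ring
  · rw [← h1 i]; ring

lemma Tri.not_mem {a b c : P3} (h : Tri a b c) : c ∉ Pl a b := by
  intro hc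
  obtain ⟨α, β, κ, e⟩ := mem_Pl.1 hc
  have := h.indep (α := α) (β := β) (γ := -1) (κ := κ) (by rw [e]; module)
  simp at this

namespace Wt
variable (θ : Wt)

def Good (a b c : P3) : Prop := Tri a b c ∧ θ.deg a ≠ θ.deg b ∧ θ.deg a ≠ θ.deg c ∧ θ.deg b ≠ θ.deg c

variable {θ}
lemma Good.tri {a b c : P3} (h : θ.Good a b c) : Tri a b c := h.1
lemma Good.rot {a b c : P3} (h : θ.Good a b c) : θ.Good b c a := ⟨h.1.rot, h.2.2.2, h.2.1.symm, h.2.2.1.symm⟩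
lemma Good.swap {a b c : P3} (h : θ.Good a b c) : θ.Good b a c := ⟨h.1.swap, h.2.1.symm, h.2.2.2, h.2.2.1⟩
lemma Good.swap23 {a b c : P3} (h : θ.Good a b c) : θ.Good a c b := h.swap.rot

lemma Good.lin_le {a b c : P3} (h : θ.Good a b c) (α β γ κ : ℂ) (hα : α ≠ 0) :
    θ.deg a ≤ θ.deg (α • a + β • b + γ • c + κ • (1 : P3)) := by
  have ha := θ.deg_pos_iff_one_le (θ.Tri_deg_pos h.tri)
  have key : ∀ x y : P3, θ.deg x ≠ θ.deg y → max (θ.deg x) (θ.deg y) ≤ θ.deg (x + y) := by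
    intro x y hxy
    rcases lt_or_gt_of_ne hxy with h | h
    · rw [θ.deg_add_eq' h]; exact max_le h.le le_rfl
    · rw [θ.deg_add_eq h]; exact max_le le_rfl h.le
  have hsm : ∀ (t : ℂ) (x : P3), θ.deg (t • x) = 0 ∨ θ.deg (t • x) = θ.deg x := by
    intro t x
    by_cases ht : t = 0
    · left; rw [ht, zero_smul, θ.deg_zero]
    · right; exact θ.deg_smul ht x
  have hκ : θ.deg (κ • (1 : P3)) = 0 := by rw [← C_smul_one, θ.deg_C]
  have hαa := θ.deg_smul hα a
  obtain ⟨-, h1, h2, h3⟩ := h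
  have s1 : max (θ.deg (α • a)) (θ.deg (β • b)) ≤ θ.deg (α • a + β • b) := by
    apply key
    rcases hsm β b with h | h <;> rw [h, hαa]
    · linarith
    · exact h1
  have s1' := θ.deg_add_le (α • a) (β • b)
  have s1e := le_antisymm s1' s1
  have s2 : max (θ.deg (α • a + β • b)) (θ.deg (γ • c)) ≤ θ.deg (α • a + β • b + γ • c) := by
    apply key
    rw [s1e, hαa]
    rcases hsm γ c with h | h <;> rcases hsm β b with h' | h' <;> rw [h, h']
    · rw [max_eq_left (by linarith)]; linarith
    · have := le_max_left (θ.deg a) (θ.deg b); linarith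
    · rw [max_eq_left (by linarith)]; exact h2
    · rcases max_choice (θ.deg a) (θ.deg b) with h4 | h4 <;> rw [h4] <;> assumption
  have s3 : θ.deg a ≤ θ.deg (α • a + β • b + γ • c) := by
    rw [← hαa]; exact (le_max_left _ _).trans (s1.trans ((le_max_left _ _).trans s2))
  rw [θ.deg_add_eq]
  · exact s3
  · rw [hκ]; linarith

lemma Good.sum_le {a b c x y z : P3} (h : θ.Good a b c) (e : Sp x y z = Sp a b c) :
    θ.deg a + θ.deg b + θ.deg c ≤ θ.deg x + θ.deg y + θ.deg z := by
  obtain ⟨m, k, hm, hx, hy, hz⟩ := h.tri.mat (x := x) (y := y) (z := z) (e ▸ mem_Sp1 _ _ _) (e ▸ mem_Sp2 _ _ _) (e ▸ mem_Sp3 _ _ _) e.ge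
  have l1 : ∀ i : Fin 3, ∀ α β γ κ : ℂ, ![α, β, γ] i ≠ 0 → θ.deg (![a, b, c] i) ≤ θ.deg (α • a + β • b + γ • c + κ • (1 : P3)) := by
    intro i α β γ κ hi
    fin_cases i
    · exact h.lin_le α β γ κ hi
    · have := h.rot.lin_le β γ α κ hi
      rwa [show β • b + γ • c + α • a + κ • (1 : P3) = α • a + β • b + γ • c + κ • (1 : P3) by module] at this
    · have := h.rot.rot.lin_le γ α β κ hi
      rwa [show γ • c + α • a + β • b + κ • (1 : P3) = α • a + β • b + γ • c + κ • (1 : P3) by module] at this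
  obtain ⟨σ, hσ⟩ : ∃ σ : Equiv.Perm (Fin 3), ∀ i, m (σ i) i ≠ 0 := by
    by_contra hcon
    push Not at hcon
    apply hm
    rw [Matrix.det_apply]
    apply Finset.sum_eq_zero
    intro σ _
    obtain ⟨i, hi⟩ := hcon σ
    rw [Finset.prod_eq_zero (Finset.mem_univ i) (by simpa using hi), smul_zero]
  have l2 : ∀ i, θ.deg (![a, b, c] i) ≤ θ.deg (![x, y, z] (σ i)) := by
    intro i
    have h1 : ![x, y, z] (σ i) = m (σ i) 0 • a + m (σ i) 1 • b + m (σ i) 2 • c + k (σ i) • (1 : P3) := by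
      generalize σ i = j
      fin_cases j <;> assumption
    rw [h1]
    apply l1
    have := hσ i
    generalize σ i = j at this
    fin_cases i <;> simpa using this
  have l3 : ∑ i, θ.deg (![a, b, c] i) ≤ ∑ i, θ.deg (![x, y, z] i) := by
    rw [← Equiv.sum_comp σ fun i => θ.deg (![x, y, z] i)]
    exact Finset.sum_le_sum fun i _ => l2 i
  simpa [Fin.sum_univ_three] using l3

variable (θ) in
noncomputable def dg (V : Submodule ℂ P3) : ℝ :=
  sInf {r | ∃ a b c, Tri a b c ∧ V = Sp a b c ∧ r = θ.deg a + θ.deg b + θ.deg c}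

lemma Good.dg {a b c : P3} (h : θ.Good a b c) : θ.dg (Sp a b c) = θ.deg a + θ.deg b + θ.deg c := by
  apply IsLeast.csInf_eq
  refine ⟨⟨a, b, c, h.tri, rfl, rfl⟩, ?_⟩
  rintro r ⟨x, y, z, -, e, rfl⟩
  exact h.sum_le e.symm

lemma Tri_dg_le {a b c : P3} (h : Tri a b c) : θ.dg (Sp a b c) ≤ θ.deg a + θ.deg b + θ.deg c := by
  apply csInf_le
  · refine ⟨0, ?_⟩
    rintro r ⟨x, y, z, -, e, rfl⟩
    linarith [θ.deg_nonneg x, θ.deg_nonneg y, θ.deg_nonneg z]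
  · exact ⟨a, b, c, h, rfl, rfl⟩

variable (θ)

/-- third element adjustment -/
lemma exists_good_third {a b c : P3} (h : Tri a b c) (hab : θ.deg a ≠ θ.deg b) :
    ∃ c', c' - c ∈ Pl a b ∧ θ.Good a b c' ∧ Sp a b c' = Sp a b c ∧ θ.deg c' ≤ θ.deg c := by
  obtain ⟨c', hc', hmin⟩ := θ.exists_min {x | x - c ∈ Pl a b} ⟨c, by simp⟩
  have hc'' : c' - c ∈ Pl a b := hc'
  have e : Sp a b c' = Sp a b c := Sp_third one_ne_zero hc'' (by simp)
  have ht : Tri a b c' := h.of_Sp e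
  have hpos : 0 < θ.deg c' := θ.Tri_deg_pos ht.rot.rot
  have key : ∀ x ∈ Pl a b, θ.deg x ≠ θ.deg c' := by
    intro x hx heq
    obtain ⟨k, hk, hlt⟩ := θ.exists_cancel heq.symm hpos
    have := hmin (c' - k • x) (by
      have : c' - k • x - c = (c' - c) - k • x := by ring
      show c' - k • x - c ∈ Pl a b
      rw [this]; exact Submodule.sub_mem _ hc'' (Submodule.smul_mem _ _ hx))
    linarith
  exact ⟨c', hc'', ⟨ht, hab, key a (left_mem_Pl _ _), key b (right_mem_Pl _ _)⟩, e, hmin c (by simp)⟩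

lemma exists_good_pair {a b c : P3} (h : Tri a b c) : ∃ b', Pl a b' = Pl a b ∧ θ.deg a ≠ θ.deg b' := by
  by_cases hd : θ.deg a = θ.deg b
  · obtain ⟨k, hk, hlt⟩ := θ.exists_cancel hd.symm (by rw [← hd]; exact θ.Tri_deg_pos h)
    refine ⟨b - k • a, ?_, by rw [hd]; exact hlt.ne'⟩
    apply Pl_eq (left_mem_Pl _ _) _ (left_mem_Pl _ _)
    · exact mem_Pl.2 ⟨k, 1, 0, by module⟩
    · exact mem_Pl.2 ⟨-k, 1, 0, by module⟩
  · exact ⟨b, rfl, hd⟩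

/-- adjacency -/
def _root_.Adj (V V' : Submodule ℂ P3) : Prop :=
  ∃ a b c c', Tri a b c ∧ c' - c ∈ Alg a b ∧ V = Sp a b c ∧ V' = Sp a b c'

lemma _root_.Adj.symm {V V' : Submodule ℂ P3} (h : Adj V V') : Adj V' V := by
  obtain ⟨a, b, c, c', h, hc, e, e'⟩ := h
  refine ⟨a, b, c', c, h.of_sub_Alg hc, ?_, e', e⟩
  rw [← neg_sub]; exact neg_mem hc

/-- rebase -/
lemma _root_.rebase {a b c c' f g h : P3} (ht : Tri a b c) (hc : c' - c ∈ Alg a b) (hP : Pl f g = Pl a b)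
    (hS : Sp f g h = Sp a b c) : ∃ h', h' - h ∈ Alg f g ∧ Sp f g h' = Sp a b c' := by
  have hT := ht.of_Sp hS
  have hm : h ∈ Sp a b c := hS ▸ mem_Sp3 f g h
  obtain ⟨α, β, γ, κ, e⟩ := mem_Sp.1 hm
  have hγ : γ ≠ 0 := by
    rintro rfl
    apply hT.not_mem
    rw [hP]
    exact mem_Pl.2 ⟨α, β, κ, by rw [e]; module⟩
  refine ⟨h + γ • (c' - c), ?_, ?_⟩
  · rw [add_sub_cancel_left, Alg_congr hP]
    exact Subalgebra.smul_mem _ hc _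
  · rw [Sp_congr_Pl hP]
    exact Sp_third hγ (x := α • a + β • b + κ • (1 : P3)) (mem_Pl.2 ⟨α, β, κ, rfl⟩) (by rw [e]; module)

lemma rebase_good {a b c c' f g h : P3} (ht : Tri a b c) (hc : c' - c ∈ Alg a b) (hP : Pl f g = Pl a b)
    (hS : Sp f g h = Sp a b c) (hfg : θ.deg f ≠ θ.deg g) :
    ∃ h', h' - h ∈ Alg f g ∧ Sp f g h' = Sp a b c' ∧ θ.Good f g h' := by
  obtain ⟨h1, h1a, h1S⟩ := rebase ht hc hP hS
  have hT1 : Tri f g h1 := (ht.of_Sp hS).of_sub_Alg h1a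
  obtain ⟨h', h2, h3, h4, -⟩ := θ.exists_good_third hT1 hfg
  refine ⟨h', ?_, h4.trans h1S, h3⟩
  have : h' - h = (h' - h1) + (h1 - h) := by ring
  rw [this]; exact add_mem (Pl_le_Alg h2) h1a

lemma _root_.Adj.good {V V' : Submodule ℂ P3} (h : Adj V V') :
    ∃ a b c c', θ.Good a b c ∧ θ.Good a b c' ∧ c' - c ∈ Alg a b ∧ V = Sp a b c ∧ V' = Sp a b c' := by
  obtain ⟨a, b, c, c', h, hc, rfl, rfl⟩ := h
  obtain ⟨b', hb', hd⟩ := θ.exists_good_pair h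
  obtain ⟨c1, h1, h2, h3, -⟩ := θ.exists_good_third (h.of_Sp (Sp_congr_Pl hb' c)) hd
  obtain ⟨c1', h4, h5, h6⟩ := θ.rebase_good h hc hb' (h3.trans (Sp_congr_Pl hb' c)) hd
  exact ⟨a, b', c1, c1', h2, h6, h4, by rw [h3, Sp_congr_Pl hb'], h5.symm⟩

end Wt


lemma Tri.Pl_eq_of_mem {f g h a b : P3} (ht : Tri f g h) (hf : f ∈ Pl a b) (hg : g ∈ Pl a b) : Pl f g = Pl a b := by
  obtain ⟨f1, f2, f0, ef⟩ := mem_Pl.1 hf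
  obtain ⟨g1, g2, g0, eg⟩ := mem_Pl.1 hg
  have hdet : f1 * g2 - f2 * g1 ≠ 0 := by
    intro h0
    have i1 := ht.indep (α := g1) (β := -f1) (γ := 0) (κ := g0 * f1 - g1 * f0) (by
      rw [ef, eg]
      have : g1 • (f1 • a + f2 • b + f0 • (1 : P3)) + -f1 • (g1 • a + g2 • b + g0 • (1 : P3)) + (0 : ℂ) • h + (g0 * f1 - g1 * f0) • (1 : P3) = -(f1 * g2 - f2 * g1) • b := by module
      rw [this, h0]; simp)
    have i2 := ht.indep (α := g2) (β := -f2) (γ := 0) (κ := g0 * f2 - g2 * f0) (by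
      rw [ef, eg]
      have : g2 • (f1 • a + f2 • b + f0 • (1 : P3)) + -f2 • (g1 • a + g2 • b + g0 • (1 : P3)) + (0 : ℂ) • h + (g0 * f2 - g2 * f0) • (1 : P3) = (f1 * g2 - f2 * g1) • a := by module
      rw [this, h0]; simp)
    have i3 := ht.indep (α := 1) (β := 0) (γ := 0) (κ := -f0) (by
      rw [ef, neg_eq_zero.1 i1.2.1, neg_eq_zero.1 i2.2.1]; module)
    exact one_ne_zero i3.1
  obtain ⟨D, hD⟩ : ∃ D, D = f1 * g2 - f2 * g1 := ⟨_, rfl⟩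
  rw [← hD] at hdet
  refine Pl_eq hf hg ?_ ?_
  · have e1 : g2 • f - f2 • g + (f2 * g0 - g2 * f0) • (1 : P3) = D • a := by rw [ef, eg, hD]; module
    have e2 : a = D⁻¹ • (D • a) := by rw [smul_smul, inv_mul_cancel₀ hdet, one_smul]
    rw [e2, ← e1]
    exact mem_Pl.2 ⟨D⁻¹ * g2, -(D⁻¹ * f2), D⁻¹ * (f2 * g0 - g2 * f0), by module⟩
  · have e1 : f1 • g - g1 • f + (g1 * f0 - f1 * g0) • (1 : P3) = D • b := by rw [ef, eg, hD]; module
    have e2 : b = D⁻¹ • (D • b) := by rw [smul_smul, inv_mul_cancel₀ hdet, one_smul]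
    rw [e2, ← e1]
    exact mem_Pl.2 ⟨-(D⁻¹ * g1), D⁻¹ * f1, D⁻¹ * (g1 * f0 - f1 * g0), by module⟩

lemma plane3 {x y z a b c : P3} (ht : Tri x y z) (e : Sp a b c = Sp x y z) :
    (∃ s t : ℂ, Pl (x + s • z) (y + t • z) = Pl a b) ∨ (∃ s : ℂ, Pl (x + s • y) z = Pl a b) ∨ Pl y z = Pl a b := by
  obtain ⟨x1, x2, x3, x0, ex⟩ := mem_Sp.1 (e ▸ mem_Sp1 x y z : x ∈ Sp a b c)
  obtain ⟨y1, y2, y3, y0, ey⟩ := mem_Sp.1 (e ▸ mem_Sp2 x y z : y ∈ Sp a b c)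
  obtain ⟨z1, z2, z3, z0, ez⟩ := mem_Sp.1 (e ▸ mem_Sp3 x y z : z ∈ Sp a b c)
  by_cases hz : z3 = 0
  · subst hz
    have hzm : z ∈ Pl a b := mem_Pl.2 ⟨z1, z2, z0, by rw [ez]; module⟩
    by_cases hy : y3 = 0
    · subst hy
      have hym : y ∈ Pl a b := mem_Pl.2 ⟨y1, y2, y0, by rw [ey]; module⟩
      exact Or.inr (Or.inr (ht.rot.Pl_eq_of_mem hym hzm))
    · refine Or.inr (Or.inl ⟨-x3 / y3, ?_⟩)
      refine Tri.Pl_eq_of_mem (h := y) (ht.of_Sp ?_) ?_ hzm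
      · refine Sp_eq (mem_Sp.2 ⟨1, -x3 / y3, 0, 0, by module⟩) (mem_Sp3 _ _ _) (mem_Sp2 _ _ _) 
          (mem_Sp.2 ⟨1, 0, x3 / y3, 0, by module⟩) (mem_Sp3 _ _ _) (mem_Sp2 _ _ _)
      · refine mem_Pl.2 ⟨x1 - x3 / y3 * y1, x2 - x3 / y3 * y2, x0 - x3 / y3 * y0, ?_⟩
        rw [ex, ey]; match_scalars <;> field_simp <;> ring
  · refine Or.inl ⟨-x3 / z3, -y3 / z3, ?_⟩
    refine Tri.Pl_eq_of_mem (h := z) (ht.of_Sp ?_) ?_ ?_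
    · refine Sp_eq (mem_Sp.2 ⟨1, 0, -x3 / z3, 0, by module⟩) (mem_Sp.2 ⟨0, 1, -y3 / z3, 0, by module⟩) (mem_Sp3 _ _ _)
          (mem_Sp.2 ⟨1, 0, x3 / z3, 0, by module⟩) (mem_Sp.2 ⟨0, 1, y3 / z3, 0, by module⟩) (mem_Sp3 _ _ _)
    · refine mem_Pl.2 ⟨x1 - x3 / z3 * z1, x2 - x3 / z3 * z2, x0 - x3 / z3 * z0, ?_⟩
      rw [ex, ez]; match_scalars <;> field_simp <;> ring
    · refine mem_Pl.2 ⟨y1 - y3 / z3 * z1, y2 - y3 / z3 * z2, y0 - y3 / z3 * z0, ?_⟩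
      rw [ey, ez]; match_scalars <;> field_simp <;> ring

lemma Jc_one_right (f : P3) : Jc f 1 = 0 := by rw [← C_1, Jc_C_right]
lemma Jc_one_left (f : P3) : Jc 1 f = 0 := by rw [← C_1, Jc_C_left]

lemma Jc_lin (x y z : P3) (a1 a2 a3 a0 b1 b2 b3 b0 : ℂ) :
    Jc (a1 • x + a2 • y + a3 • z + a0 • (1 : P3)) (b1 • x + b2 • y + b3 • z + b0 • (1 : P3)) =
    (a1 * b2 - a2 * b1) • Jc x y + (a1 * b3 - a3 * b1) • Jc x z + (a2 * b3 - a3 * b2) • Jc y z := by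
  simp only [Jc_add_left, Jc_add_right, Jc_smul_left, Jc_smul_right, Jc_self, Jc_one_left, Jc_one_right,
    Jc_swap x y, Jc_swap x z, Jc_swap y z]
  module

namespace Wt
variable {θ : Wt}

lemma vdeg_lin_top {u v w : Fin 3 → P3} {a b c : ℂ} (ha : a ≠ 0) (h1 : θ.vdeg v < θ.vdeg u) (h2 : θ.vdeg w < θ.vdeg u) :
    θ.vdeg (a • u + b • v + c • w) = θ.vdeg u := by
  have e : a • u + b • v + c • w = a • u + (b • v + c • w) := by abel
  rw [e, θ.vdeg_add_eq, θ.vdeg_smulC ha]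
  rw [θ.vdeg_smulC ha]
  exact lt_of_le_of_lt (θ.vdeg_add_le _ _) (max_lt (lt_of_le_of_lt (θ.vdeg_smulC_le _ _) h1) (lt_of_le_of_lt (θ.vdeg_smulC_le _ _) h2))

/-- Lemma G -/
lemma lemG {x y z a b c : P3} (ht : Tri x y z) (e : Sp a b c = Sp x y z) (h1 : θ.om x z < θ.om x y) (h2 : θ.om y z < θ.om x z) :
    Pl a b = Pl y z ∨ θ.om x z ≤ θ.om a b := by
  have hT := ht.of_Sp e
  obtain ⟨a1, a2, a3, a0, ea⟩ := mem_Sp.1 (e ▸ mem_Sp1 a b c : a ∈ Sp x y z)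
  obtain ⟨b1, b2, b3, b0, eb⟩ := mem_Sp.1 (e ▸ mem_Sp2 a b c : b ∈ Sp x y z)
  have hJ := Jc_lin x y z a1 a2 a3 a0 b1 b2 b3 b0
  rw [← ea, ← eb] at hJ
  by_cases m1 : a1 * b2 - a2 * b1 = 0
  · by_cases m2 : a1 * b3 - a3 * b1 = 0
    · left
      have ha1 : a1 = 0 ∧ b1 = 0 := by
        have i1 := hT.indep (α := b1) (β := -a1) (γ := 0) (κ := b0 * a1 - b1 * a0) (by
          rw [ea, eb]
          have : b1 • (a1 • x + a2 • y + a3 • z + a0 • (1 : P3)) + -a1 • (b1 • x + b2 • y + b3 • z + b0 • (1 : P3)) + (0 : ℂ) • c + (b0 * a1 - b1 * a0) • (1 : P3) = -(a1 * b2 - a2 * b1) • y + -(a1 * b3 - a3 * b1) • z := by module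
          rw [this, m1, m2]; simp)
        exact ⟨neg_eq_zero.1 i1.2.1, i1.1⟩
      obtain ⟨rfl, rfl⟩ := ha1
      exact hT.Pl_eq_of_mem (mem_Pl.2 ⟨a2, a3, a0, by rw [ea]; module⟩) (mem_Pl.2 ⟨b2, b3, b0, by rw [eb]; module⟩)
    · right
      rw [m1, zero_smul, zero_add] at hJ
      unfold om at *
      rw [hJ, θ.vdeg_add_eq, θ.vdeg_smulC m2]
      rw [θ.vdeg_smulC m2]
      exact lt_of_le_of_lt (θ.vdeg_smulC_le _ _) h2
  · right
    unfold om at *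
    rw [hJ, vdeg_lin_top m1 h1 (h2.trans h1)]
    exact h1.le

lemma om_Pl {y z y' z' : P3} (ht : Jc y' z' ≠ 0) (hy : y' ∈ Pl y z) (hz : z' ∈ Pl y z) : θ.om y' z' = θ.om y z := by
  obtain ⟨a2, a3, a0, ea⟩ := mem_Pl.1 hy
  obtain ⟨b2, b3, b0, eb⟩ := mem_Pl.1 hz
  have hJ := Jc_lin 0 y z 0 a2 a3 a0 0 b2 b3 b0
  simp only [zero_mul, smul_zero, zero_add, mul_zero, sub_zero, zero_smul] at hJ
  rw [← ea, ← eb] at hJ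
  have hm : a2 * b3 - a3 * b2 ≠ 0 := by
    intro h0; rw [h0, zero_smul] at hJ; exact ht hJ
  unfold om; rw [hJ, θ.vdeg_smulC hm]

lemma flag_aux {x y z x' y' z' : P3} (ht : Tri x y z) (e : Sp x' y' z' = Sp x y z) (h1 : θ.om x z < θ.om x y) (h2 : θ.om y z < θ.om x z)
    (hP : Pl y' z' = Pl y z) :
    (z' ∈ Pl y z) ∧ ((∃ g k : ℂ, z' = g • z + k • (1 : P3)) ∨ θ.om x' z' = θ.om x y) := by
  have hT := ht.of_Sp e
  have hz : z' ∈ Pl y z := hP ▸ right_mem_Pl y' z'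
  refine ⟨hz, ?_⟩
  obtain ⟨b2, b3, b0, eb⟩ := mem_Pl.1 hz
  obtain ⟨a1, a2, a3, a0, ea⟩ := mem_Sp.1 (e ▸ mem_Sp1 x' y' z' : x' ∈ Sp x y z)
  have ha : a1 ≠ 0 := by
    rintro rfl
    apply hT.rot.not_mem
    rw [hP]; exact mem_Pl.2 ⟨a2, a3, a0, by rw [ea]; module⟩
  by_cases hb : b2 = 0
  · left; exact ⟨b3, b0, by rw [eb, hb]; module⟩
  · right
    have hJ := Jc_lin x y z a1 a2 a3 a0 0 b2 b3 b0
    rw [← ea, show (0 : ℂ) • x + b2 • y + b3 • z + b0 • (1 : P3) = z' by rw [eb]; module] at hJ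
    unfold om at *
    rw [hJ, vdeg_lin_top (by simp [ha, hb]) h1 (h2.trans h1)]

/-- Flag lemma -/
lemma flag {x y z x' y' z' : P3} (ht : Tri x y z) (e : Sp x' y' z' = Sp x y z) (h1 : θ.om x z < θ.om x y) (h2 : θ.om y z < θ.om x z)
    (h1' : θ.om x' z' < θ.om x' y') (h2' : θ.om y' z' < θ.om x' z') :
    Pl y' z' = Pl y z ∧ (∃ g k : ℂ, z' = g • z + k • (1 : P3)) ∧ θ.om y' z' = θ.om y z ∧ θ.om x' z' = θ.om x z ∧
      θ.om x' y' = θ.om x y := by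
  have hT := ht.of_Sp e
  have hP : Pl y' z' = Pl y z := by
    rcases lemG ht (a := y') (b := z') (c := x') (by rw [← Sp_rot]; exact e) h1 h2 with h | h
    · exact h
    · rcases lemG hT (a := y) (b := z) (c := x) (by rw [← Sp_rot]; exact e.symm) h1' h2' with h' | h'
      · exact h'.symm
      · linarith
  have hyz : θ.om y' z' = θ.om y z := om_Pl hT.rot.Jc_ne (hP ▸ left_mem_Pl _ _) (hP ▸ right_mem_Pl _ _)
  obtain ⟨hz, hz2⟩ := flag_aux ht e h1 h2 hP
  have hzz : ∃ g k : ℂ, z' = g • z + k • (1 : P3) := by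
    rcases hz2 with h | h
    · exact h
    · obtain ⟨-, h3⟩ := flag_aux hT e.symm h1' h2' hP.symm
      rcases h3 with ⟨g, k, h3⟩ | h3
      · have hg : g ≠ 0 := by
          rintro rfl
          apply ht.rot.Jc_ne
          rw [h3, zero_smul, zero_add, Jc_smul_right, Jc_one_right, smul_zero]
        refine ⟨g⁻¹, -(g⁻¹ * k), ?_⟩
        rw [h3]; match_scalars <;> field_simp <;> ring
      · linarith
  refine ⟨hP, hzz, hyz, ?_⟩
  obtain ⟨g, k, hzz⟩ := hzz
  have hg : g ≠ 0 := by
    rintro rfl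
    apply hT.rot.Jc_ne
    rw [hzz, zero_smul, zero_add, Jc_smul_right, Jc_one_right, smul_zero]
  obtain ⟨b2, b3, b0, eb⟩ := mem_Pl.1 (hP ▸ left_mem_Pl y' z' : y' ∈ Pl y z)
  obtain ⟨a1, a2, a3, a0, ea⟩ := mem_Sp.1 (e ▸ mem_Sp1 x' y' z' : x' ∈ Sp x y z)
  have ha : a1 ≠ 0 := by
    rintro rfl
    apply hT.rot.not_mem
    rw [hP]; exact mem_Pl.2 ⟨a2, a3, a0, by rw [ea]; module⟩
  have hb : b2 ≠ 0 := by
    rintro rfl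
    apply hT.rot.Jc_ne
    rw [eb, hzz]
    simp [Jc_add_left, Jc_add_right, Jc_smul_left, Jc_smul_right, Jc_self, Jc_one_left, Jc_one_right]
  constructor
  · have hJ := Jc_lin x y z a1 a2 a3 a0 0 0 g k
    rw [← ea, show (0 : ℂ) • x + (0 : ℂ) • y + g • z + k • (1 : P3) = z' by rw [hzz]; module] at hJ
    simp only [mul_zero, sub_zero, zero_smul, zero_add] at hJ
    unfold om at *
    rw [hJ, θ.vdeg_add_eq, θ.vdeg_smulC (mul_ne_zero ha hg)]
    rw [θ.vdeg_smulC (mul_ne_zero ha hg)]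
    exact lt_of_le_of_lt (θ.vdeg_smulC_le _ _) h2
  · have hJ := Jc_lin x y z a1 a2 a3 a0 0 b2 b3 b0
    rw [← ea, show (0 : ℂ) • x + b2 • y + b3 • z + b0 • (1 : P3) = y' by rw [eb]; module] at hJ
    unfold om at *
    rw [hJ, vdeg_lin_top (by simp [ha, hb]) h1 (h2.trans h1)]

/-- interface to the SU inequality -/
lemma nc_or {f g x : P3} (h : Jc f g ≠ 0) (hx : x ∈ Alg f g) :
    ((∀ M : Submodule ℂ P3, (∀ i j : ℕ, (i : ℝ) * θ.deg f + j * θ.deg g ≤ θ.deg x → f ^ i * g ^ j ∈ M) → x ∈ M) ∧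
      (x ≠ 0 → ∃ i j : ℕ, (i : ℝ) * θ.deg f + j * θ.deg g = θ.deg x)) ∨
    ∃ φ p q k i j ε, θ.Canc f g φ p q k i j ε ∧ ev f g φ = x := by
  obtain ⟨φ, rfl⟩ := mem_Alg.1 hx
  rcases θ.su_cases h φ with h1 | ⟨p, q, k, i, j, ε, c⟩
  · left
    refine ⟨fun M hM => ev_mem M fun u hu => hM _ _ (h1 u hu), fun h0 => ?_⟩
    have hs : φ.support.Nonempty := by
      rw [Finset.nonempty_iff_ne_empty, Ne, MvPolynomial.support_eq_empty]
      rintro rfl; simp at h0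
    obtain ⟨m, hm, hmax⟩ := Finset.exists_max_image φ.support (θ.mw f g) hs
    exact ⟨m 0, m 1, le_antisymm (h1 m hm) (θ.deg_ev_le f g φ (θ.mw_nonneg f g m) hmax)⟩
  · right; exact ⟨φ, p, q, k, i, j, ε, c, rfl⟩

/-- trichotomy of cancellation -/
lemma Canc.cases {f g : P3} {φ : P2} {p q k i j : ℕ} {ε : ℝ} (c : θ.Canc f g φ p q k i j ε) :
    (p = 1 ∧ θ.deg g = q * θ.deg f) ∨ (q = 1 ∧ θ.deg f = p * θ.deg g) ∨
    (2 ≤ p ∧ 2 ≤ q ∧ p ≠ q ∧ θ.om f g + ε ≤ θ.deg (ev f g φ)) := by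
  rcases Nat.lt_or_ge p 2 with hp | hp
  · left
    have : p = 1 := by have := c.hp; omega
    subst this
    refine ⟨rfl, ?_⟩
    rw [c.hf, c.hg]; push_cast; ring
  rcases Nat.lt_or_ge q 2 with hq | hq
  · right; left
    have : q = 1 := by have := c.hq; omega
    subst this
    refine ⟨rfl, ?_⟩
    rw [c.hf, c.hg]; push_cast; ring
  right; right
  have hne : p ≠ q := by
    rintro rfl
    have := c.cop
    rw [Nat.coprime_self] at this; omega
  refine ⟨hp, hq, hne, ?_⟩
  have hge := c.ge
  have h1 : p + q + 1 ≤ p * q := by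
    rcases Nat.lt_or_gt_of_ne hne with h | h <;> nlinarith
  have h2 : (p : ℝ) + q + 1 ≤ p * q := by exact_mod_cast h1
  have h3 : (1 : ℝ) ≤ k := by exact_mod_cast c.hk
  have h4 := c.hε
  have h5 : 0 ≤ θ.om f g := θ.vdeg_nonneg _
  have h6 : ε ≤ (p * q - p - q) * ε := by nlinarith
  have h7 : 0 ≤ i * θ.deg f := mul_nonneg (Nat.cast_nonneg _) (θ.deg_nonneg _)
  have h8 : 0 ≤ j * θ.deg g := mul_nonneg (Nat.cast_nonneg _) (θ.deg_nonneg _)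
  nlinarith

lemma Canc.three_two {f g : P3} {φ : P2} {p q k i j : ℕ} {ε δ : ℝ} (c : θ.Canc f g φ p q k i j ε)
    (hf : θ.deg f = 3 * δ) (hg : θ.deg g = 2 * δ) (hδ : 0 < δ) : p = 3 ∧ q = 2 ∧ ε = δ := by
  have h1 := c.hf; have h2 := c.hg
  have h3 : (2 * p : ℝ) = 3 * q := by
    have : ε * (2 * p : ℝ) = ε * (3 * q) := by nlinarith
    exact mul_left_cancel₀ c.hε.ne' this
  have h4 : 2 * p = 3 * q := by exact_mod_cast h3
  have h5 : q ∣ 2 := by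
    have : q ∣ 2 * p := ⟨3, by omega⟩
    exact c.cop.symm.dvd_of_dvd_mul_right this
  have h6 : q ≤ 2 := Nat.le_of_dvd (by norm_num) h5
  have h7 := c.hq
  have h8 : q = 2 := by omega
  have h9 : p = 3 := by omega
  subst h8 h9
  refine ⟨rfl, rfl, ?_⟩
  push_cast at h1; linarith

end Wt


lemma ilt {i j n : ℕ} {F G r : ℝ} (hF : 0 < F) (hG : 0 < G) (h : (i : ℝ) * F + j * G ≤ r) (h2 : r < n * F) : i < n := by
  have h3 : 0 ≤ (j : ℝ) * G := by positivity
  have h4 : (i : ℝ) * F < n * F := by linarith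
  exact_mod_cast lt_of_mul_lt_mul_right h4 hF.le

lemma jlt {i j n : ℕ} {F G r : ℝ} (hF : 0 < F) (hG : 0 < G) (h : (i : ℝ) * F + j * G ≤ r) (h2 : r < n * G) : j < n :=
  ilt hG hF (i := j) (j := i) (by linarith) h2

namespace Wt
variable {θ : Wt}

/-- type of the non-cancelling alternative -/
def NC (θ : Wt) (f g x : P3) : Prop :=
  (∀ M : Submodule ℂ P3, (∀ i j : ℕ, (i : ℝ) * θ.deg f + j * θ.deg g ≤ θ.deg x → f ^ i * g ^ j ∈ M) → x ∈ M) ∧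
      (x ≠ 0 → ∃ i j : ℕ, (i : ℝ) * θ.deg f + j * θ.deg g = θ.deg x)

def Cn (θ : Wt) (f g x : P3) : Prop := ∃ φ p q k i j ε, θ.Canc f g φ p q k i j ε ∧ ev f g φ = x

lemma nc_cn {f g x : P3} (h : Jc f g ≠ 0) (hx : x ∈ Alg f g) : θ.NC f g x ∨ θ.Cn f g x := nc_or h hx

lemma NC.lin {f g x : P3} (h : θ.NC f g x) (hij : ∀ i j : ℕ, (i : ℝ) * θ.deg f + j * θ.deg g ≤ θ.deg x → i + j ≤ 1) :
    x ∈ Pl f g := by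
  apply h.1
  intro i j hh
  have := hij i j hh
  have h3 : (i = 0 ∧ j = 0) ∨ (i = 1 ∧ j = 0) ∨ (i = 0 ∧ j = 1) := by omega
  rcases h3 with ⟨rfl, rfl⟩ | ⟨rfl, rfl⟩ | ⟨rfl, rfl⟩
  · simpa using one_mem_Pl _ _
  · simpa using left_mem_Pl _ _
  · simpa using right_mem_Pl _ _

lemma NC.const {f g x : P3} (h : θ.NC f g x) (hij : ∀ i j : ℕ, (i : ℝ) * θ.deg f + j * θ.deg g ≤ θ.deg x → i = 0 ∧ j = 0) :
    ∃ κ : ℂ, x = κ • (1 : P3) := by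
  have := h.1 (Submodule.span ℂ {1}) (by
    intro i j hh
    obtain ⟨rfl, rfl⟩ := hij i j hh
    simpa using Submodule.mem_span_singleton_self _)
  obtain ⟨κ, hκ⟩ := Submodule.mem_span_singleton.1 this
  exact ⟨κ, hκ.symm⟩

lemma NC.quad {f g x : P3} (h : θ.NC f g x) (hij : ∀ i j : ℕ, (i : ℝ) * θ.deg f + j * θ.deg g ≤ θ.deg x → i + j ≤ 1 ∨ (i = 0 ∧ j = 2)) :
    x ∈ Sp f g (g ^ 2) := by
  apply h.1
  intro i j hh
  have := hij i j hh
  have h3 : (i = 0 ∧ j = 0) ∨ (i = 1 ∧ j = 0) ∨ (i = 0 ∧ j = 1) ∨ (i = 0 ∧ j = 2) := by omega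
  rcases h3 with ⟨rfl, rfl⟩ | ⟨rfl, rfl⟩ | ⟨rfl, rfl⟩ | ⟨rfl, rfl⟩
  · simpa using one_mem_Sp _ _ _
  · simpa using mem_Sp1 _ _ _
  · simpa using mem_Sp2 _ _ _
  · simpa using mem_Sp3 _ _ _

lemma om_top1 {x y z : P3} (s t : ℂ) (h1 : θ.om x z < θ.om x y) (h2 : θ.om y z < θ.om x y) :
    θ.om (x + s • z) (y + t • z) = θ.om x y := by
  have hJ := Jc_lin x y z 1 0 s 0 0 1 t 0
  have e1 : (1 : ℂ) • x + (0 : ℂ) • y + s • z + (0 : ℂ) • (1 : P3) = x + s • z := by module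
  have e2 : (0 : ℂ) • x + (1 : ℂ) • y + t • z + (0 : ℂ) • (1 : P3) = y + t • z := by module
  rw [e1, e2] at hJ
  unfold om at *
  rw [hJ, vdeg_lin_top (by simp) h1 h2]

lemma om_top2 {x y z : P3} (s : ℂ) (h2 : θ.om y z < θ.om x z) :
    θ.om (x + s • y) z = θ.om x z := by
  unfold om at *
  rw [Jc_add_left, Jc_smul_left, θ.vdeg_add_eq]
  exact lt_of_le_of_lt (θ.vdeg_smulC_le _ _) h2

lemma om_add {x y z : P3} (h2 : θ.om y z < θ.om x z) : θ.om (x + y) z = θ.om x z := by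
  have := om_top2 (θ := θ) 1 h2
  rwa [one_smul] at this

lemma om_add' {x y z : P3} (h2 : θ.om y z < θ.om x z) : θ.om (y + x) z = θ.om x z := by
  rw [add_comm]; exact om_add h2

lemma om_sq {x z : P3} (h : Jc x z ≠ 0) {k : ℂ} (hk : k ≠ 0) : θ.om (k • x ^ 2) z = θ.deg x + θ.om x z := by
  have hx : x ≠ 0 := by rintro rfl; apply h; rw [show (0 : P3) = (0 : ℂ) • 0 by simp, Jc_smul_left]; simp
  unfold om
  rw [Jc_smul_left, pow_two, Jc_mul_left, θ.vdeg_smulC hk, ← two_smul ℂ, θ.vdeg_smulC two_ne_zero, θ.vdeg_smul hx h]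

lemma om_self_sq (x : P3) (k : ℂ) : Jc (k • x ^ 2) x = 0 := by
  rw [Jc_smul_left, pow_two, Jc_mul_left, Jc_self]; simp

/-- om of ev with g -/
lemma om_ev0 {f g : P3} (h : Jc f g ≠ 0) {φ : P2} (hφ : pderiv 0 φ ≠ 0) :
    θ.om (ev f g φ) g = θ.deg (ev f g (pderiv 0 φ)) + θ.om f g := by
  unfold om
  rw [Jc_ev_left, Jc_self, smul_zero, add_zero, θ.vdeg_smul (ev_inj h hφ) h]

lemma om_ev1 {f g : P3} (h : Jc f g ≠ 0) {φ : P2} (hφ : pderiv 1 φ ≠ 0) :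
    θ.om (ev f g φ) f = θ.deg (ev f g (pderiv 1 φ)) + θ.om f g := by
  rw [θ.om_comm f g]
  unfold om
  rw [Jc_ev_left, Jc_self, smul_zero, zero_add, θ.vdeg_smul (ev_inj h hφ) (Jc_ne_swap h)]

/-- Reducible nodes -/
inductive Red (θ : Wt) : Submodule ℂ P3 → Prop
  | base (V : Submodule ℂ P3) (a b c : P3) (hV : V = Sp a b c) (ht : Tri a b c) (h : θ.dg V < 4) : Red θ V
  | elem (V V' : Submodule ℂ P3) (ha : Adj V V') (hd : θ.dg V' < θ.dg V) (hr : Red θ V') : Red θ V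
  | kred (V : Submodule ℂ P3) (A B C C' : P3) (δ : ℝ) (k : ℂ) (hg : θ.Good A B C) (hA : θ.deg A = 3 * δ) (hB : θ.deg B = 2 * δ)
      (hC : 2 * θ.deg C ≤ 3 * δ) (hm : C' - C ∈ Alg A B) (hlt : θ.deg C' < θ.deg C) (hom : 3 * δ + θ.om A B ≤ θ.om B C)
      (hk : k ≠ 0) (hV : V = Sp (A + k • C ^ 2) B C) (hr : Red θ (Sp A B C')) : Red θ V

lemma _root_.Adj.tri {V V' : Submodule ℂ P3} (h : Adj V V') : ∃ a b c, V = Sp a b c ∧ Tri a b c := by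
  obtain ⟨a, b, c, c', h, hc, e, e'⟩ := h
  exact ⟨a, b, c, e, h⟩

lemma Red.tri {V : Submodule ℂ P3} (h : Red θ V) : ∃ a b c, V = Sp a b c ∧ Tri a b c := by
  cases h with
  | base _ a b c hV ht h => exact ⟨a, b, c, hV, ht⟩
  | elem _ V1 ha hd hr => exact ha.tri
  | kred _ A B C C1 δ k hg hA hB hC hm hlt hom hk hV hr =>
    refine ⟨_, _, _, hV, ?_⟩
    have : Tri B C (A + k • C ^ 2) := hg.tri.rot.add_Alg (Subalgebra.smul_mem _ (pow_mem (right_mem_Alg _ _) _) _)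
    exact this.rot.rot

/-- normalisation of neighbours -/
lemma _root_.Adj.norm {x y z : P3} {V' : Submodule ℂ P3} (hg : θ.Good x y z) (hzy : θ.deg z < θ.deg y) (hyx : θ.deg y < θ.deg x)
    (ha : Adj (Sp x y z) V') :
    (∃ (s t : ℂ) (h' : P3), θ.Good (x + s • z) (y + t • z) z ∧ θ.deg (x + s • z) = θ.deg x ∧ θ.deg (y + t • z) = θ.deg y ∧
      h' - z ∈ Alg (x + s • z) (y + t • z) ∧ θ.Good (x + s • z) (y + t • z) h' ∧ V' = Sp (x + s • z) (y + t • z) h' ∧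
      Sp (x + s • z) (y + t • z) z = Sp x y z ∧ θ.dg V' - θ.dg (Sp x y z) = θ.deg h' - θ.deg z) ∨
    (∃ (s : ℂ) (h' : P3), θ.Good (x + s • y) z y ∧ θ.deg (x + s • y) = θ.deg x ∧
      h' - y ∈ Alg (x + s • y) z ∧ θ.Good (x + s • y) z h' ∧ V' = Sp (x + s • y) z h' ∧
      Sp (x + s • y) z y = Sp x y z ∧ θ.dg V' - θ.dg (Sp x y z) = θ.deg h' - θ.deg y) ∨
    (∃ h' : P3, h' - x ∈ Alg y z ∧ θ.Good y z h' ∧ V' = Sp y z h' ∧ θ.dg V' - θ.dg (Sp x y z) = θ.deg h' - θ.deg x) := by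
  obtain ⟨a, b, c, c', ht, hc, e, rfl⟩ := ha
  have hS := e
  have ds : ∀ (u v : P3) (s : ℂ), θ.deg v < θ.deg u → θ.deg (u + s • v) = θ.deg u := fun u v s h =>
    θ.deg_add_eq (lt_of_le_of_lt (θ.deg_smul_le _ _) h)
  have mk : ∀ f g h : P3, θ.Good f g h → Sp f g h = Sp x y z → Pl f g = Pl a b → 
      ∃ h', h' - h ∈ Alg f g ∧ θ.Good f g h' ∧ Sp a b c' = Sp f g h' ∧ θ.dg (Sp a b c') - θ.dg (Sp x y z) = θ.deg h' - θ.deg h := by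
    intro f g h hG h1 h2
    obtain ⟨h', q1, q2, q3⟩ := θ.rebase_good ht hc h2 (h1.trans e) hG.2.1
    refine ⟨h', q1, q3, q2.symm, ?_⟩
    rw [← q2, q3.dg, ← h1, hG.dg]; ring
  rcases plane3 hg.tri e.symm with ⟨s, t, hP⟩ | ⟨s, hP⟩ | hP
  · left
    have d1 := ds x z s (hzy.trans hyx)
    have d2 := ds y z t hzy
    have e2 : Sp (x + s • z) (y + t • z) z = Sp x y z :=
      Sp_eq (mem_Sp.2 ⟨1, 0, s, 0, by module⟩) (mem_Sp.2 ⟨0, 1, t, 0, by module⟩) (mem_Sp3 _ _ _)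
          (mem_Sp.2 ⟨1, 0, -s, 0, by module⟩) (mem_Sp.2 ⟨0, 1, -t, 0, by module⟩) (mem_Sp3 _ _ _)
    have hG : θ.Good (x + s • z) (y + t • z) z := ⟨hg.tri.of_Sp e2, by rw [d1, d2]; exact hyx.ne', by rw [d1]; exact (hzy.trans hyx).ne', by rw [d2]; exact hzy.ne'⟩
    obtain ⟨h', q1, q2, q3, q4⟩ := mk _ _ _ hG e2 hP
    exact ⟨s, t, h', hG, d1, d2, q1, q2, q3, e2, q4⟩
  · right; left
    have d1 := ds x y s hyx
    have e2 : Sp (x + s • y) z y = Sp x y z :=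
      Sp_eq (mem_Sp.2 ⟨1, s, 0, 0, by module⟩) (mem_Sp3 _ _ _) (mem_Sp2 _ _ _)
          (mem_Sp.2 ⟨1, 0, -s, 0, by module⟩) (mem_Sp3 _ _ _) (mem_Sp2 _ _ _)
    have hG : θ.Good (x + s • y) z y := ⟨hg.tri.of_Sp e2, by rw [d1]; exact (hzy.trans hyx).ne', by rw [d1]; exact hyx.ne', hzy.ne⟩
    obtain ⟨h', q1, q2, q3, q4⟩ := mk _ _ _ hG e2 hP
    exact ⟨s, h', hG, d1, q1, q2, q3, e2, q4⟩
  · right; right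
    obtain ⟨h', q1, q2, q3, q4⟩ := mk _ _ _ hg.rot (Sp_rot _ _ _).symm hP
    exact ⟨h', q1, q2, q3, q4⟩

lemma deg_sub_le_of {h h' : P3} {r : ℝ} (h1 : θ.deg h' ≤ r) (h2 : θ.deg h ≤ r) : θ.deg (h' - h) ≤ r :=
  (θ.deg_sub_le _ _).trans (max_le h1 h2)

lemma deg_sub_eq_of {h h' : P3} (h1 : θ.deg h' < θ.deg h) : θ.deg (h' - h) = θ.deg h := by
  rw [← neg_sub, θ.deg_neg, θ.deg_sub_eq h1]

lemma c32 {A B x : P3} {δ : ℝ} (hJ : Jc A B ≠ 0) (hA : θ.deg A = 3 * δ) (hB : θ.deg B = 2 * δ) (hx : x ∈ Alg A B)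
    (hd : θ.deg x < 2 * δ) : (∃ κ : ℂ, x = κ • (1 : P3)) ∨ ∃ φ, θ.Canc A B φ 3 2 1 0 0 δ ∧ ev A B φ = x := by
  have h1 := θ.Jc_pos_left hJ
  have hδ : 0 < δ := by linarith
  have hω := θ.two_le_om hJ
  rcases nc_cn hJ hx with h | ⟨φ, p, q, k, i, j, ε, c, rfl⟩
  · left
    apply h.const
    intro i j hij
    rw [hA, hB] at hij
    have i1 := ilt (n := 1) (by linarith) (by linarith) hij (by push_cast; linarith)
    have j1 := jlt (n := 1) (by linarith) (by linarith) hij (by push_cast; linarith)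
    omega
  · right
    obtain ⟨rfl, rfl, rfl⟩ := c.three_two hA hB hδ
    have hge := c.ge
    rw [hA, hB] at hge
    push_cast at hge
    have hk := c.hk
    have p1 : 0 ≤ (i : ℝ) * (3 * ε) := by positivity
    have p2 : 0 ≤ (j : ℝ) * (2 * ε) := by positivity
    have p3 : 0 ≤ (k : ℝ) * (ε + θ.om A B) := by positivity
    have e3 : (k : ℝ) * ((3 * 2 - 3 - 2) * ε + θ.om A B) = k * (ε + θ.om A B) := by ring
    rw [e3] at hge
    have hk2 : k < 2 := by
      by_contra hk2
      push Not at hk2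
      have : (2 : ℝ) ≤ k := by exact_mod_cast hk2
      nlinarith
    have hk1 : k = 1 := by omega
    subst hk1
    have hi : i < 1 := by
      by_contra hi; push Not at hi
      have : (1 : ℝ) ≤ i := by exact_mod_cast hi
      nlinarith
    have hj : j < 1 := by
      by_contra hi; push Not at hi
      have : (1 : ℝ) ≤ j := by exact_mod_cast hi
      nlinarith
    obtain rfl : i = 0 := by omega
    obtain rfl : j = 0 := by omega
    exact ⟨φ, c, rfl⟩

lemma deg_const (κ : ℂ) : θ.deg (κ • (1 : P3)) = 0 := by rw [← C_smul_one, θ.deg_C]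

lemma Canc.om32 {A B : P3} {δ : ℝ} {φ : P2} (hJ : Jc A B ≠ 0) (c : θ.Canc A B φ 3 2 1 0 0 δ) :
    θ.om (ev A B φ) B = 3 * δ + θ.om A B ∧ θ.om (ev A B φ) A = 4 * δ + θ.om A B ∧ δ + θ.om A B ≤ θ.deg (ev A B φ) := by
  refine ⟨?_, ?_, ?_⟩
  · rw [om_ev0 hJ c.pd0, c.deg_pd0_eq hJ]; push_cast; ring
  · rw [om_ev1 hJ c.pd1, c.deg_pd1_eq hJ]; push_cast; ring
  · have := c.ge; push_cast at this; linarith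

/-- basic facts when the third element is reducible by the other two -/
lemma cfacts {A B C C' : P3} {δ : ℝ} (hg : θ.Good A B C) (hA : θ.deg A = 3 * δ) (hB : θ.deg B = 2 * δ)
      (hC : 2 * θ.deg C ≤ 3 * δ) (hm : C' - C ∈ Alg A B) (hlt : θ.deg C' < θ.deg C) :
    (∃ φ, θ.Canc A B φ 3 2 1 0 0 δ ∧ ev A B φ = C' - C) ∧ δ + θ.om A B ≤ θ.deg C ∧ 4 ≤ δ ∧ 2 ≤ θ.om A B := by
  have hJ := hg.tri.Jc_ne
  have hd := deg_sub_eq_of hlt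
  have hω := θ.two_le_om hJ
  have hCp := θ.Tri_deg_pos hg.tri.rot.rot
  rcases c32 hJ hA hB hm (by rw [hd]; linarith) with ⟨κ, hκ⟩ | ⟨φ, c, hφ⟩
  · rw [hκ, deg_const] at hd; linarith
  · have := (c.om32 hJ).2.2
    rw [hφ, hd] at this
    exact ⟨⟨φ, c, hφ⟩, this, by linarith, hω⟩

lemma kfacts {A B C C' : P3} {δ : ℝ} {k : ℂ} (hg : θ.Good A B C) (hA : θ.deg A = 3 * δ) (hB : θ.deg B = 2 * δ)
      (hC : 2 * θ.deg C ≤ 3 * δ) (hm : C' - C ∈ Alg A B) (hlt : θ.deg C' < θ.deg C) (hom : 3 * δ + θ.om A B ≤ θ.om B C)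
      (hk : k ≠ 0) : δ + θ.om A B ≤ θ.deg C ∧ 4 ≤ δ ∧ 2 ≤ θ.om A B ∧ θ.om A C = θ.om B C + δ ∧
      θ.om (A + k • C ^ 2) B = θ.deg C + θ.om B C ∧ θ.om (A + k • C ^ 2) C = θ.om B C + δ ∧
      2 * δ < θ.deg (A + k • C ^ 2) ∧ θ.deg (A + k • C ^ 2) ≤ 3 * δ ∧ Tri (A + k • C ^ 2) B C := by
  obtain ⟨-, h1, h2, h3⟩ := cfacts hg hA hB hC hm hlt
  have hac : θ.om A C = θ.om B C + δ := by
    have t1 := θ.TM hg.tri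
    have t2 := θ.TM hg.tri.swap
    rw [θ.om_comm B A] at t2
    have hw := θ.W0_le
    rw [le_max_iff, le_max_iff, hA, hB] at t1 t2
    rcases t1 with (t1 | t1) | t1
    · rcases t2 with (t2 | t2) | t2 <;> linarith
    · linarith
    · linarith
  have hCB : Jc C B ≠ 0 := Jc_ne_swap hg.tri.rot.Jc_ne
  have e1 : θ.om (A + k • C ^ 2) B = θ.deg C + θ.om B C := by
    rw [om_add', om_sq hCB hk, θ.om_comm C B]
    rw [om_sq hCB hk, θ.om_comm C B]; linarith
  have e2 : θ.om (A + k • C ^ 2) C = θ.om B C + δ := by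
    rw [← hac]; unfold om; rw [Jc_add_left, om_self_sq, add_zero]
  have hle := θ.om_le (A + k • C ^ 2) B
  refine ⟨h1, h2, h3, hac, e1, e2, by linarith, ?_, ?_⟩
  · refine (θ.deg_add_le _ _).trans (max_le hA.le ((θ.deg_smul_le _ _).trans ?_))
    rw [θ.deg_pow]; push_cast; exact hC
  · have : Tri B C (A + k • C ^ 2) := hg.tri.rot.add_Alg (Subalgebra.smul_mem _ (pow_mem (right_mem_Alg _ _) _) _)
    exact this.rot.rot

/-- Part II -/
lemma partII {V W : Submodule ℂ P3} {A B C C' : P3} {δ : ℝ} {k : ℂ} (hg : θ.Good A B C) (hA : θ.deg A = 3 * δ) (hB : θ.deg B = 2 * δ)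
      (hC : 2 * θ.deg C ≤ 3 * δ) (hm : C' - C ∈ Alg A B) (hlt : θ.deg C' < θ.deg C) (hom : 3 * δ + θ.om A B ≤ θ.om B C)
      (hk : k ≠ 0) (hV : V = Sp (A + k • C ^ 2) B C) (hr : Red θ (Sp A B C')) (ha : Adj V W) (hd : θ.dg W ≤ θ.dg V) : Red θ W := by
  obtain ⟨f1, f2, f3, f4, f5, f6, f7, f8, f9⟩ := kfacts hg hA hB hC hm hlt hom hk
  have hRV : Red θ V := Red.kred V A B C C' δ k hg hA hB hC hm hlt hom hk hV hr
  have hG : θ.Good (A + k • C ^ 2) B C := ⟨f9, by linarith [hB] |> ne_of_gt, by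
    apply ne_of_gt; linarith, by apply ne_of_gt; linarith⟩
  subst hV
  rcases ha.norm hG (by linarith) (by linarith) with ⟨s, t, h', q1, q2, q3, q4, q5, q6, q7, q8⟩ | ⟨s, h', q1, q2, q4, q5, q6, q7, q8⟩ | ⟨h', q4, q5, q6, q8⟩
  · have hx : θ.deg (h' - C) ≤ θ.deg C := deg_sub_le_of (by linarith) le_rfl
    have ho := om_top1 (θ := θ) (x := A + k • C ^ 2) (y := B) (z := C) s t (by linarith) (by linarith)
    rcases nc_cn q1.tri.Jc_ne q4 with h | ⟨φ, p, q, k', i, j, ε, c, e⟩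
    · obtain ⟨κ, hκ⟩ := h.const (by
        intro i j hij
        rw [q2, q3] at hij
        have i1 := ilt (n := 1) (by linarith) (by linarith) hij (by push_cast; linarith)
        have j1 := jlt (n := 1) (by linarith) (by linarith) hij (by push_cast; linarith)
        omega)
      rw [q6, Sp_third one_ne_zero (c := C) (x := κ • (1 : P3)) (Submodule.smul_mem _ _ (one_mem_Pl _ _)) (by rw [← hκ]; simp), q7]
      exact hRV
    · have := c.om_g q1.tri.Jc_ne
      rw [e, ho] at this; linarith
  · have hx : θ.deg (h' - B) ≤ θ.deg B := deg_sub_le_of (by linarith) le_rfl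
    have ho := om_top2 (θ := θ) (x := A + k • C ^ 2) (y := B) (z := C) s (by linarith)
    rcases nc_cn q1.tri.Jc_ne q4 with h | ⟨φ, p, q, k', i, j, ε, c, e⟩
    · have hl := h.lin (by
        intro i j hij
        rw [q2] at hij
        have i1 := ilt (n := 1) (by linarith) (by linarith) hij (by push_cast; linarith)
        have j1 := jlt (n := 2) (by linarith) (by linarith) hij (by push_cast; linarith)
        omega)
      rw [q6, Sp_third one_ne_zero hl (c := B) (by simp), q7]
      exact hRV
    · have := c.om_g q1.tri.Jc_ne
      rw [e, ho] at this; linarith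
  · have hx : θ.deg (h' - (A + k • C ^ 2)) ≤ θ.deg (A + k • C ^ 2) := deg_sub_le_of (by linarith) le_rfl
    rcases nc_cn hG.rot.tri.Jc_ne q4 with h | ⟨φ, p, q, k', i, j, ε, c, e⟩
    · have hl := h.quad (by
        intro i j hij
        have i1 := ilt (n := 2) (by linarith) (by linarith) hij (by push_cast; linarith)
        have j1 := jlt (n := 3) (by linarith) (by linarith) hij (by push_cast; linarith)
        rcases (show i = 0 ∨ i = 1 by omega) with rfl | rfl
        · omega
        · rw [hB] at hij
          push_cast at hij
          have j2 := jlt (i := 0) (j := j) (n := 1) (F := 1) (G := θ.deg C) (r := δ) (by linarith) (by linarith) (by push_cast; linarith) (by push_cast; linarith)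
          omega)
      obtain ⟨b, c, a, κ, e⟩ := mem_Sp.1 hl
      have hW : W = Sp (A + (k + a) • C ^ 2) B C := by
        rw [q6, Sp_rot (A + (k + a) • C ^ 2) B C]
        refine Sp_third one_ne_zero (mem_Pl.2 ⟨b, c, κ, rfl⟩) ?_
        rw [sub_eq_iff_eq_add.1 e]; module
      by_cases hka : k + a = 0
      · rw [hka, zero_smul, add_zero] at hW
        refine Red.elem W _ ⟨A, B, C, C', hg.tri, hm, hW, rfl⟩ ?_ hr
        rw [hW, hg.dg]
        refine lt_of_le_of_lt (θ.Tri_dg_le (hg.tri.of_sub_Alg hm)) (by linarith)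
      · exact Red.kred W A B C C' δ (k + a) hg hA hB hC hm hlt hom hka hW hr
    · rcases c.cases with ⟨-, h1⟩ | ⟨-, h1⟩ | ⟨-, -, -, h1⟩
      · have : (1 : ℝ) ≤ q := by exact_mod_cast c.hq
        nlinarith
      · have h3 : p < 2 := ilt (i := p) (j := 0) (F := θ.deg C) (G := 1) (r := 2 * δ) (by linarith) (by linarith) (by push_cast; linarith) (by push_cast; linarith)
        have := c.hp
        obtain rfl : p = 1 := by omega
        push_cast at h1; linarith
      · have := c.hε
        rw [e] at h1; linarith

end Wt


namespace Wt
variable {θ : Wt}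

lemma Good.deg_mem {a b c x : P3} (h : θ.Good a b c) (hx : x ∈ Sp a b c) :
    θ.deg x = 0 ∨ θ.deg x = θ.deg a ∨ θ.deg x = θ.deg b ∨ θ.deg x = θ.deg c := by
  obtain ⟨α, β, γ, κ, e⟩ := mem_Sp.1 hx
  have pa := θ.Tri_deg_pos h.tri
  have pb := θ.Tri_deg_pos h.tri.rot
  have pc := θ.Tri_deg_pos h.tri.rot.rot
  have key : ∀ (u y : P3) (s : ℂ), θ.deg u ≠ θ.deg y → θ.deg (s • u + y) = θ.deg u ∨ θ.deg (s • u + y) = θ.deg y := by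
    intro u y s hne
    by_cases hs : s = 0
    · right; rw [hs, zero_smul, zero_add]
    · rcases lt_or_gt_of_ne hne with h | h
      · right; rw [θ.deg_add_eq']; rwa [θ.deg_smul hs]
      · left; rw [θ.deg_add_eq, θ.deg_smul hs]; rwa [θ.deg_smul hs]
  have k0 : θ.deg (κ • (1 : P3)) = 0 := deg_const κ
  have k1 := key c (κ • 1) γ (by rw [k0]; exact pc.ne')
  have k2 := key b (γ • c + κ • 1) β (by
    rcases k1 with k | k <;> rw [k]
    · exact h.2.2.2
    · rw [k0]; exact pb.ne')
  have k3 := key a (β • b + (γ • c + κ • 1)) α (by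
    rcases k2 with k | k <;> rw [k]
    · exact h.2.1
    rcases k1 with k | k <;> rw [k]
    · exact h.2.2.1
    · rw [k0]; exact pa.ne')
  have e' : x = α • a + (β • b + (γ • c + κ • 1)) := by rw [e]; module
  rw [← e'] at k3
  rcases k3 with k | k
  · exact Or.inr (Or.inl k)
  rcases k2 with k' | k'
  · exact Or.inr (Or.inr (Or.inl (k.trans k')))
  rcases k1 with k'' | k''
  · exact Or.inr (Or.inr (Or.inr (k.trans (k'.trans k''))))
  · exact Or.inl (k.trans (k'.trans (k''.trans k0)))

lemma Red.inv {V : Submodule ℂ P3} (h : Red θ V) : θ.dg V < 4 ∨ (∃ V', Adj V V' ∧ θ.dg V' < θ.dg V ∧ Red θ V') ∨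
    ∃ (A B C C' : P3) (δ : ℝ) (k : ℂ), θ.Good A B C ∧ θ.deg A = 3 * δ ∧ θ.deg B = 2 * δ ∧ 2 * θ.deg C ≤ 3 * δ ∧
      C' - C ∈ Alg A B ∧ θ.deg C' < θ.deg C ∧ 3 * δ + θ.om A B ≤ θ.om B C ∧ k ≠ 0 ∧ V = Sp (A + k • C ^ 2) B C ∧
      Red θ (Sp A B C') := by
  cases h with
  | base _ a b c hV ht h => exact Or.inl h
  | elem _ V1 ha hd hr => exact Or.inr (Or.inl ⟨V1, ha, hd, hr⟩)
  | kred _ A B C C1 δ k hg hA hB hC hm hlt hom hk hV hr => 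
    exact Or.inr (Or.inr ⟨A, B, C, C1, δ, k, hg, hA, hB, hC, hm, hlt, hom, hk, hV, hr⟩)

/-- inversion with flag information in the third case -/
lemma Red.inv_flag {x y z : P3} (h : Red θ (Sp x y z)) (ht : Tri x y z) (h1 : θ.om x z < θ.om x y) (h2 : θ.om y z < θ.om x z) :
    θ.dg (Sp x y z) < 4 ∨ (∃ V', Adj (Sp x y z) V' ∧ θ.dg V' < θ.dg (Sp x y z) ∧ Red θ V') ∨
    ∃ (A B C C' : P3) (δ : ℝ) (k : ℂ), θ.Good A B C ∧ θ.deg A = 3 * δ ∧ θ.deg B = 2 * δ ∧ 2 * θ.deg C ≤ 3 * δ ∧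
      C' - C ∈ Alg A B ∧ θ.deg C' < θ.deg C ∧ 
      Red θ (Sp A B C') ∧ δ + θ.om A B ≤ θ.deg C ∧ Sp (A + k • C ^ 2) B C = Sp x y z ∧ Pl B C = Pl y z ∧
      (∃ g κ : ℂ, g ≠ 0 ∧ C = g • z + κ • (1 : P3)) ∧ θ.deg C = θ.deg z ∧ θ.om x z = θ.om y z + δ ∧ θ.om x y = θ.om y z + θ.deg z := by
  rcases h.inv with h | h | ⟨A, B, C, C', δ, k, hg, hA, hB, hC, hm, hlt, hom, hk, hV, hr⟩
  · exact Or.inl h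
  · exact Or.inr (Or.inl h)
  · refine Or.inr (Or.inr ⟨A, B, C, C', δ, k, hg, hA, hB, hC, hm, hlt, hr, ?_⟩)
    obtain ⟨f1, f2, f3, f4, f5, f6, f7, f8, f9⟩ := kfacts hg hA hB hC hm hlt hom hk
    obtain ⟨g1, ⟨g, κ, g2⟩, g3, g4, g5⟩ := flag ht hV.symm h1 h2 (by linarith) (by linarith)
    have hg0 : g ≠ 0 := by
      rintro rfl
      have := θ.Tri_deg_pos hg.tri.rot.rot
      rw [g2, zero_smul, zero_add, deg_const] at this
      linarith
    have hz : 0 < θ.deg z := θ.Tri_deg_pos ht.rot.rot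
    have hdC : θ.deg C = θ.deg z := by
      rw [g2, θ.deg_add_eq, θ.deg_smul hg0]
      rw [deg_const, θ.deg_smul hg0]; exact hz
    exact ⟨f1, hV.symm, g1, ⟨g, κ, hg0, g2⟩, hdC, by linarith, by linarith⟩

lemma om_sel {x y z : P3} (s t : ℂ) (h1 : θ.om y z < θ.om x z) (h2 : θ.om x y < θ.om y z) :
    (s = 0 ∧ t = 0) ∨ θ.om y z ≤ θ.om (x + s • z) (y + t • z) := by
  have hJ := Jc_lin x y z 1 0 s 0 0 1 t 0
  have e1 : (1 : ℂ) • x + (0 : ℂ) • y + s • z + (0 : ℂ) • (1 : P3) = x + s • z := by module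
  have e2 : (0 : ℂ) • x + (1 : ℂ) • y + t • z + (0 : ℂ) • (1 : P3) = y + t • z := by module
  rw [e1, e2] at hJ
  unfold om at *
  by_cases ht : t = 0
  · by_cases hs : s = 0
    · exact Or.inl ⟨hs, ht⟩
    · right
      rw [show (1 * t - s * 0 : ℂ) = 0 by rw [ht]; ring, zero_smul, add_zero] at hJ
      have hs' : (0 * t - s * 1 : ℂ) ≠ 0 := by simpa using hs
      rw [hJ, add_comm, θ.vdeg_add_eq, θ.vdeg_smulC hs']
      rw [θ.vdeg_smulC hs']
      exact lt_of_le_of_lt (θ.vdeg_smulC_le _ _) h2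
  · right
    rw [hJ, show ∀ u v w : Fin 3 → P3, u + v + w = v + u + w by intro u v w; abel, vdeg_lin_top (by simpa using ht) (h2.trans h1) h1]
    exact h1.le

set_option maxHeartbeats 1000000 in
lemma Irr {A B C C' : P3} {δ : ℝ} (hg : θ.Good A B C) (hA : θ.deg A = 3 * δ) (hB : θ.deg B = 2 * δ)
      (hC : 2 * θ.deg C ≤ 3 * δ) (hm : C' - C ∈ Alg A B) (hlt : θ.deg C' < θ.deg C) 
      (hmin : ∀ y, y - C ∈ Alg A B → θ.deg C' ≤ θ.deg y) (hβ : θ.om B C < 3 * δ + θ.om A B) : ¬ Red θ (Sp A B C') := by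
  obtain ⟨⟨φ, c, hφ⟩, h1, h2, h3⟩ := cfacts hg hA hB hC hm hlt
  have hJ := hg.tri.Jc_ne
  obtain ⟨o1, o2, -⟩ := c.om32 hJ
  have e : C' = C + ev A B φ := by rw [hφ]; ring
  have hw := θ.W0_le
  have hac : θ.om A C < 4 * δ + θ.om A B := by
    have t2 := θ.TM hg.tri.swap
    rw [θ.om_comm B A] at t2
    rw [le_max_iff, le_max_iff, hA, hB] at t2
    rcases t2 with (t2 | t2) | t2 <;> linarith
  have ob : θ.om C' B = 3 * δ + θ.om A B := by
    rw [e, om_add', o1]; rw [o1, θ.om_comm]; exact hβ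
  have oa : θ.om C' A = 4 * δ + θ.om A B := by
    rw [e, om_add', o2]; rw [o2, θ.om_comm]; exact hac
  have hC' := θ.om_le C' B
  have hClo : δ + θ.om A B ≤ θ.deg C' := by linarith
  have hT : Tri A B C' := hg.tri.of_sub_Alg hm
  have hG : θ.Good A B C' := ⟨hT, hg.2.1, by apply ne_of_gt; linarith, by apply ne_of_gt; linarith⟩
  intro hR
  have hR' : Red θ (Sp C' A B) := by rwa [Sp_rot]
  rcases hR'.inv_flag hT.rot.rot (by linarith) (by linarith) with h | ⟨V', ha, hd, -⟩ | ⟨As, Bs, Cs, Cs', δs, k, _, _, _, _, _, _, _, _, _, _, _, _, f1, f2⟩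
  · rw [Sp_rot, hG.dg] at h; linarith
  · rw [Sp_rot] at ha hd
    rcases ha.norm hG (by linarith) (by linarith) with ⟨s, t, h', q1, q2, q3, q4, q5, q6, q7, q8⟩ | ⟨s, h', q1, q2, q4, q5, q6, q7, q8⟩ | ⟨h', q4, q5, q6, q8⟩
    · have hx : θ.deg (h' - C') = θ.deg C' := deg_sub_eq_of (by linarith)
      rcases nc_cn q1.tri.Jc_ne q4 with h | ⟨φ', p, q, k', i, j, ε, c', e'⟩
      · obtain ⟨i, j, hij⟩ := h.2 (by intro h0; rw [h0, θ.deg_zero] at hx; linarith)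
        rw [q2, q3] at hij
        have i1 := ilt (n := 1) (by linarith) (by linarith) hij.le (by push_cast; linarith)
        have j1 := jlt (n := 1) (by linarith) (by linarith) hij.le (by push_cast; linarith)
        obtain rfl : i = 0 := by omega
        obtain rfl : j = 0 := by omega
        rw [hx] at hij; push_cast at hij; linarith
      · have ho : (s = 0 ∧ t = 0) ∨ 3 * δ + θ.om A B ≤ θ.om (A + s • C') (B + t • C') := by
          rw [θ.om_comm] at ob oa
          rw [← ob]
          exact om_sel s t (by linarith) (by linarith)
        rcases ho with ⟨rfl, rfl⟩ | ho
        · simp only [zero_smul, add_zero] at q4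
          have := hmin h' (by have := add_mem q4 hm; rwa [sub_add_sub_cancel] at this)
          linarith
        · obtain ⟨rfl, rfl, rfl⟩ := c'.three_two (q2.trans hA) (q3.trans hB) (by linarith)
          have hge := c'.ge
          rw [e'] at hge
          have hk : (1 : ℝ) ≤ k' := by exact_mod_cast c'.hk
          push_cast at hge
          have p1 : 0 ≤ (i : ℝ) * θ.deg (A + s • C') := mul_nonneg (Nat.cast_nonneg _) (θ.deg_nonneg _)
          have p2 : 0 ≤ (j : ℝ) * θ.deg (B + t • C') := mul_nonneg (Nat.cast_nonneg _) (θ.deg_nonneg _)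
          nlinarith
    · have hx : θ.deg (h' - B) = θ.deg B := deg_sub_eq_of (by linarith)
      rw [θ.om_comm] at ob oa
      have ho := om_top2 (θ := θ) (x := A) (y := B) (z := C') s (by linarith)
      rcases nc_cn q1.tri.Jc_ne q4 with h | ⟨φ, p, q, k', i, j, ε, c, e⟩
      · obtain ⟨i, j, hij⟩ := h.2 (by intro h0; rw [h0, θ.deg_zero] at hx; linarith)
        rw [q2] at hij
        have i1 := ilt (n := 1) (by linarith) (by linarith) hij.le (by push_cast; linarith)
        have j1 := jlt (n := 2) (by linarith) (by linarith) hij.le (by push_cast; linarith)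
        obtain rfl : i = 0 := by omega
        rw [hx] at hij
        interval_cases j <;> push_cast at hij <;> linarith
      · have := c.om_g q1.tri.Jc_ne
        rw [e, ho] at this; linarith
    · have hx : θ.deg (h' - A) = θ.deg A := deg_sub_eq_of (by linarith)
      rcases nc_cn hG.rot.tri.Jc_ne q4 with h | ⟨φ, p, q, k', i, j, ε, c, e⟩
      · obtain ⟨i, j, hij⟩ := h.2 (by intro h0; rw [h0, θ.deg_zero] at hx; linarith)
        have i1 := ilt (n := 2) (by linarith) (by linarith) hij.le (by push_cast; linarith)
        have j1 := jlt (n := 3) (by linarith) (by linarith) hij.le (by push_cast; linarith)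
        rw [hx] at hij
        interval_cases i <;> interval_cases j <;> push_cast at hij <;> linarith
      · rcases c.cases with ⟨-, h1⟩ | ⟨-, h1⟩ | ⟨-, -, -, h1⟩
        · have : (1 : ℝ) ≤ q := by exact_mod_cast c.hq
          nlinarith
        · have h3 : p < 2 := ilt (i := p) (j := 0) (F := θ.deg C') (G := 1) (r := 2 * δ) (by linarith) (by linarith) (by push_cast; linarith) (by push_cast; linarith)
          have := c.hp
          obtain rfl : p = 1 := by omega
          push_cast at h1; linarith
        · have := c.hε
          rw [θ.om_comm] at ob
          rw [e] at h1; linarith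
  · linarith

lemma omACeq {A B C : P3} {δ : ℝ} (ht : Tri A B C) (hA : θ.deg A = 3 * δ) (hB : θ.deg B = 2 * δ)
    (h1 : θ.deg C + θ.om A B < 3 * δ + θ.om B C) (h2 : θ.W0 < 3 * δ + θ.om B C) : θ.om A C = θ.om B C + δ := by
  have t1 := θ.TM ht
  have t2 := θ.TM ht.swap
  rw [θ.om_comm B A] at t2
  rw [le_max_iff, le_max_iff, hA, hB] at t1 t2
  rcases t1 with (t1 | t1) | t1
  · rcases t2 with (t2 | t2) | t2 <;> linarith
  · linarith
  · linarith

lemma Irr3 {A B C A' : P3} {δ : ℝ} (hg : θ.Good A B C) (hA : θ.deg A = 3 * δ) (hB : θ.deg B = 2 * δ)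
      (hC : 3 * θ.deg C = 4 * δ) (hω : θ.om A B ≤ δ / 3) (hm : A' - A ∈ Alg B C) (hlt : θ.deg A' < θ.deg A) 
      (hmin : ∀ y, y - A ∈ Alg B C → θ.deg A' ≤ θ.deg y) : ¬ Red θ (Sp A' B C) := by
  have hJ := hg.tri.Jc_ne
  have hJ2 := hg.tri.rot.Jc_ne
  have h3 := θ.two_le_om hJ
  have hw := θ.W0_le
  have hw2 := θ.W0_ge
  have hβ : 5 / 3 * δ < θ.om B C := by
    have := θ.cross hg.tri.swap
    rw [θ.om_comm B A] at this; linarith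
  have hac := omACeq hg.tri hA hB (by linarith) (by linarith)
  have hx := deg_sub_eq_of hlt
  obtain ⟨φ, c, hφ⟩ : ∃ φ, θ.Canc B C φ 3 2 1 0 0 (2 / 3 * δ) ∧ ev B C φ = A' - A := by
    rcases nc_cn hJ2 hm with h | ⟨φ, p, q, k', i, j, ε, c, e⟩
    · exfalso
      obtain ⟨i, j, hij⟩ := h.2 (by intro h0; rw [h0, θ.deg_zero] at hx; linarith)
      have i1 := ilt (n := 2) (by linarith) (by linarith) hij.le (by push_cast; linarith)
      have j1 := jlt (n := 3) (by linarith) (by linarith) hij.le (by push_cast; linarith)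
      rw [hx] at hij
      interval_cases i <;> interval_cases j <;> push_cast at hij <;> linarith
    · obtain ⟨rfl, rfl, rfl⟩ := c.three_two (δ := 2 / 3 * δ) (by linarith) (by linarith) (by linarith)
      have hge := c.ge
      rw [e, hx] at hge
      push_cast at hge
      have hk := c.hk
      have p1 : 0 ≤ (i : ℝ) * θ.deg B := mul_nonneg (Nat.cast_nonneg _) (θ.deg_nonneg _)
      have p2 : 0 ≤ (j : ℝ) * θ.deg C := mul_nonneg (Nat.cast_nonneg _) (θ.deg_nonneg _)
      have hk2 : k' < 2 := by
        by_contra hk2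
        push Not at hk2
        have : (2 : ℝ) ≤ k' := by exact_mod_cast hk2
        nlinarith
      obtain rfl : k' = 1 := by omega
      have hi : i < 1 := by
        by_contra hi; push Not at hi
        have : (1 : ℝ) ≤ i := by exact_mod_cast hi
        push_cast at hge
        nlinarith
      have hj : j < 1 := by
        by_contra hi; push Not at hi
        have : (1 : ℝ) ≤ j := by exact_mod_cast hi
        push_cast at hge
        nlinarith
      obtain rfl : i = 0 := by omega
      obtain rfl : j = 0 := by omega
      exact ⟨φ, c, e⟩
  obtain ⟨o1, o2, -⟩ := c.om32 hJ2
  have e : A' = A + ev B C φ := by rw [hφ]; ring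
  have oc : θ.om A' C = 2 * δ + θ.om B C := by
    rw [e, om_add', o1]
    · ring
    · rw [o1]; linarith
  have ob : θ.om A' B = 8 / 3 * δ + θ.om B C := by
    rw [e, om_add', o2]
    · ring
    · rw [o2]; linarith
  have hA' := θ.om_le A' B
  have hT : Tri A' B C := (hg.tri.rot.of_sub_Alg hm).rot.rot
  have hG : θ.Good A' B C := ⟨hT, by apply ne_of_gt; linarith, by apply ne_of_gt; linarith, by apply ne_of_gt; linarith⟩
  intro hR
  rcases hR.inv_flag hT (by linarith) (by linarith) with h | ⟨V', ha, hd, -⟩ | ⟨As, Bs, Cs, Cs', δs, k, _, _, _, _, _, _, _, _, _, _, _, _, f1, f2⟩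
  · rw [hG.dg] at h; linarith
  · rcases ha.norm hG (by linarith) (by linarith) with ⟨s, t, h', q1, q2, q3, q4, q5, q6, q7, q8⟩ | ⟨s, h', q1, q2, q4, q5, q6, q7, q8⟩ | ⟨h', q4, q5, q6, q8⟩
    · have hx : θ.deg (h' - C) = θ.deg C := deg_sub_eq_of (by linarith)
      have ho := om_top1 (θ := θ) (x := A') (y := B) (z := C) s t (by linarith) (by linarith)
      rcases nc_cn q1.tri.Jc_ne q4 with h | ⟨φ', p, q, k', i, j, ε, c', e'⟩
      · obtain ⟨i, j, hij⟩ := h.2 (by intro h0; rw [h0, θ.deg_zero] at hx; linarith)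
        rw [q2, q3] at hij
        have i1 := ilt (n := 1) (by linarith) (by linarith) hij.le (by push_cast; linarith)
        have j1 := jlt (n := 1) (by linarith) (by linarith) hij.le (by push_cast; linarith)
        obtain rfl : i = 0 := by omega
        obtain rfl : j = 0 := by omega
        rw [hx] at hij; push_cast at hij; linarith
      · have := c'.om_g q1.tri.Jc_ne
        rw [e', ho] at this; linarith
    · have hx : θ.deg (h' - B) = θ.deg B := deg_sub_eq_of (by linarith)
      have ho := om_top2 (θ := θ) (x := A') (y := B) (z := C) s (by linarith)
      rcases nc_cn q1.tri.Jc_ne q4 with h | ⟨φ, p, q, k', i, j, ε, c, e⟩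
      · obtain ⟨i, j, hij⟩ := h.2 (by intro h0; rw [h0, θ.deg_zero] at hx; linarith)
        rw [q2] at hij
        have i1 := ilt (n := 1) (by linarith) (by linarith) hij.le (by push_cast; linarith)
        have j1 := jlt (n := 2) (by linarith) (by linarith) hij.le (by push_cast; linarith)
        obtain rfl : i = 0 := by omega
        rw [hx] at hij
        interval_cases j <;> push_cast at hij <;> linarith
      · have := c.om_g q1.tri.Jc_ne
        rw [e, ho] at this; linarith
    · have := hmin h' (by have := add_mem q4 hm; rwa [sub_add_sub_cancel] at this)
      linarith
  · linarith

end Wt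


noncomputable def Al1 (f : P3) : Subalgebra ℂ P3 := Algebra.adjoin ℂ {f}

lemma Al1_le_left {f g x : P3} (h : x ∈ Al1 f) : x ∈ Alg f g :=
  Algebra.adjoin_mono (by simp) h

lemma Al1_le_right {f g x : P3} (h : x ∈ Al1 f) : x ∈ Alg g f :=
  Algebra.adjoin_mono (by simp) h

lemma self_mem_Al1 (f : P3) : f ∈ Al1 f := Algebra.subset_adjoin rfl

lemma Tri.adj {a b c c' : P3} (h : Tri a b c) (hc : c' - c ∈ Alg a b) : Adj (Sp a b c) (Sp a b c') :=
  ⟨a, b, c, c', h, hc, rfl, rfl⟩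

/-- two members of the same class -/
lemma Tri.adj2 {a b c c' c'' : P3} (h : Tri a b c) (hc : c' - c ∈ Alg a b) (hc' : c'' - c ∈ Alg a b) : Adj (Sp a b c') (Sp a b c'') := by
  refine (h.of_sub_Alg hc).adj ?_
  have := sub_mem hc' hc
  rwa [sub_sub_sub_cancel_right] at this

namespace Wt
variable {θ : Wt}

lemma NC.al1 {f g x : P3} (h : θ.NC f g x) (hij : ∀ i j : ℕ, (i : ℝ) * θ.deg f + j * θ.deg g ≤ θ.deg x → j = 0) : x ∈ Al1 f := by
  have := h.1 (Subalgebra.toSubmodule (Al1 f)) (by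
    intro i j hh
    obtain rfl := hij i j hh
    simpa using pow_mem (self_mem_Al1 f) i)
  exact this

lemma NC.al1' {f g x : P3} (h : θ.NC f g x) (hij : ∀ i j : ℕ, (i : ℝ) * θ.deg f + j * θ.deg g ≤ θ.deg x → i = 0) : x ∈ Al1 g := by
  have := h.1 (Subalgebra.toSubmodule (Al1 g)) (by
    intro i j hh
    obtain rfl := hij i j hh
    simpa using pow_mem (self_mem_Al1 g) j)
  exact this

def IH (θ : Wt) (d : ℝ) : Prop := ∀ V V', Red θ V → Adj V V' → θ.dg V < d → θ.dg V' ≤ θ.dg V → Red θ V'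

lemma IH.N {d : ℝ} (h : θ.IH d) {V V' : Submodule ℂ P3} (hR : Red θ V) (ha : Adj V V') (hd : θ.dg V < d) : Red θ V' := by
  rcases le_or_gt (θ.dg V') (θ.dg V) with h1 | h1
  · exact h _ _ hR ha hd h1
  · exact Red.elem _ _ ha.symm h1 hR

def Lnk (θ : Wt) (d : ℝ) (X Y : Submodule ℂ P3) : Prop := (Red θ X → θ.dg X < d → Red θ Y) ∧ (Red θ Y → θ.dg Y < d → Red θ X)

lemma Lnk.symm {d : ℝ} {X Y : Submodule ℂ P3} (h : θ.Lnk d X Y) : θ.Lnk d Y X := ⟨h.2, h.1⟩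
lemma Lnk.refl (d : ℝ) (X : Submodule ℂ P3) : θ.Lnk d X X := ⟨fun h _ => h, fun h _ => h⟩

lemma Lnk.trans {d : ℝ} {X Y M : Submodule ℂ P3} (h : θ.Lnk d X M) (h' : θ.Lnk d M Y) (hM : θ.dg M < d) : θ.Lnk d X Y :=
  ⟨fun hX hd => h'.1 (h.1 hX hd) hM, fun hY hd => h.2 (h'.2 hY hd) hM⟩

lemma IH.lnk {d : ℝ} (h : θ.IH d) {X Y : Submodule ℂ P3} (ha : Adj X Y) : θ.Lnk d X Y :=
  ⟨fun hX hd => h.N hX ha hd, fun hY hd => h.N hY ha.symm hd⟩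

lemma IH.square {d : ℝ} (hI : θ.IH d) {f g h g' h' : P3} (ht : Tri f g h) (hh : h' - h ∈ Alg f g) (hg : g' - g ∈ Al1 f)
    (hd : θ.deg f + θ.deg g' + θ.deg h' < d) : θ.Lnk d (Sp f g h') (Sp f g' h) := by
  have t1 : Tri f g h' := ht.of_sub_Alg hh
  have t2 : Tri f h' g' := t1.swap23.of_sub_Alg (Al1_le_left hg)
  have a1 : Adj (Sp f g h') (Sp f g' h') := by
    rw [Sp_swap23 f g, Sp_swap23 f g']
    exact t1.swap23.adj (Al1_le_left hg)
  have t3 : Tri f g' h := (ht.swap23.of_sub_Alg (Al1_le_left hg)).swap23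
  have e : Alg f g' = Alg f g := by
    apply le_antisymm
    · refine Alg_le (left_mem_Alg _ _) ?_
      have := add_mem (Al1_le_left (g := g) hg) (right_mem_Alg f g)
      rwa [sub_add_cancel] at this
    · refine Alg_le (left_mem_Alg _ _) ?_
      have := sub_mem (right_mem_Alg f g') (Al1_le_left (g := g') hg)
      rwa [sub_sub_cancel] at this
  have a2 : Adj (Sp f g' h') (Sp f g' h) := (t3.adj (e ▸ hh)).symm
  exact (hI.lnk a1).trans (hI.lnk a2) (lt_of_le_of_lt (θ.Tri_dg_le t2.swap23) hd)

/-- the facts about the modified first element in Lemma Z -/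
lemma Zom {A B C : P3} {δ : ℝ} (ht : Tri A B C) (hA : θ.deg A = 3 * δ) (hB : θ.deg B = 2 * δ)
    (hC : 2 * θ.deg C = 3 * δ) (hω : 2 * θ.om A B ≤ δ) : 3 / 2 * δ < θ.om B C ∧ θ.om A C = θ.om B C + δ ∧ 4 ≤ δ := by
  have hJ := ht.Jc_ne
  have h3 := θ.two_le_om hJ
  have hw := θ.W0_le
  have hw2 := θ.W0_ge
  have hβ : 3 / 2 * δ < θ.om B C := by
    have := θ.cross ht.swap
    rw [θ.om_comm B A] at this; linarith
  exact ⟨hβ, omACeq ht hA hB (by linarith) (by linarith), by linarith⟩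

lemma Jc_quad (A B C : P3) (a1 γ b c κ b2 b3 b0 : ℂ) :
    Jc (a1 • A + γ • C ^ 2 + b • B + c • C + κ • (1 : P3)) (b2 • B + b3 • C + b0 • (1 : P3)) =
      (γ * b2 + γ * b2) • (C • Jc C B) + (a1 * b3) • Jc A C + (b2 * c - b3 * b) • Jc C B + (a1 * b2) • Jc A B := by
  simp only [Jc_add_left, Jc_add_right, Jc_smul_left, Jc_smul_right, Jc_self, Jc_one_left, Jc_one_right, pow_two, Jc_mul_left]
  rw [Jc_swap B C]
  module

lemma vdeg_lin4 {u v w z : Fin 3 → P3} {a b c d : ℂ} (ha : a ≠ 0) (h1 : θ.vdeg v < θ.vdeg u) (h2 : θ.vdeg w < θ.vdeg u)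
    (h3 : θ.vdeg z < θ.vdeg u) :
    θ.vdeg (a • u + b • v + c • w + d • z) = θ.vdeg u := by
  have := vdeg_lin_top (b := b) (c := c) ha h1 h2
  rw [θ.vdeg_add_eq, this]
  rw [this]
  exact lt_of_le_of_lt (θ.vdeg_smulC_le _ _) h3

lemma Canc.ge1 {f g : P3} {φ : P2} {p q k i j : ℕ} {ε : ℝ} (c : θ.Canc f g φ p q k i j ε) (hp : 2 ≤ p) (hq : 2 ≤ q) :
    ((q : ℝ) - 1) * θ.deg f - θ.deg g + θ.om f g ≤ θ.deg (ev f g φ) ∧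
    ((p : ℝ) - 1) * θ.deg g - θ.deg f + θ.om f g ≤ θ.deg (ev f g φ) := by
  have hge := c.ge
  have h1 : p + q ≤ p * q := by nlinarith
  have h2 : (p : ℝ) + q ≤ p * q := by exact_mod_cast h1
  have h3 : (1 : ℝ) ≤ k := by exact_mod_cast c.hk
  have h4 := c.hε
  have h5 : 0 ≤ θ.om f g := θ.vdeg_nonneg _
  have h6 : 0 ≤ ((p : ℝ) * q - p - q) * ε := mul_nonneg (by linarith) h4.le
  have h7 : 0 ≤ i * θ.deg f := mul_nonneg (Nat.cast_nonneg _) (θ.deg_nonneg _)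
  have h8 : 0 ≤ j * θ.deg g := mul_nonneg (Nat.cast_nonneg _) (θ.deg_nonneg _)
  have h9 : ((p : ℝ) * q - p - q) * ε + θ.om f g ≤ θ.deg (ev f g φ) := by nlinarith
  rw [c.hf, c.hg]
  constructor
  · have : ((q : ℝ) - 1) * (p * ε) - q * ε = (p * q - p - q) * ε := by ring
    linarith
  · have : ((p : ℝ) - 1) * (q * ε) - p * ε = (p * q - p - q) * ε := by ring
    linarith

/-- inner resonance, sharper version of cases when degrees are distinct -/
lemma Canc.cases' {f g : P3} {φ : P2} {p q k i j : ℕ} {ε : ℝ} (c : θ.Canc f g φ p q k i j ε) (hne : θ.deg f ≠ θ.deg g) :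
    (2 ≤ q ∧ θ.deg g = q * θ.deg f) ∨ (2 ≤ p ∧ θ.deg f = p * θ.deg g) ∨ (2 ≤ p ∧ 2 ≤ q) := by
  rcases c.cases with ⟨rfl, h⟩ | ⟨rfl, h⟩ | ⟨h1, h2, -⟩
  · left
    refine ⟨?_, h⟩
    by_contra hq
    have : q = 1 := by have := c.hq; omega
    subst this; push_cast at h; apply hne; linarith
  · right; left
    refine ⟨?_, h⟩
    by_contra hq
    have : p = 1 := by have := c.hp; omega
    subst this; push_cast at h; apply hne; linarith
  · exact Or.inr (Or.inr ⟨h1, h2⟩)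

lemma two_mul_le {q : ℕ} (hq : 2 ≤ q) {F : ℝ} (hF : 0 ≤ F) : 2 * F ≤ q * F := by
  have : (2 : ℝ) ≤ q := by exact_mod_cast hq
  nlinarith

set_option maxHeartbeats 1000000 in
lemma Z_elem {x y z a b c c' : P3} {δ : ℝ} (hδ : 0 < δ) (hx1 : δ < θ.deg x) (hx2 : θ.deg x < 3 * δ) (hy : θ.deg y = 2 * δ) (hz : 2 * θ.deg z = 3 * δ)
   (hg : θ.Good x y z) (hg' : θ.Good a b c) (e : Sp a b c = Sp x y z) (hm : c' - c ∈ Alg a b) (hlt : θ.deg c' < θ.deg c)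
   (ho : 5 / 2 * δ < θ.om a b) : False := by
  have hJ := hg'.tri.Jc_ne
  have ha := θ.Jc_pos_left hJ
  have hb := θ.Jc_pos_right hJ
  have hc := θ.Tri_deg_pos hg'.tri.rot.rot
  have da := hg.deg_mem (x := a) (e ▸ mem_Sp1 _ _ _)
  have db := hg.deg_mem (x := b) (e ▸ mem_Sp2 _ _ _)
  have dc := hg.deg_mem (x := c) (e ▸ mem_Sp3 _ _ _)
  replace da := da.resolve_left (by linarith)
  replace db := db.resolve_left (by linarith)
  replace dc := dc.resolve_left (by linarith)
  obtain ⟨-, n1, n2, n3⟩ := hg'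
  have hx := deg_sub_eq_of hlt
  have ha' : δ < θ.deg a := by rcases da with h | h | h <;> linarith
  have hb' : δ < θ.deg b := by rcases db with h | h | h <;> linarith
  have hc' : θ.deg c < 3 * δ := by rcases dc with h | h | h <;> linarith
  have hab : ¬ 2 * θ.deg a ≤ θ.deg b := by
    rcases da with h | h | h <;> rcases db with h' | h' | h' <;> linarith
  have hba : ¬ 2 * θ.deg b ≤ θ.deg a := by
    rcases da with h | h | h <;> rcases db with h' | h' | h' <;> linarith
  rcases nc_cn hJ hm with h | ⟨φ, p, q, k', i, j, ε, cc, e⟩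
  · obtain ⟨i, j, hij⟩ := h.2 (by intro h0; rw [h0, θ.deg_zero] at hx; linarith)
    have i1 := ilt (n := 3) (by linarith) (by linarith) hij.le (by push_cast; linarith)
    have j1 := jlt (n := 3) (by linarith) (by linarith) hij.le (by push_cast; linarith)
    rw [hx] at hij
    rcases da with h | h | h <;> rcases db with h' | h' | h' <;> rcases dc with h'' | h'' | h'' <;>
      first
      | (exfalso; apply n1; rw [h, h']; done)
      | (exfalso; apply n2; rw [h, h'']; done)
      | (exfalso; apply n3; rw [h', h'']; done)
      | (interval_cases i <;> interval_cases j <;> push_cast at hij <;> first | linarith | exact n2 (by linarith) | exact n3 (by linarith))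
  · rcases cc.cases' n1 with ⟨hq, h⟩ | ⟨hq, h⟩ | ⟨h1, h2⟩
    · have := two_mul_le hq (θ.deg_nonneg a)
      exact hab (by linarith)
    · have := two_mul_le hq (θ.deg_nonneg b)
      exact hba (by linarith)
    · obtain ⟨g1, g2⟩ := cc.ge1 h1 h2
      rw [e, hx] at g1 g2
      have g3 : θ.deg a - θ.deg b + θ.om a b ≤ θ.deg c := by
        have : (2 : ℝ) ≤ q := by exact_mod_cast h2
        nlinarith
      have g4 : θ.deg b - θ.deg a + θ.om a b ≤ θ.deg c := by
        have : (2 : ℝ) ≤ p := by exact_mod_cast h1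
        nlinarith
      rcases da with h | h | h <;> rcases db with h' | h' | h' <;> rcases dc with h'' | h'' | h'' <;>
      first
      | (exfalso; apply n1; rw [h, h']; done)
      | (exfalso; apply n2; rw [h, h'']; done)
      | (exfalso; apply n3; rw [h', h'']; done)
      | linarith


lemma four_three {p q : ℕ} {ε δ : ℝ} (hε : 0 < ε) (h1 : 2 * δ = p * ε) (h2 : 3 / 2 * δ = q * ε) (hp : 2 ≤ p) : 4 ≤ p := by
  have : ε * (3 * p : ℝ) = ε * (4 * q) := by nlinarith
  have h3 : (3 * p : ℝ) = 4 * q := mul_left_cancel₀ hε.ne' this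
  have h4 : 3 * p = 4 * q := by exact_mod_cast h3
  omega

lemma Z_elem2 {x y z x' : P3} {δ : ℝ} (hδ : 0 < δ) (hx2 : θ.deg x < 3 * δ) (hy : θ.deg y = 2 * δ) (hz : 2 * θ.deg z = 3 * δ)
   (hg : θ.Good x y z) (hm : x' - x ∈ Alg y z) (hlt : θ.deg x' < θ.deg x)
   (ho : 3 / 2 * δ < θ.om y z) : x' - x ∈ Pl y z := by
  have hJ := hg.tri.rot.Jc_ne
  have hx := deg_sub_eq_of hlt
  rcases nc_cn hJ hm with h | ⟨φ, p, q, k', i, j, ε, cc, e⟩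
  · apply h.lin
    intro i j hij
    have i1 := ilt (n := 2) (by linarith) (by linarith) hij (by push_cast; linarith)
    have j1 := jlt (n := 2) (by linarith) (by linarith) hij (by push_cast; linarith)
    interval_cases i <;> interval_cases j <;> push_cast at hij <;> first | omega | linarith
  · exfalso
    rcases cc.cases' hg.2.2.2 with ⟨hq, h⟩ | ⟨hq, h⟩ | ⟨h1, h2⟩
    · have := two_mul_le hq (θ.deg_nonneg y); linarith
    · have := two_mul_le hq (θ.deg_nonneg z); linarith
    · have h4 := four_three cc.hε (δ := δ) (by rw [← cc.hf]; linarith) (by rw [← cc.hg]; linarith) h1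
      obtain ⟨-, g2⟩ := cc.ge1 h1 h2
      rw [e, hx] at g2
      have : (4 : ℝ) ≤ p := by exact_mod_cast h4
      nlinarith

lemma sub_mem_trans {M : Submodule ℂ P3} {x y z : P3} (h1 : x - y ∈ M) (h2 : y - z ∈ M) : x - z ∈ M := by
  have := add_mem h1 h2; rwa [sub_add_sub_cancel] at this

set_option maxHeartbeats 1000000 in
lemma Z_K {A B C As Bs Cs Cs' : P3} {δ : ℝ} {a1 γ b c κ b2 b3 b0 g κ' : ℂ} (ht : Tri A B C) (hts : Tri As Bs Cs)
    (h1 : θ.om A C = θ.om B C + δ) (h2 : 3 / 2 * δ < θ.om B C) (h3 : 2 * θ.deg C = 3 * δ) (hδ : 0 < δ) (hω : 2 * θ.om A B ≤ δ)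
    (hωs : 2 * θ.om As Bs ≤ δ) (ha1 : a1 ≠ 0) (hb2 : b2 ≠ 0) (hgg : g ≠ 0)
    (hAs : As = a1 • A + γ • C ^ 2 + b • B + c • C + κ • (1 : P3)) (hBs : Bs = b2 • B + b3 • C + b0 • (1 : P3))
    (hCs : Cs = g • C + κ' • (1 : P3)) (hm : Cs' - Cs ∈ Alg As Bs) (hlt : θ.deg Cs' < θ.deg Cs) (hd : θ.deg Cs = θ.deg C) (hR : Red θ (Sp As Bs Cs')) :
    ∃ C'', C'' - C ∈ Alg A B ∧ θ.deg C'' < θ.deg C ∧ Red θ (Sp A B C'') := by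
  have hJ := Jc_quad A B C a1 γ b c κ b2 b3 b0
  rw [← hAs, ← hBs] at hJ
  have hJ' : θ.om As Bs = θ.vdeg (Jc As Bs) := rfl
  have v1 : θ.vdeg (C • Jc C B) = θ.deg C + θ.om B C := by
    rw [θ.vdeg_smul (θ.ne_zero_of_deg_pos (θ.Tri_deg_pos ht.rot.rot)) (ht.rot.swap.Jc_ne), θ.om_comm B C]; rfl
  have v2 : θ.vdeg (Jc A C) = θ.om B C + δ := h1
  have v3 : θ.vdeg (Jc C B) = θ.om B C := by rw [θ.om_comm B C]; rfl
  have v4 : θ.vdeg (Jc A B) = θ.om A B := rfl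
  have hγ : γ = 0 := by
    by_contra hγ
    have : γ * b2 + γ * b2 ≠ 0 := by
      rw [← two_mul]; exact mul_ne_zero two_ne_zero (mul_ne_zero hγ hb2)
    have := vdeg_lin4 (θ := θ) (b := a1 * b3) (c := b2 * c - b3 * b) (d := a1 * b2) this (u := C • Jc C B) (v := Jc A C) (w := Jc C B) (z := Jc A B) (by rw [v1, v2]; linarith)
      (by rw [v1, v3]; linarith) (by rw [v1, v4]; linarith)
    rw [← hJ, v1, ← hJ'] at this
    linarith
  subst hγ
  rw [zero_mul, zero_add, zero_smul, zero_add] at hJ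
  have hb3 : b3 = 0 := by
    by_contra hb3
    have := vdeg_lin_top (θ := θ) (b := b2 * c - b3 * b) (c := a1 * b2) (mul_ne_zero ha1 hb3) (u := Jc A C) (v := Jc C B) (w := Jc A B) (by rw [v2, v3]; linarith)
      (by rw [v2, v4]; linarith)
    rw [← hJ, v2, ← hJ'] at this
    linarith
  subst hb3
  rw [mul_zero, zero_smul, zero_add, zero_mul, sub_zero] at hJ
  have hc : c = 0 := by
    by_contra hc
    have := vdeg_lin_top (θ := θ) (b := a1 * b2) (c := 0) (mul_ne_zero hb2 hc) (u := Jc C B) (v := Jc A B) (w := Jc A B) (by rw [v3, v4]; linarith)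
      (by rw [v3, v4]; linarith)
    rw [zero_smul, add_zero, ← hJ, v3, ← hJ'] at this
    linarith
  subst hc
  have hP : Pl As Bs = Pl A B := by
    apply hts.Pl_eq_of_mem
    · exact mem_Pl.2 ⟨a1, b, κ, by rw [hAs]; module⟩
    · exact mem_Pl.2 ⟨0, b2, b0, by rw [hBs]; module⟩
  have e : g⁻¹ • (Cs' - κ' • (1 : P3)) - C = g⁻¹ • (Cs' - Cs) := by
    rw [hCs]
    have : C = g⁻¹ • (g • C) := by rw [smul_smul, inv_mul_cancel₀ hgg, one_smul]
    nth_rewrite 1 [this]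
    module
  refine ⟨g⁻¹ • (Cs' - κ' • (1 : P3)), ?_, ?_, ?_⟩
  · rw [e, ← Alg_congr hP]
    exact Subalgebra.smul_mem _ hm _
  · refine lt_of_le_of_lt (θ.deg_smul_le _ _) (lt_of_le_of_lt (θ.deg_sub_le _ _) ?_)
    rw [deg_const]
    exact max_lt (hd ▸ hlt) (θ.Tri_deg_pos ht.rot.rot)
  · have : Sp A B (g⁻¹ • (Cs' - κ' • (1 : P3))) = Sp As Bs Cs' := by
      rw [← Sp_congr_Pl hP]
      exact Sp_third (inv_ne_zero hgg) (x := -(g⁻¹ * κ') • (1 : P3)) (mem_Pl.2 ⟨0, 0, -(g⁻¹ * κ'), by module⟩) (by module)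
    rw [this]; exact hR

set_option maxHeartbeats 1000000 in
lemma Z1 {A B C A' : P3} {δ : ℝ} (hg : θ.Good A B C) (hA : θ.deg A = 3 * δ) (hB : θ.deg B = 2 * δ)
    (hC : 2 * θ.deg C = 3 * δ) (hω : 2 * θ.om A B ≤ δ) (hm : A' - A ∈ Sp B C (C ^ 2)) (hlt : θ.deg A' < 3 * δ)
    (hmin : ∀ y, y - A ∈ Sp B C (C ^ 2) → θ.deg A' ≤ θ.deg y) (hR : Red θ (Sp A' B C)) :
    ∃ C'', C'' - C ∈ Alg A B ∧ θ.deg C'' < θ.deg C ∧ Red θ (Sp A B C'') := by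
  obtain ⟨hβ, hac, hδ⟩ := Zom hg.tri hA hB hC hω
  have hJBC := hg.tri.rot.Jc_ne
  obtain ⟨b, c, a, κ, e⟩ := mem_Sp.1 hm
  have eA : A' = A + (b • B + c • C + a • C ^ 2 + κ • (1 : P3)) := by rw [← e]; ring
  have hmA : A' - A ∈ Alg B C := by
    rw [e]
    refine add_mem (add_mem (add_mem ?_ ?_) ?_) ?_
    · exact Subalgebra.smul_mem _ (left_mem_Alg _ _) _
    · exact Subalgebra.smul_mem _ (right_mem_Alg _ _) _
    · exact Subalgebra.smul_mem _ (pow_mem (right_mem_Alg _ _) _) _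
    · exact Subalgebra.smul_mem _ (one_mem _) _
  have hT : Tri A' B C := (hg.tri.rot.of_sub_Alg hmA).rot.rot
  have ha : a ≠ 0 := by
    rintro rfl
    have := hg.lin_le 1 b c κ one_ne_zero
    rw [show (1 : ℂ) • A + b • B + c • C + κ • (1 : P3) = A' by rw [eA]; module] at this
    linarith
  have oB : θ.om A' B = θ.deg C + θ.om B C := by
    have := Jc_quad A B C 1 a b c κ 1 0 0
    rw [show (1 : ℂ) • A + a • C ^ 2 + b • B + c • C + κ • (1 : P3) = A' by rw [eA]; module,
      show (1 : ℂ) • B + (0 : ℂ) • C + (0 : ℂ) • (1 : P3) = B by module] at this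
    have v1 : θ.vdeg (C • Jc C B) = θ.deg C + θ.om B C := by
      rw [θ.vdeg_smul (θ.ne_zero_of_deg_pos (θ.Tri_deg_pos hg.tri.rot.rot)) (hg.tri.rot.swap.Jc_ne), θ.om_comm B C]; rfl
    have v2 : θ.vdeg (Jc A C) = θ.om B C + δ := hac
    have v3 : θ.vdeg (Jc C B) = θ.om B C := by rw [θ.om_comm B C]; rfl
    have v4 : θ.vdeg (Jc A B) = θ.om A B := rfl
    unfold om at *
    rw [this, vdeg_lin4, v1]
    · rw [← two_mul]; exact mul_ne_zero two_ne_zero (mul_ne_zero ha one_ne_zero)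
    · rw [v1, v2]; linarith
    · rw [v1, v3]; linarith
    · rw [v1, v4]; linarith
  have oC : θ.om A' C = θ.om B C + δ := by
    have := Jc_quad A B C 1 a b c κ 0 1 0
    rw [show (1 : ℂ) • A + a • C ^ 2 + b • B + c • C + κ • (1 : P3) = A' by rw [eA]; module,
      show (0 : ℂ) • B + (1 : ℂ) • C + (0 : ℂ) • (1 : P3) = C by module] at this
    have v2 : θ.vdeg (Jc A C) = θ.om B C + δ := hac
    have v3 : θ.vdeg (Jc C B) = θ.om B C := by rw [θ.om_comm B C]; rfl
    rw [show (a * 0 + a * 0) • C • Jc C B + ((1 : ℂ) * 1) • Jc A C + (0 * c - 1 * b) • Jc C B + ((1 : ℂ) * 0) • Jc A B =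
      (1 : ℂ) • Jc A C + (- b) • Jc C B + (0 : ℂ) • Jc C B by module] at this
    unfold om at *
    rw [this, vdeg_lin_top one_ne_zero, v2]
    · rw [v2, v3]; linarith
    · rw [v2, v3]; linarith
  have l1 := θ.om_le A' B
  rw [oB, hB] at l1
  have nomin : ∀ x ∈ Pl B C, θ.deg x ≠ θ.deg A' := by
    intro x hx heq
    obtain ⟨t, -, ht⟩ := θ.exists_cancel heq.symm (by linarith)
    have := hmin (A' - t • x) (by
      obtain ⟨x1, x2, x3, hx'⟩ := mem_Pl.1 hx
      refine mem_Sp.2 ⟨b - t * x1, c - t * x2, a, κ - t * x3, ?_⟩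
      rw [hx', eA]; module)
    linarith
  have hG : θ.Good A' B C := ⟨hT, (nomin B (left_mem_Pl _ _)).symm, (nomin C (right_mem_Pl _ _)).symm, hg.2.2.2⟩
  rcases hR.inv_flag hT (by linarith) (by linarith) with h | ⟨V', ha, hd, -⟩ | ⟨As, Bs, Cs, Cs', δs, k, w1, w2, w3, w4, w5, w6, w7, w8, w9, w10, ⟨g, κ', hgg, hCs⟩, w11, w12, w13⟩
  · rw [hG.dg] at h; linarith
  · exfalso
    obtain ⟨a, b, c, c', q1, q2, q3, q4, rfl⟩ := ha.good (θ := θ)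
    rw [q4, q1.dg, q2.dg] at hd
    rcases lemG hT q4.symm (by linarith) (by linarith) with hP | ho
    · obtain ⟨h', r1, r2, r3⟩ := θ.rebase_good q1.tri q3 hP.symm ((Sp_rot A' B C).symm.trans q4) hg.2.2.2
      have : θ.deg h' < θ.deg A' := by
        have e1 := r3.dg
        have e2 := q2.dg
        have e3 := q1.dg
        rw [r2] at e1
        rw [← q4, hG.dg] at e3
        linarith
      have hp := Z_elem2 (by linarith) hlt hB hC hG r1 this hβ
      have := hmin h' (sub_mem_trans (Pl_le_Sp _ _ _ hp) hm)
      linarith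
    · exact Z_elem (by linarith) (by linarith) hlt hB hC hG q1 q4.symm q3 (by linarith) (by linarith)
  · obtain rfl : δs = δ := by linarith
    have hmx : As + k • Cs ^ 2 ∈ Sp A' B C := w9 ▸ mem_Sp1 _ _ _
    obtain ⟨α, y1, y2, y3, hy⟩ := mem_Sp.1 hmx
    have hBs : Bs ∈ Pl B C := w10 ▸ left_mem_Pl _ _
    obtain ⟨b2, b3, b0, hBs⟩ := mem_Pl.1 hBs
    have hα : α ≠ 0 := by
      rintro rfl
      have hn := (hT.of_Sp w9).rot.not_mem
      apply hn
      rw [w10]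
      exact mem_Pl.2 ⟨y1, y2, y3, by rw [hy]; module⟩
    have hb2 : b2 ≠ 0 := by
      rintro rfl
      have h1 : θ.deg Bs ≤ θ.deg C := by
        rw [hBs, zero_smul, zero_add]
        refine (θ.deg_add_le _ _).trans (max_le (θ.deg_smul_le _ _) ?_)
        rw [deg_const]; exact θ.deg_nonneg _
      linarith
    refine Z_K (A := A) (B := B) (C := C) (As := As) (a1 := α) (γ := α * a - k * g ^ 2) (b := α * b + y1) (c := α * c + y2 - 2 * k * g * κ') (κ := α * κ + y3 - k * κ' ^ 2) hg.tri w1.tri hac hβ hC (by linarith) hω (by linarith) hα hb2 hgg ?_ hBs hCs w5 w6 w11 w7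
    have : As = α • A' + y1 • B + y2 • C + y3 • (1 : P3) - k • Cs ^ 2 := by rw [← hy]; ring
    rw [this, eA, hCs]
    simp only [Algebra.smul_def, map_add, map_sub, map_mul, map_pow, map_ofNat]
    ring

lemma IH.Z {d : ℝ} (hI : θ.IH d) {A B C A' : P3} {δ : ℝ} (hg : θ.Good A B C) (hA : θ.deg A = 3 * δ) (hB : θ.deg B = 2 * δ)
    (hC : 2 * θ.deg C = 3 * δ) (hω : 2 * θ.om A B ≤ δ) (hm : A' - A ∈ Sp B C (C ^ 2)) (hlt : θ.deg A' < 3 * δ)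
    (hR : Red θ (Sp A' B C)) (hd : θ.dg (Sp A' B C) < d) :
    ∃ C'', C'' - C ∈ Alg A B ∧ θ.deg C'' < θ.deg C ∧ Red θ (Sp A B C'') := by
  obtain ⟨A'', h1, h2⟩ := θ.exists_min {y | y - A ∈ Sp B C (C ^ 2)} ⟨A', hm⟩
  have hS : ∀ y, y - A ∈ Sp B C (C ^ 2) → y - A ∈ Alg B C := by
    intro y hy
    have : Sp B C (C ^ 2) ≤ Subalgebra.toSubmodule (Alg B C) :=
      Sp_le (show (1 : P3) ∈ Alg B C from one_mem _) (left_mem_Alg _ _) (right_mem_Alg _ _) (pow_mem (right_mem_Alg _ _) _)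
    exact this hy
  have had : Adj (Sp A' B C) (Sp A'' B C) := by
    rw [Sp_rot A' B C, Sp_rot A'' B C]
    exact hg.tri.rot.adj2 (hS _ hm) (hS _ h1)
  exact Z1 hg hA hB hC hω h1 (lt_of_le_of_lt (h2 _ hm) hlt) h2 (hI.N hR had hd)


set_option maxHeartbeats 1000000 in
lemma IH.XZ {d : ℝ} (hI : θ.IH d) {A B C P : P3} {δ : ℝ} {a : ℂ} (hg : θ.Good A B C) (hA : θ.deg A = 3 * δ) (hB : θ.deg B = 2 * δ)
    (hC : 2 * θ.deg C ≤ 3 * δ) (hP : P ∈ Alg A B) (hP1 : ¬ ∃ κ : ℂ, P = κ • (1 : P3)) (hPd : θ.deg P ≤ θ.deg C) (ha : a ≠ 0)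
    (hd : θ.deg A + θ.deg B + θ.deg C = d) : θ.Lnk d (Sp A B (C + P)) (Sp (A + a • C ^ 2) B C) := by
  have hC0 := θ.Tri_deg_pos hg.tri.rot.rot
  have hPm : (C + P) - C ∈ Alg A B := by rwa [add_sub_cancel_left]
  constructor
  · intro hR hlt
    obtain ⟨C1, r1, r2, r3, -⟩ := θ.exists_good_third (hg.tri.of_sub_Alg hPm) hg.2.1
    have h1 : θ.deg C1 < θ.deg C := by
      rw [← r3, r2.dg] at hlt; linarith
    have hm1 : C1 - C ∈ Alg A B := by
      have := add_mem (Pl_le_Alg r1) hPm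
      rwa [sub_add_sub_cancel] at this
    obtain ⟨C', m1, m2⟩ := θ.exists_min {y | y - C ∈ Alg A B} ⟨C1, hm1⟩
    have h2 : θ.deg C' < θ.deg C := lt_of_le_of_lt (m2 _ hm1) h1
    have hR' : Red θ (Sp A B C') := hI.N hR (hg.tri.adj2 hPm m1) hlt
    rcases le_or_gt (3 * δ + θ.om A B) (θ.om B C) with hb | hb
    · exact Red.kred _ A B C C' δ a hg hA hB hC m1 h2 hb ha rfl hR'
    · exact absurd hR' (Irr hg hA hB hC m1 h2 m2 hb)
  · intro hR hlt
    have hsq : a • C ^ 2 ∈ Alg B C := Subalgebra.smul_mem _ (pow_mem (right_mem_Alg _ _) _) _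
    have hT : Tri B C (A + a • C ^ 2) := hg.tri.rot.of_sub_Alg (by rwa [add_sub_cancel_left])
    obtain ⟨A3, r1, r2, r3, -⟩ := θ.exists_good_third hT hg.2.2.2
    have eS : Sp A3 B C = Sp (A + a • C ^ 2) B C := by rw [Sp_rot A3, r3, ← Sp_rot]
    have h1 : θ.deg A3 < θ.deg A := by
      rw [← eS, Sp_rot, r2.dg] at hlt; linarith
    obtain ⟨b, c, κ, e⟩ := mem_Pl.1 r1
    have e1 : A3 - A = b • B + c • C + a • C ^ 2 + κ • (1 : P3) := by
      have : A3 - A = (A3 - (A + a • C ^ 2)) + a • C ^ 2 := by ring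
      rw [this, e]; module
    have hC2 : 2 * θ.deg C = 3 * δ := by
      by_contra hne
      have hlt2 : 2 * θ.deg C < 3 * δ := lt_of_le_of_ne hC hne
      have : θ.deg (A3 - A) < θ.deg A := by
        rw [e1]
        refine lt_of_le_of_lt (θ.deg_add_le _ _) (max_lt (lt_of_le_of_lt (θ.deg_add_le _ _) (max_lt (lt_of_le_of_lt (θ.deg_add_le _ _) (max_lt ?_ ?_)) ?_)) ?_)
        · exact lt_of_le_of_lt (θ.deg_smul_le _ _) (by linarith)
        · exact lt_of_le_of_lt (θ.deg_smul_le _ _) (by linarith)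
        · refine lt_of_le_of_lt (θ.deg_smul_le _ _) ?_
          rw [θ.deg_pow]; push_cast; linarith
        · rw [deg_const]; linarith
      rw [deg_sub_eq_of h1] at this
      exact lt_irrefl _ this
    have hω : 2 * θ.om A B ≤ δ := by
      rcases c32 hg.tri.Jc_ne hA hB hP (by linarith) with h | ⟨φ, cc, rfl⟩
      · exact absurd h hP1
      · obtain ⟨-, -, h⟩ := cc.om32 hg.tri.Jc_ne
        linarith
    obtain ⟨C'', s1, s2, s3⟩ := hI.Z (A' := A3) hg hA hB hC2 hω (mem_Sp.2 ⟨b, c, a, κ, e1⟩) (by linarith) (eS ▸ hR) (eS ▸ hlt)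
    refine hI.N s3 (hg.tri.adj2 s1 hPm) ?_
    have := θ.Tri_dg_le (hg.tri.of_sub_Alg s1)
    linarith

end Wt


lemma Sp_rot2 (a b c : P3) : Sp a b c = Sp c a b := by rw [Sp_rot, Sp_rot]
lemma Sp_13 (a b c : P3) : Sp a b c = Sp c b a := by rw [Sp_rot, Sp_swap]

namespace Wt
variable {θ : Wt}

lemma IH.minC {d : ℝ} (hI : θ.IH d) {a b c c1 : P3} (hg : θ.Good a b c) (hm : c1 - c ∈ Alg a b) (hR : Red θ (Sp a b c1))
    (hlt : θ.dg (Sp a b c1) < d) (hd : θ.deg a + θ.deg b + θ.deg c = d) :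
    ∃ c', c' - c ∈ Alg a b ∧ θ.deg c' < θ.deg c ∧ (∀ y, y - c ∈ Alg a b → θ.deg c' ≤ θ.deg y) ∧ Red θ (Sp a b c') := by
  obtain ⟨C1, r1, r2, r3, -⟩ := θ.exists_good_third (hg.tri.of_sub_Alg hm) hg.2.1
  have h1 : θ.deg C1 < θ.deg c := by
    have := hlt
    rw [← r3, r2.dg] at this; linarith
  have hm1 : C1 - c ∈ Alg a b := by
    have := add_mem (Pl_le_Alg r1) hm
    rwa [sub_add_sub_cancel] at this
  obtain ⟨C', m1, m2⟩ := θ.exists_min {y | y - c ∈ Alg a b} ⟨C1, hm1⟩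
  have h2 : θ.deg C' < θ.deg c := lt_of_le_of_lt (m2 _ hm1) h1
  exact ⟨C', m1, h2, m2, hI.N hR (hg.tri.adj2 hm m1) hlt⟩

lemma add_le_of {x p : P3} (h : θ.deg p ≤ θ.deg x) : θ.deg (x + p) ≤ θ.deg x := (θ.deg_add_le _ _).trans (max_le le_rfl h)

lemma Lnk.of_not {d : ℝ} {X Y : Submodule ℂ P3} (h1 : ¬ θ.dg X < d) (h2 : ¬ θ.dg Y < d) : θ.Lnk d X Y :=
  ⟨fun _ h => absurd h h1, fun _ h => absurd h h2⟩

lemma IH.sq {d : ℝ} (hI : θ.IH d) {f g h P Q : P3} (hg : θ.Good f g h) (hP : P ∈ Alg f g) (hQ : Q ∈ Al1 f)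
    (hPd : θ.deg P ≤ θ.deg h) (hQd : θ.deg Q ≤ θ.deg g)
    (hd : θ.deg f + θ.deg g + θ.deg h = d) : θ.Lnk d (Sp f g (h + P)) (Sp f (g + Q) h) := by
  have hPm : (h + P) - h ∈ Alg f g := by rwa [add_sub_cancel_left]
  have hQm : (g + Q) - g ∈ Al1 f := by rwa [add_sub_cancel_left]
  have l1 := add_le_of hPd
  have l2 := add_le_of hQd
  by_cases e : θ.deg (h + P) = θ.deg h ∧ θ.deg (g + Q) = θ.deg g
  · obtain ⟨e1, e2⟩ := e
    have g1 : θ.Good f g (h + P) := ⟨hg.tri.of_sub_Alg hPm, hg.2.1, by rw [e1]; exact hg.2.2.1, by rw [e1]; exact hg.2.2.2⟩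
    have g2 : θ.Good f h (g + Q) := ⟨hg.tri.swap23.of_sub_Alg (Al1_le_left hQm), hg.2.2.1, by rw [e2]; exact hg.2.1, by rw [e2]; exact hg.2.2.2.symm⟩
    apply Lnk.of_not
    · rw [g1.dg, e1]; linarith
    · rw [Sp_swap23, g2.dg, e2]; linarith
  · refine hI.square hg.tri hPm hQm ?_
    by_contra hcon
    exact e ⟨by linarith, by linarith⟩

lemma IH.lin {d : ℝ} (hI : θ.IH d) {f g h P Q : P3} (hg : θ.Good f g h) (hP : P ∈ Alg f g) (hQ : Q ∈ Pl f h) :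
    θ.Lnk d (Sp f g (h + P)) (Sp f (g + Q) h) := by
  have : Sp f (g + Q) h = Sp f g h := by
    rw [Sp_swap23 f _ h, Sp_swap23 f g h]
    exact Sp_third one_ne_zero hQ (by module)
  rw [this]
  exact hI.lnk (hg.tri.adj (by rwa [add_sub_cancel_left])).symm

/-- reduce f by a power of g -/
lemma exists_pow {f g : P3} {k : ℕ} (h : θ.deg f = k * θ.deg g) (hpos : 0 < θ.deg f) :
    ∃ f', f' - f ∈ Al1 g ∧ θ.deg f' < θ.deg f ∧ ∃ c : ℂ, c ≠ 0 ∧ f' = f - c • g ^ k := by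
  obtain ⟨c, hc, hlt⟩ := θ.exists_cancel (f := f) (g := g ^ k) (by rw [θ.deg_pow, h]) hpos
  refine ⟨f - c • g ^ k, ?_, hlt, c, hc, rfl⟩
  rw [sub_sub_cancel_left]
  exact neg_mem (Subalgebra.smul_mem _ (pow_mem (self_mem_Al1 g) k) _)

lemma Alg_sub_comm {f g x : P3} (h : x ∈ Alg f g) : x ∈ Alg g f := Alg_comm f g ▸ h

/-- (ii) f2 = k f1 -/
lemma S_ii {d : ℝ} (hI : θ.IH d) {f g h P Q : P3} (hg : θ.Good f g h) (hP : P ∈ Alg f g) (hQ : Q ∈ Alg f h)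
    (hPd : θ.deg P ≤ θ.deg h) (hd : θ.deg f + θ.deg g + θ.deg h = d) {k : ℕ} (hk : θ.deg g = k * θ.deg f) :
    θ.Lnk d (Sp f g (h + P)) (Sp f (g + Q) h) := by
  obtain ⟨g', m, l, -⟩ := exists_pow hk (θ.Tri_deg_pos hg.tri.rot)
  have hPm : (h + P) - h ∈ Alg f g := by rwa [add_sub_cancel_left]
  have l1 := add_le_of hPd
  have t : Tri f h g' := hg.tri.swap23.of_sub_Alg (Al1_le_left m)
  refine (hI.square (g' := g') hg.tri hPm m (by linarith)).trans (hI.lnk ?_) ?_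
  · rw [Sp_swap23 f g' h, Sp_swap23 f _ h]
    exact hg.tri.swap23.adj2 (Al1_le_left m) (by rwa [add_sub_cancel_left])
  · refine lt_of_le_of_lt (θ.Tri_dg_le t.swap23) (by linarith)

set_option maxHeartbeats 1000000 in
/-- (i) f1 = k f2 -/
lemma S_i {d : ℝ} (hI : θ.IH d) {f g h P Q : P3} (hg : θ.Good f g h) (hP : P ∈ Alg f g) (hQ : Q ∈ Alg f h)
    (hPd : θ.deg P ≤ θ.deg h) (hQd : θ.deg Q ≤ θ.deg g) (hhg : θ.deg h < θ.deg g)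
    (hd : θ.deg f + θ.deg g + θ.deg h = d) {k : ℕ} (hk : θ.deg f = k * θ.deg g) (hk2 : 2 ≤ k) :
    θ.Lnk d (Sp f g (h + P)) (Sp f (g + Q) h) := by
  obtain ⟨f', m, l, -⟩ := exists_pow hk (θ.Tri_deg_pos hg.tri)
  have hg0 := θ.Tri_deg_pos hg.tri.rot
  have hh0 := θ.Tri_deg_pos hg.tri.rot.rot
  have hfg : 2 * θ.deg g ≤ θ.deg f := by rw [hk]; exact two_mul_le hk2 hg0.le
  have hPm : (h + P) - h ∈ Alg g f := Alg_sub_comm (by rwa [add_sub_cancel_left])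
  have hQm : (g + Q) - g ∈ Alg h f := Alg_sub_comm (by rwa [add_sub_cancel_left])
  have l1 := add_le_of hPd
  have l2 := add_le_of hQd
  have t : Tri g h f' := hg.tri.rot.of_sub_Alg (Al1_le_left m)
  have dM : θ.dg (Sp g f' h) < d := lt_of_le_of_lt (θ.Tri_dg_le t.swap23) (by linarith)
  have L1 : θ.Lnk d (Sp f g (h + P)) (Sp g f' h) := by
    have := hI.square (g' := f') hg.tri.swap hPm m (by linarith)
    rwa [Sp_swap] at this
  refine L1.trans ?_ dM
  rcases nc_cn hg.tri.swap23.Jc_ne hQ with hn | ⟨φ, p, q, k', i, j, ε, cc, e⟩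
  · have hQ1 : Q ∈ Al1 h := by
      apply hn.al1'
      intro i j hij
      have := ilt (n := 1) (by linarith) (by linarith) hij (by push_cast; linarith)
      omega
    have := hI.square (f := h) (g := g) (h := f) (g' := g + Q) (h' := f') hg.tri.swap13 (Al1_le_right m) (by rwa [add_sub_cancel_left]) (by linarith)
    rwa [Sp_rot h g f', Sp_13 h _ f] at this
  · rcases cc.cases' hg.2.2.1 with ⟨hq, h'⟩ | ⟨hq, h'⟩ | ⟨h1, h2⟩
    · have := two_mul_le hq (θ.deg_nonneg f); linarith
    · obtain ⟨f'', m', l', -⟩ := exists_pow h' (θ.Tri_deg_pos hg.tri)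
      have t' : Tri g h f'' := hg.tri.rot.of_sub_Alg (Al1_le_right m')
      have dM' : θ.dg (Sp h f'' g) < d := lt_of_le_of_lt (θ.Tri_dg_le t'.swap.swap23) (by linarith)
      refine Lnk.trans (M := Sp h f'' g) ?_ ?_ dM'
      · apply hI.lnk
        rw [Sp_swap23 g f' h, Sp_rot2 h f'' g]
        exact hg.tri.rot.adj2 (Al1_le_left m) (Al1_le_right m')
      · have := hI.square (f := h) (g := f) (h := g) (g' := f'') (h' := g + Q) hg.tri.rot.rot hQm m' (by linarith)
        rw [Sp_rot] at this
        exact this.symm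
    · exfalso
      obtain ⟨g1, -⟩ := cc.ge1 h1 h2
      rw [e] at g1
      have o : 0 ≤ θ.om f h := θ.vdeg_nonneg _
      have : (2 : ℝ) ≤ q := by exact_mod_cast h2
      nlinarith

end Wt

namespace Wt
variable {θ : Wt}

lemma const_mem_Al1 {f x : P3} (h : ∃ κ : ℂ, x = κ • (1 : P3)) : x ∈ Al1 f := by
  obtain ⟨κ, rfl⟩ := h
  exact Subalgebra.smul_mem _ (one_mem _) _

set_option maxHeartbeats 1000000 in
lemma S_iiia {d : ℝ} (hI : θ.IH d) {A B C P Q : P3} {δ : ℝ} (hg : θ.Good A B C) (hP : P ∈ Alg A B) (hQ : Q ∈ Alg A C)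
    (hPd : θ.deg P ≤ θ.deg C) (hQd : θ.deg Q ≤ θ.deg B) (hCB : θ.deg C < θ.deg B)
    (hd : θ.deg A + θ.deg B + θ.deg C = d) (hP1 : ¬ ∃ κ : ℂ, P = κ • (1 : P3)) (hA : θ.deg A = 3 * δ) (hB : θ.deg B = 2 * δ) :
    θ.Lnk d (Sp A B (C + P)) (Sp A (B + Q) C) := by
  have hC0 := θ.Tri_deg_pos hg.tri.rot.rot
  have hA0 := θ.Tri_deg_pos hg.tri
  have l2 := add_le_of hQd
  have hQm : (B + Q) - B ∈ Alg A C := by rwa [add_sub_cancel_left]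
  have hω : δ + θ.om A B ≤ θ.deg C := by
    rcases c32 hg.tri.Jc_ne hA hB hP (by linarith) with h | ⟨φ, cc, rfl⟩
    · exact absurd h hP1
    · obtain ⟨-, -, h⟩ := cc.om32 hg.tri.Jc_ne
      linarith
  have hω2 := θ.two_le_om hg.tri.Jc_ne
  have hcr := θ.cross hg.tri
  have hw := θ.W0_ge
  rcases nc_cn hg.tri.swap23.Jc_ne hQ with hn | ⟨φ, p, q, k', i, j, ε, cc, e⟩
  · apply hI.lin hg hP
    apply hn.lin
    intro i j hij
    have i1 := ilt (n := 1) (by linarith) (by linarith) hij (by push_cast; linarith)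
    have j1 := jlt (n := 2) (by linarith) (by linarith) hij (by push_cast; linarith)
    omega
  · rcases cc.cases' hg.2.2.1 with ⟨hq, h'⟩ | ⟨hq, h'⟩ | ⟨h1, h2⟩
    · have := two_mul_le hq (θ.deg_nonneg A); linarith
    · have hp3 : p < 3 := by
        by_contra hp
        have : (3 : ℝ) ≤ p := by exact_mod_cast (by omega : 3 ≤ p)
        nlinarith
      obtain rfl : p = 2 := by omega
      obtain ⟨A', m, l, c, hc, rfl⟩ := exists_pow h' hA0
      have t : Tri B C (A - c • C ^ 2) := hg.tri.rot.of_sub_Alg (Al1_le_right m)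
      have dM : θ.dg (Sp C (A - c • C ^ 2) B) < d := lt_of_le_of_lt (θ.Tri_dg_le t.swap.swap23) (by linarith)
      refine Lnk.trans (M := Sp C (A - c • C ^ 2) B) ?_ ?_ dM
      · have := hI.XZ (a := -c) hg hA hB (by push_cast at h'; linarith) hP hP1 hPd (neg_ne_zero.2 hc) hd
        rwa [neg_smul, ← sub_eq_add_neg, Sp_rot2 _ B C] at this
      · have := hI.square hg.tri.rot.rot (Alg_sub_comm hQm) m (by linarith)
        rw [Sp_rot C A] at this
        exact this.symm
    · exfalso
      rcases cc.cases with ⟨rfl, -⟩ | ⟨rfl, -⟩ | ⟨-, -, -, h⟩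
      · omega
      · omega
      · rw [e] at h
        have := cc.hε
        linarith

lemma ni_small {p q : ℕ} (hp : 2 ≤ p) (hq : 2 ≤ q) (h : ((q : ℝ) - 1) * p < 2 * q) : p = 2 ∨ (p = 3 ∧ q = 2) := by
  obtain ⟨q', rfl⟩ : ∃ q', q = q' + 1 := ⟨q - 1, by omega⟩
  push_cast at h
  have h2 : q' * p < 2 * (q' + 1) := by
    have : ((q' : ℝ)) * p < 2 * (q' + 1) := by linarith
    exact_mod_cast this
  rcases Nat.lt_or_ge p 4 with h4 | h4
  · rcases Nat.lt_or_ge p 3 with h3 | h3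
    · left; omega
    · right
      obtain rfl : p = 3 := by omega
      omega
  · nlinarith

lemma mem_Al1_lin {B C Q : P3} (h : Q ∈ (Subalgebra.toSubmodule (Al1 B)) ⊔ Submodule.span ℂ {C}) : ∃ R ∈ Al1 B, ∃ b : ℂ, Q = R + b • C := by
  obtain ⟨R, hR, x, hx, rfl⟩ := Submodule.mem_sup.1 h
  obtain ⟨b, rfl⟩ := Submodule.mem_span_singleton.1 hx
  exact ⟨R, hR, b, rfl⟩

set_option maxHeartbeats 1000000 in
lemma S_iiib {d : ℝ} (hI : θ.IH d) {A B C P Q : P3} {δ : ℝ} {s : ℕ} (hg : θ.Good B A C) (hP : P ∈ Alg B A) (hQ : Q ∈ Alg B C)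
    (hPd : θ.deg P ≤ θ.deg C) (hQd : θ.deg Q ≤ θ.deg A) (hCA : θ.deg C < θ.deg A) (hs : ¬ 2 ∣ s) (hs3 : 3 ≤ s)
    (hd : θ.deg B + θ.deg A + θ.deg C = d) (hP1 : ¬ ∃ κ : ℂ, P = κ • (1 : P3)) (hA : θ.deg A = s * δ) (hB : θ.deg B = 2 * δ)
    (hω : (s - 2) * δ + θ.om A B ≤ θ.deg C) :
    θ.Lnk d (Sp B A (C + P)) (Sp B (A + Q) C) := by
  have hC0 := θ.Tri_deg_pos hg.tri.rot.rot
  have hB0 := θ.Tri_deg_pos hg.tri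
  have hω2 := θ.two_le_om hg.tri.swap.Jc_ne
  have hw := θ.W0_ge
  have hs3' : (3 : ℝ) ≤ s := by exact_mod_cast hs3
  have hδ : 0 < δ := by linarith
  have hCδ : δ < θ.deg C := by nlinarith
  have l2 := add_le_of hQd
  have hQm : (A + Q) - A ∈ Alg B C := by rwa [add_sub_cancel_left]
  rcases nc_cn hg.tri.swap23.Jc_ne hQ with hn | ⟨φ, p, q, k', i, j, ε, cc, e⟩
  · by_cases h3 : s = 3
    · subst h3
      push_cast at hA hω
      have hij' : ∀ i j : ℕ, (i : ℝ) * θ.deg B + j * θ.deg C ≤ θ.deg Q → i + j ≤ 1 ∨ (i = 0 ∧ j = 2) := by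
        intro i j hij
        have i1 := ilt (n := 2) (by linarith) (by linarith) hij (by push_cast; linarith)
        have j1 := jlt (n := 3) (by linarith) (by linarith) hij (by push_cast; linarith)
        interval_cases i <;> interval_cases j <;> push_cast at hij <;> first | omega | linarith
      by_cases hC3 : 2 * θ.deg C ≤ 3 * δ
      · obtain ⟨b, c, a, κ, e⟩ := mem_Sp.1 (hn.quad hij')
        by_cases ha : a = 0
        · apply hI.lin hg hP
          exact mem_Pl.2 ⟨b, c, κ, by rw [e, ha]; module⟩
        · have := hI.XZ (a := a) hg.swap hA hB hC3 (Alg_sub_comm hP) hP1 hPd ha (by linarith)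
          have e2 : Sp B (A + Q) C = Sp (A + a • C ^ 2) B C := by
            rw [Sp_swap23 B, Sp_rot (A + a • C ^ 2)]
            exact Sp_third one_ne_zero (x := b • B + c • C + κ • (1 : P3)) (mem_Pl.2 ⟨b, c, κ, rfl⟩) (by rw [e]; module)
          rw [e2, Sp_swap B A]
          exact this
      · apply hI.lin hg hP
        apply hn.lin
        intro i j hij
        rcases hij' i j hij with h | ⟨rfl, rfl⟩
        · exact h
        · push_cast at hij; linarith
    · have hs5 : (5 : ℝ) ≤ s := by exact_mod_cast (by omega : 5 ≤ s)
      have hm : Q ∈ (Subalgebra.toSubmodule (Al1 B)) ⊔ Submodule.span ℂ {C} := by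
        apply hn.1
        intro i j hij
        have j1 := jlt (n := 2) (by linarith) (by linarith) hij (by push_cast; nlinarith)
        interval_cases j
        · apply Submodule.mem_sup_left
          simpa using pow_mem (self_mem_Al1 B) i
        · have i1 : i < 1 := by
            by_contra hi
            have : (1 : ℝ) ≤ i := by exact_mod_cast (by omega : 1 ≤ i)
            push_cast at hij
            nlinarith
          obtain rfl : i = 0 := by omega
          apply Submodule.mem_sup_right
          simp
      obtain ⟨R, hR, b, e⟩ := mem_Al1_lin hm
      have e2 : Sp B (A + Q) C = Sp B (A + R) C := by
        rw [Sp_swap23 B, Sp_swap23 B (A + R)]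
        exact Sp_third one_ne_zero (x := b • C) (mem_Pl.2 ⟨0, b, 0, by module⟩) (by rw [e]; module)
      rw [e2]
      refine hI.sq hg hP hR hPd ?_ hd
      rw [show R = Q - b • C by rw [e]; ring]
      exact (θ.deg_sub_le _ _).trans (max_le hQd ((θ.deg_smul_le _ _).trans hCA.le))
  · rcases cc.cases' hg.2.2.1 with ⟨hq, h'⟩ | ⟨hq, h'⟩ | ⟨h1, h2⟩
    · obtain ⟨C', m, l, -⟩ := exists_pow h' hC0
      have t : Tri B A C' := hg.tri.of_sub_Alg (Al1_le_left m)
      have dM : θ.dg (Sp B A C') < d := lt_of_le_of_lt (θ.Tri_dg_le t) (by linarith)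
      refine Lnk.trans (M := Sp B A C') ?_ ?_ dM
      · apply hI.lnk
        exact hg.tri.adj2 (by rwa [add_sub_cancel_left]) (Al1_le_left m)
      · have := hI.square (g' := C') hg.tri.swap23 hQm m (by linarith)
        rw [Sp_swap23 B C, Sp_swap23 B C'] at this
        exact this.symm
    · have := two_mul_le hq (θ.deg_nonneg C)
      linarith
    · have hcr := θ.cross hg.tri
      rw [θ.om_comm B A] at hcr
      obtain ⟨g1, -⟩ := cc.ge1 h1 h2
      rw [e] at g1
      have hε := cc.hε
      have k1 : ((q : ℝ) - 1) * θ.deg B < 2 * θ.deg C := by nlinarith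
      have k2 : ((q : ℝ) - 1) * p < 2 * q := by
        rw [cc.hf, cc.hg] at k1
        nlinarith
      rcases ni_small h1 h2 k2 with rfl | ⟨rfl, rfl⟩
      · exfalso
        have e1 := cc.hf
        push_cast at e1
        obtain rfl : ε = δ := by linarith
        have e2 := cc.hg
        have s1 : (s : ℝ) < q + 2 := by nlinarith
        have s2 : (q : ℝ) < s := by nlinarith
        have s1' : s < q + 2 := by exact_mod_cast s1
        have s2' : q < s := by exact_mod_cast s2
        have hc := cc.cop
        have : ¬ 2 ∣ q := by
          intro h
          have := Nat.eq_one_of_dvd_coprimes hc (dvd_refl 2) h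
          omega
        omega
      · have e1 := cc.hf
        have e2 := cc.hg
        push_cast at e1 e2 g1
        have hC4 : 3 * θ.deg C = 4 * δ := by linarith
        have s1 : (s : ℝ) < 4 := by nlinarith
        have s1' : s < 4 := by exact_mod_cast s1
        obtain rfl : s = 3 := by omega
        push_cast at hA hω
        constructor
        · intro hR hlt
          exfalso
          rw [Sp_swap] at hR hlt
          obtain ⟨C', r1, r2, r3, r4⟩ := hI.minC hg.swap (by rw [add_sub_cancel_left]; exact Alg_sub_comm hP) hR hlt (by linarith)
          exact Irr hg.swap hA hB (by linarith) r1 r2 r3 (by linarith) r4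
        · intro hR hlt
          exfalso
          rw [Sp_swap23] at hR hlt
          obtain ⟨A', r1, r2, r3, r4⟩ := hI.minC hg.swap23 hQm hR hlt (by linarith)
          rw [Sp_rot2] at r4
          exact Irr3 hg.swap hA hB hC4 (by linarith) r1 r2 r3 r4

lemma caseS {d : ℝ} (hI : θ.IH d) {f g h P Q : P3} (hg : θ.Good f g h) (hP : P ∈ Alg f g) (hQ : Q ∈ Alg f h)
    (hPd : θ.deg P ≤ θ.deg h) (hQd : θ.deg Q ≤ θ.deg g) (hhg : θ.deg h < θ.deg g)
    (hd : θ.deg f + θ.deg g + θ.deg h = d) :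
    θ.Lnk d (Sp f g (h + P)) (Sp f (g + Q) h) := by
  by_cases hP1 : P ∈ Al1 f
  · have := hI.sq hg.swap23 hQ hP1 hQd hPd (by linarith)
    rw [Sp_swap23 f h, Sp_swap23 f _ g] at this
    exact this.symm
  have hP2 : ¬ ∃ κ : ℂ, P = κ • (1 : P3) := fun h => hP1 (const_mem_Al1 h)
  have hf0 := θ.Tri_deg_pos hg.tri
  have hg0 := θ.Tri_deg_pos hg.tri.rot
  rcases nc_cn hg.tri.Jc_ne hP with hn | ⟨φ, p, q, k', i, j, ε, cc, e⟩
  · exfalso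
    apply hP1
    apply hn.al1
    intro i j hij
    have := jlt (n := 1) (by linarith) (by linarith) hij (by push_cast; linarith)
    omega
  · rcases cc.cases' hg.2.1 with ⟨hq, h'⟩ | ⟨hq, h'⟩ | ⟨h1, h2⟩
    · exact S_ii hI hg hP hQ hPd hd h'
    · exact S_i hI hg hP hQ hPd hQd hhg hd h' hq
    · obtain ⟨g1, g2⟩ := cc.ge1 h1 h2
      rw [e] at g1 g2
      have o : 0 ≤ θ.om f g := θ.vdeg_nonneg _
      have hε := cc.hε
      have e1 := cc.hf
      have e2 := cc.hg
      have k2 : ((q : ℝ) - 1) * p < 2 * q := by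
        have : ((q : ℝ) - 1) * θ.deg f < 2 * θ.deg g := by linarith
        rw [e1, e2] at this
        nlinarith
      rcases ni_small h1 h2 k2 with rfl | ⟨rfl, rfl⟩
      · push_cast at e1
        have hqo : ¬ 2 ∣ q := by
          intro h
          have := Nat.eq_one_of_dvd_coprimes cc.cop (dvd_refl 2) h
          omega
        refine S_iiib hI hg hP hQ hPd hQd hhg hqo ?_ hd hP2 e2 e1 ?_
        · rcases Nat.lt_or_ge q 3 with h | h
          · obtain rfl : q = 2 := by omega
            omega
          · exact h
        · rw [θ.om_comm g f]
          push_cast at g2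
          nlinarith
      · push_cast at e1 e2
        exact S_iiia hI hg hP hQ hPd hQd hhg hd hP2 e1 e2

end Wt


namespace Wt
variable {θ : Wt}

structure TT (θ : Wt) (d : ℝ) (f g h e : P3) (γ : ℂ) (P Q : P3) : Prop where
  hI : θ.IH d
  G1 : θ.Good f g e
  G2 : θ.Good f h e
  hγ : γ ≠ 0
  hh : h = g + γ • e
  hgh : θ.deg h = θ.deg g
  heg : θ.deg e < θ.deg g
  hd : θ.deg f + θ.deg g + θ.deg e = d
  hP : P ∈ Alg f g
  hQ : Q ∈ Alg f h
  hPd : θ.deg P ≤ θ.deg e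
  hQd : θ.deg Q ≤ θ.deg e

lemma TT.symm {d : ℝ} {f g h e P Q : P3} {γ : ℂ} (t : θ.TT d f g h e γ P Q) : θ.TT d f h g e (-γ) Q P :=
  ⟨t.hI, t.G2, t.G1, neg_ne_zero.2 t.hγ, by rw [t.hh]; module, t.hgh.symm, by rw [t.hgh]; exact t.heg, by rw [t.hgh]; exact t.hd,
    t.hQ, t.hP, t.hQd, t.hPd⟩

lemma TT.Pl {d : ℝ} {f g h e P Q : P3} {γ : ℂ} (t : θ.TT d f g h e γ P Q) : Pl h e = Pl g e :=
  Pl_eq (mem_Pl.2 ⟨1, γ, 0, by rw [t.hh]; module⟩) (right_mem_Pl _ _) (mem_Pl.2 ⟨1, -γ, 0, by rw [t.hh]; module⟩) (right_mem_Pl _ _)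

lemma TT.Sp {d : ℝ} {f g h e P Q : P3} {γ : ℂ} (t : θ.TT d f g h e γ P Q) : Sp f h e = Sp f g e := by
  rw [Sp_rot f h e, Sp_rot f g e]; exact Sp_congr_Pl t.Pl f

lemma TT.lin {d : ℝ} {f g h e P Q : P3} {γ : ℂ} (t : θ.TT d f g h e γ P Q) (hP : P ∈ _root_.Pl f g) :
    θ.Lnk d (_root_.Sp f g (e + P)) (_root_.Sp f h (e + Q)) := by
  have : _root_.Sp f g (e + P) = _root_.Sp f g e := Sp_third one_ne_zero hP (by module)
  rw [this, ← t.Sp]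
  exact t.hI.lnk (t.G2.tri.adj (by rw [add_sub_cancel_left]; exact t.hQ))

lemma TT.res_gf {d : ℝ} {f g h e P Q : P3} {γ : ℂ} (t : θ.TT d f g h e γ P Q) {k : ℕ} (hk : θ.deg g = k * θ.deg f) :
    θ.Lnk d (_root_.Sp f g (e + P)) (_root_.Sp f h (e + Q)) := by
  obtain ⟨g', m, l, -⟩ := exists_pow hk (θ.Tri_deg_pos t.G1.tri.rot)
  obtain ⟨h', m', l', -⟩ := exists_pow (f := h) (g := f) (k := k) (by rw [t.hgh, hk]) (θ.Tri_deg_pos t.G2.tri.rot)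
  have l1 := add_le_of t.hPd
  have l2 := add_le_of t.hQd
  have hd := t.hd
  have hgh := t.hgh
  have tg : Tri f e g' := t.G1.tri.swap23.of_sub_Alg (Al1_le_left m)
  have th : Tri f e h' := t.G2.tri.swap23.of_sub_Alg (Al1_le_left m')
  have s1 := t.hI.square (g' := g') (h' := e + P) t.G1.tri (by rw [add_sub_cancel_left]; exact t.hP) m (by linarith)
  have s2 := t.hI.square (g' := h') (h' := e + Q) t.G2.tri (by rw [add_sub_cancel_left]; exact t.hQ) m' (by linarith)
  have a : Adj (_root_.Sp f g' e) (_root_.Sp f h' e) := by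
    rw [Sp_swap23 f g' e, Sp_swap23 f h' e]
    refine t.G1.tri.swap23.adj2 (Al1_le_left m) ?_
    have := add_mem (Al1_le_left (g := e) m') (Subalgebra.smul_mem _ (right_mem_Alg f e) γ)
    rwa [show h' - h + γ • e = h' - g by rw [t.hh]; module] at this
  refine s1.trans ((t.hI.lnk a).trans s2.symm ?_) ?_
  · exact lt_of_le_of_lt (θ.Tri_dg_le th.swap23) (by linarith)
  · exact lt_of_le_of_lt (θ.Tri_dg_le tg.swap23) (by linarith)

lemma TT.res_fg {d : ℝ} {f g h e P Q : P3} {γ : ℂ} (t : θ.TT d f g h e γ P Q) {k : ℕ} (hk : θ.deg f = k * θ.deg g) :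
    θ.Lnk d (_root_.Sp f g (e + P)) (_root_.Sp f h (e + Q)) := by
  obtain ⟨f', m, l, -⟩ := exists_pow hk (θ.Tri_deg_pos t.G1.tri)
  obtain ⟨f'', m', l', -⟩ := exists_pow (f := f) (g := h) (k := k) (by rw [t.hgh, hk]) (θ.Tri_deg_pos t.G2.tri)
  have l1 := add_le_of t.hPd
  have l2 := add_le_of t.hQd
  have hd := t.hd
  have hgh := t.hgh
  have tg : Tri g e f' := t.G1.tri.rot.of_sub_Alg (Al1_le_left m)
  have th : Tri h e f'' := t.G2.tri.rot.of_sub_Alg (Al1_le_left m')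
  have s1 := t.hI.square (g' := f') (h' := e + P) t.G1.tri.swap (by rw [add_sub_cancel_left]; exact Alg_sub_comm t.hP) m (by linarith)
  have s2 := t.hI.square (g' := f'') (h' := e + Q) t.G2.tri.swap (by rw [add_sub_cancel_left]; exact Alg_sub_comm t.hQ) m' (by linarith)
  have a : Adj (_root_.Sp g f' e) (_root_.Sp h f'' e) := by
    rw [Sp_swap23 g f' e, Sp_swap23 h f'' e, Sp_congr_Pl t.Pl]
    refine t.G1.tri.rot.adj2 (Al1_le_left m) ?_
    rw [← Alg_congr t.Pl]
    exact Al1_le_left m'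
  rw [Sp_swap f g, Sp_swap f h]
  refine s1.trans ((t.hI.lnk a).trans s2.symm ?_) ?_
  · exact lt_of_le_of_lt (θ.Tri_dg_le th.swap23) (by linarith)
  · exact lt_of_le_of_lt (θ.Tri_dg_le tg.swap23) (by linarith)

/-- om f e is bounded by max -/
lemma TT.om_fe {d : ℝ} {f g h e P Q : P3} {γ : ℂ} (t : θ.TT d f g h e γ P Q) : θ.om f e ≤ max (θ.om f g) (θ.om f h) := by
  have : Jc f e = γ⁻¹ • (Jc f h - Jc f g) := by
    rw [t.hh, Jc_add_right, Jc_smul_right, add_sub_cancel_left, smul_smul, inv_mul_cancel₀ t.hγ, one_smul]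
  unfold om
  rw [this, max_comm]
  exact (θ.vdeg_smulC_le _ _).trans (θ.vdeg_sub_le _ _)

lemma TT.T1half {d : ℝ} {f g h e P Q : P3} {γ : ℂ} (t : θ.TT d f g h e γ P Q) (hef : θ.deg e < θ.deg f) :
    θ.Lnk d (_root_.Sp f g (e + P)) (_root_.Sp f h (e + Q)) ∨ (∃ δ, 0 < δ ∧ 2 * δ ≤ θ.deg f ∧ θ.deg f + θ.deg g = 5 * δ ∧ θ.om f g ≤ θ.deg e - δ ∧ θ.deg e < 2 * δ) := by
  have hf0 := θ.Tri_deg_pos t.G1.tri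
  have hg0 := θ.Tri_deg_pos t.G1.tri.rot
  have he0 := θ.Tri_deg_pos t.G1.tri.rot.rot
  have hPd := t.hPd
  have heg := t.heg
  rcases nc_cn t.G1.tri.Jc_ne t.hP with hn | ⟨φ, p, q, k', i, j, ε, cc, e'⟩
  · left
    apply t.lin
    obtain ⟨κ, hκ⟩ := hn.const (by
      intro i j hij
      have := jlt (n := 1) (by linarith) (by linarith) hij (by push_cast; linarith)
      have := ilt (n := 1) (by linarith) (by linarith) hij (by push_cast; linarith)
      omega)
    rw [hκ]; exact Submodule.smul_mem _ _ (one_mem_Pl _ _)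
  · rcases cc.cases' t.G1.2.1 with ⟨hq, h'⟩ | ⟨hq, h'⟩ | ⟨h1, h2⟩
    · exact Or.inl (t.res_gf h')
    · exact Or.inl (t.res_fg h')
    · right
      obtain ⟨g1, g2⟩ := cc.ge1 h1 h2
      rw [e'] at g1 g2
      have o : 0 ≤ θ.om f g := θ.vdeg_nonneg _
      have hε := cc.hε
      have e1 := cc.hf
      have e2 := cc.hg
      have k2 : ((q : ℝ) - 1) * p < 2 * q := by
        have : ((q : ℝ) - 1) * θ.deg f < 2 * θ.deg g := by linarith
        rw [e1, e2] at this
        nlinarith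
      rcases ni_small h1 h2 k2 with rfl | ⟨rfl, rfl⟩
      · push_cast at e1
        have hqo : ¬ 2 ∣ q := by
          intro h
          have := Nat.eq_one_of_dvd_coprimes cc.cop (dvd_refl 2) h
          omega
        push_cast at g2
        have hq4 : q < 4 := by
          by_contra hh
          push Not at hh
          have : (4 : ℝ) ≤ q := by exact_mod_cast hh
          nlinarith
        obtain rfl : q = 3 := by
          rcases (show q = 2 ∨ q = 3 by omega) with rfl | rfl
          · omega
          · rfl
        push_cast at e2
        exact ⟨ε, hε, by linarith, by linarith, by linarith, by linarith⟩
      · push_cast at e1 e2 g2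
        exact ⟨ε, hε, by linarith, by linarith, by linarith, by linarith⟩

lemma TT.T1 {d : ℝ} {f g h e P Q : P3} {γ : ℂ} (t : θ.TT d f g h e γ P Q) (hef : θ.deg e < θ.deg f) :
    θ.Lnk d (_root_.Sp f g (e + P)) (_root_.Sp f h (e + Q)) := by
  rcases t.T1half hef with h1 | ⟨δ, h1, h2, h3, h4, h5⟩
  · exact h1
  rcases t.symm.T1half hef with h1' | ⟨δ', h1', h2', h3', h4', h5'⟩
  · exact h1'.symm
  exfalso
  have hgh := t.hgh
  obtain rfl : δ' = δ := by linarith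
  have := θ.cross t.G1.tri
  have := t.om_fe
  have := θ.W0_ge
  have : θ.om f e ≤ θ.deg e - δ' := t.om_fe.trans (max_le h4 h4')
  linarith

end Wt


noncomputable def uu (a b : ℕ) : Fin 2 →₀ ℕ := Finsupp.single 0 a + Finsupp.single 1 b
@[simp] lemma uu0 (a b : ℕ) : uu a b 0 = a := by simp [uu]
@[simp] lemma uu1 (a b : ℕ) : uu a b 1 = b := by simp [uu]
lemma uu_eq {u : Fin 2 →₀ ℕ} {a b : ℕ} (h0 : u 0 = a) (h1 : u 1 = b) : u = uu a b := by
  ext i; fin_cases i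
  · simpa using h0
  · simpa using h1

lemma uu_inj {a b a' b' : ℕ} (h : uu a b = uu a' b') : a = a' ∧ b = b' := by
  have h0 := DFunLike.congr_fun h 0
  have h1 := DFunLike.congr_fun h 1
  simp at h0 h1
  exact ⟨h0, h1⟩

/-- weighted filtration -/
noncomputable def MM (f g : P3) (s n : ℕ) : Submodule ℂ P3 := Submodule.span ℂ {x | ∃ i j : ℕ, 2 * i + s * j ≤ n ∧ x = f ^ i * g ^ j}

lemma MM_mem {f g : P3} {s n i j : ℕ} (h : 2 * i + s * j ≤ n) : f ^ i * g ^ j ∈ MM f g s n := Submodule.subset_span ⟨i, j, h, rfl⟩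

lemma MM_mono {f g : P3} {s n m : ℕ} (h : n ≤ m) : MM f g s n ≤ MM f g s m := by
  apply Submodule.span_mono
  rintro x ⟨i, j, hij, rfl⟩
  exact ⟨i, j, hij.trans h, rfl⟩

lemma MM_mul {f g : P3} {s n m l : ℕ} {x y : P3} (hl : n + m = l) (hx : x ∈ MM f g s n) (hy : y ∈ MM f g s m) : x * y ∈ MM f g s l := by
  subst hl
  have := Submodule.mul_mem_mul hx hy
  rw [MM, MM, Submodule.span_mul_span] at this
  refine Submodule.span_le.2 ?_ this
  rintro _ ⟨_, ⟨i, j, h, rfl⟩, _, ⟨i', j', h', rfl⟩, rfl⟩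
  refine Submodule.subset_span ⟨i + i', j + j', by nlinarith, ?_⟩
  simp only []
  ring

namespace Wt
variable {θ : Wt}

lemma MM_deg {f g : P3} {s n : ℕ} {δ : ℝ} (hδ : 0 < δ) (hf : θ.deg f = 2 * δ) (hg : θ.deg g = s * δ) {x : P3} (hx : x ∈ MM f g s n) :
    θ.deg x ≤ n * δ := by
  induction hx using Submodule.span_induction with
  | mem x h =>
    obtain ⟨i, j, hij, rfl⟩ := h
    refine (θ.deg_mul_le _ _).trans ?_
    rw [θ.deg_pow, θ.deg_pow, hf, hg]
    have : (2 * i + s * j : ℝ) ≤ n := by exact_mod_cast hij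
    nlinarith
  | zero => rw [θ.deg_zero]; positivity
  | add x y _ _ hx hy => exact (θ.deg_add_le _ _).trans (max_le hx hy)
  | smul a x _ hx => exact (θ.deg_smul_le _ _).trans hx

lemma MM_gap {f g : P3} {s n m : ℕ} {δ : ℝ} (hδ : 0 < δ) (hf : θ.deg f = 2 * δ) (hg : θ.deg g = s * δ) {x : P3} {r : ℂ} (hm : m + 1 = 2 * n)
    (hx : x - r • f ^ n ∈ MM f g s m) : θ.deg x = 2 * n * δ ∨ θ.deg x ≤ m * δ := by
  have h1 := MM_deg hδ hf hg hx
  by_cases hr : r = 0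
  · right; simpa [hr] using h1
  · left
    have e : x = r • f ^ n + (x - r • f ^ n) := by module
    have h2 : θ.deg (r • f ^ n) = 2 * n * δ := by rw [θ.deg_smul hr, θ.deg_pow, hf]; ring
    rw [e, θ.deg_add_eq, h2]
    rw [h2]
    have : (m : ℝ) + 1 = 2 * n := by exact_mod_cast hm
    nlinarith

lemma Canc.wt {f g : P3} {φ : P2} {s k : ℕ} {δ : ℝ} (c : θ.Canc f g φ 2 s k 0 0 δ) {u : Fin 2 →₀ ℕ} (hu : u ∈ φ.support) :
    2 * u 0 + s * u 1 < 2 * s * k ∨ ∃ t ≤ k, u = uu (t * s) ((k - t) * 2) := by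
  have h1 := c.le u hu
  have h2 := c.top u hu
  have hε := c.hε
  have e : θ.mw f g u = ((2 * u 0 + s * u 1 : ℕ) : ℝ) * δ := by
    unfold mw; rw [c.hf, c.hg]; push_cast; ring
  have e2 : ((k * (2 : ℕ) * s) * δ + (0 : ℕ) * θ.deg f + (0 : ℕ) * θ.deg g : ℝ) = ((2 * s * k : ℕ) : ℝ) * δ := by push_cast; ring
  rw [e2] at h1 h2
  rw [e] at h1 h2
  have h3 : 2 * u 0 + s * u 1 ≤ 2 * s * k := by
    exact_mod_cast le_of_mul_le_mul_right h1 hε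
  rcases h3.lt_or_eq with h4 | h4
  · exact Or.inl h4
  · right
    obtain ⟨t, ht, a, b⟩ := h2 (by rw [h4])
    exact ⟨t, ht, uu_eq (by simpa using a) (by simpa using b)⟩

lemma Canc.dec1 {f g : P3} {φ : P2} {s : ℕ} {δ : ℝ} (c : θ.Canc f g φ 2 s 1 0 0 δ) :
    ∃ (a r : ℂ) (φ' : P2), a ≠ 0 ∧ φ = monomial (uu 0 2) a + monomial (uu s 0) r + φ' ∧ ∀ u ∈ φ'.support, 2 * u 0 + s * u 1 < 2 * s := by
  classical
  have hq := c.hq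
  have n1 : uu 0 2 ≠ uu s 0 := fun h => by have := uu_inj h; omega
  refine ⟨coeff (uu 0 2) φ, coeff (uu s 0) φ, φ - monomial (uu 0 2) (coeff (uu 0 2) φ) - monomial (uu s 0) (coeff (uu s 0) φ), ?_, by ring, ?_⟩
  · obtain ⟨u, hu, h0, h1⟩ := c.mem1
    rw [uu_eq h0 (b := 2) (by simpa using h1)] at hu
    exact mem_support_iff.1 hu
  · intro u hu
    rw [mem_support_iff, coeff_sub, coeff_sub, coeff_monomial, coeff_monomial] at hu
    by_cases h1 : uu 0 2 = u
    · subst h1; simp [n1.symm] at hu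
    by_cases h2 : uu s 0 = u
    · subst h2; simp [n1] at hu
    rw [if_neg h1, if_neg h2, sub_zero, sub_zero] at hu
    rcases c.wt (mem_support_iff.2 hu) with h | ⟨t, ht, h⟩
    · simpa using h
    · rcases (show t = 0 ∨ t = 1 by omega) with rfl | rfl
      · simp at h; exact absurd h.symm h1
      · simp at h; exact absurd h.symm h2

lemma Canc.dec2 {f g : P3} {φ : P2} {δ : ℝ} (c : θ.Canc f g φ 2 3 2 0 0 δ) :
    ∃ (a r1 r0 : ℂ) (φ' : P2), a ≠ 0 ∧ φ = monomial (uu 0 4) a + monomial (uu 3 2) r1 + monomial (uu 6 0) r0 + φ' ∧ ∀ u ∈ φ'.support, 2 * u 0 + 3 * u 1 < 12 := by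
  classical
  have n1 : uu 0 4 ≠ uu 3 2 := fun h => by have := uu_inj h; omega
  have n2 : uu 0 4 ≠ uu 6 0 := fun h => by have := uu_inj h; omega
  have n3 : uu 3 2 ≠ uu 6 0 := fun h => by have := uu_inj h; omega
  refine ⟨coeff (uu 0 4) φ, coeff (uu 3 2) φ, coeff (uu 6 0) φ, φ - monomial (uu 0 4) (coeff (uu 0 4) φ) - monomial (uu 3 2) (coeff (uu 3 2) φ) - monomial (uu 6 0) (coeff (uu 6 0) φ), ?_, by ring, ?_⟩
  · obtain ⟨u, hu, h0, h1⟩ := c.mem1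
    rw [uu_eq h0 (b := 4) (by simpa using h1)] at hu
    exact mem_support_iff.1 hu
  · intro u hu
    rw [mem_support_iff, coeff_sub, coeff_sub, coeff_sub, coeff_monomial, coeff_monomial, coeff_monomial] at hu
    by_cases h1 : uu 0 4 = u
    · subst h1; simp [n1.symm, n2.symm] at hu
    by_cases h2 : uu 3 2 = u
    · subst h2; simp [n1, n3.symm] at hu
    by_cases h3 : uu 6 0 = u
    · subst h3; simp [n2, n3] at hu
    rw [if_neg h1, if_neg h2, if_neg h3, sub_zero, sub_zero, sub_zero] at hu
    rcases c.wt (mem_support_iff.2 hu) with h | ⟨t, ht, h⟩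
    · simpa using h
    · rcases (show t = 0 ∨ t = 1 ∨ t = 2 by omega) with rfl | rfl | rfl
      · simp at h; exact absurd h.symm h1
      · simp at h; exact absurd h.symm h2
      · simp at h; exact absurd h.symm h3

lemma ev_MM {f g : P3} {φ : P2} {s n m : ℕ} (hm : m + 1 = n) (h : ∀ u ∈ φ.support, 2 * u 0 + s * u 1 < n) : ev f g φ ∈ MM f g s m :=
  ev_mem _ fun u hu => MM_mem (by have := h u hu; omega)

/-- the difference of lower parts -/
lemma ev_diff {f g h e : P3} {γ : ℂ} {φ : P2} {s : ℕ} {δ : ℝ} (hδ : 0 < δ) (hf : θ.deg f = 2 * δ) (hh : h = g + γ • e)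
    (hu : ∀ u ∈ φ.support, 2 * u 0 + s * u 1 < 2 * s) (hs : 3 ≤ s) : θ.deg (ev f h φ - ev f g φ) ≤ (s - 1) * δ + θ.deg e := by
  have he := θ.deg_nonneg e
  have hs' : (3 : ℝ) ≤ s := by exact_mod_cast hs
  rw [φ.as_sum, map_sum, map_sum, ← Finset.sum_sub_distrib]
  refine θ.deg_sum_le _ _ (by nlinarith) ?_
  intro u hu'
  have h1 := hu u hu'
  rw [ev_monomial, ev_monomial, ← smul_sub]
  refine (θ.deg_smul_le _ _).trans ?_
  have h2 : u 1 < 2 := by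
    by_contra hc; push Not at hc; nlinarith
  rcases (show u 1 = 0 ∨ u 1 = 1 by omega) with h3 | h3
  · rw [h3]; simp only [pow_zero, sub_self, θ.deg_zero]; nlinarith
  · rw [h3] at h1 ⊢
    have e1 : f ^ u 0 * h ^ 1 - f ^ u 0 * g ^ 1 = f ^ u 0 * (γ • e) := by rw [hh]; ring
    rw [e1]
    refine (θ.deg_mul_le _ _).trans ?_
    rw [θ.deg_pow, hf]
    have : 2 * u 0 + 1 ≤ s := by omega
    have h5 : (2 * u 0 + 1 : ℝ) ≤ s := by exact_mod_cast this
    have := θ.deg_smul_le γ e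
    nlinarith

set_option maxHeartbeats 1000000 in
lemma T2core {f g h e : P3} {γ : ℂ} (hγ : γ ≠ 0) (hh : h = g + γ • e) {s k : ℕ} {δ : ℝ} {φ ψ : P2} (hs : 3 ≤ s)
    (c1 : θ.Canc f g φ 2 s k 0 0 δ) (c2 : θ.Canc f h ψ 2 s 1 0 0 δ) (hk : k = 1 ∨ (k = 2 ∧ s = 3 ∧ 8 / 3 * δ < θ.deg e))
    (d1 : θ.deg (ev f g φ) ≤ θ.deg e) (d2 : θ.deg (ev f h ψ) ≤ θ.deg e) (e1 : (s - 1) * δ < θ.deg e) (e2 : θ.deg e < s * δ) : False := by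
  obtain ⟨c, r, ψ', hc, rfl, hu⟩ := c2.dec1
  have hδ := c2.hε
  have hf : θ.deg f = 2 * δ := by have := c1.hf; push_cast at this; exact this
  have hg := c1.hg
  have hs' : (3 : ℝ) ≤ s := by exact_mod_cast hs
  have he0 : 0 < θ.deg e := lt_of_le_of_lt (by nlinarith) e1
  set H := ev f g (monomial (uu 0 2) c + monomial (uu s 0) r + ψ') with hH
  obtain ⟨m, hm⟩ : ∃ m, m + 1 = 2 * s := ⟨2 * s - 1, by omega⟩
  have hm' : (m : ℝ) + 1 = 2 * s := by exact_mod_cast hm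
  have hn : ev f g ψ' ∈ MM f g s m := ev_MM hm hu
  have H1 : H = c • g ^ 2 + r • f ^ s + ev f g ψ' := by
    simp [hH, ev_monomial, map_add]
  have H2 : H = ev f h (monomial (uu 0 2) c + monomial (uu s 0) r + ψ') - (ev f h ψ' - ev f g ψ') - (c * γ) • (e * ((2 : ℂ) • g + γ • e)) := by
    rw [H1]
    simp only [map_add, ev_monomial, uu0, uu1, pow_zero, one_mul, mul_one]
    rw [hh]
    simp only [Algebra.smul_def, map_mul, map_ofNat]
    ring
  have t1 : θ.deg ((2 : ℂ) • g + γ • e) = s * δ := by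
    rw [θ.deg_add_eq, θ.deg_smul two_ne_zero, hg]
    rw [θ.deg_smul two_ne_zero, hg]
    exact lt_of_le_of_lt (θ.deg_smul_le _ _) e2
  have t2 : θ.deg ((c * γ) • (e * ((2 : ℂ) • g + γ • e))) = θ.deg e + s * δ := by
    rw [θ.deg_smul (mul_ne_zero hc hγ), θ.deg_mul (θ.ne_zero_of_deg_pos he0) (θ.ne_zero_of_deg_pos (by rw [t1]; nlinarith)), t1]
  have t3 : θ.deg (ev f h (monomial (uu 0 2) c + monomial (uu s 0) r + ψ') - (ev f h ψ' - ev f g ψ')) < θ.deg e + s * δ := by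
    refine lt_of_le_of_lt (θ.deg_sub_le _ _) (max_lt (lt_of_le_of_lt d2 (by nlinarith)) (lt_of_le_of_lt (ev_diff hδ hf hh hu hs) (by nlinarith)))
  have Hd : θ.deg H = θ.deg e + s * δ := by
    rw [H2, deg_sub_eq_of, t2]
    rw [t2]; exact t3
  clear_value H
  rcases hk with rfl | ⟨rfl, rfl, h3⟩
  · obtain ⟨α, ρ, φ', hα, rfl, hu'⟩ := c1.dec1
    have P1 : ev f g (monomial (uu 0 2) α + monomial (uu s 0) ρ + φ') = α • g ^ 2 + ρ • f ^ s + ev f g φ' := by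
      simp [ev_monomial, map_add]
    have hx : (ev f g (monomial (uu 0 2) α + monomial (uu s 0) ρ + φ') - (α * c⁻¹) • H) - (ρ - α * c⁻¹ * r) • f ^ s ∈ MM f g s m := by
      have : (ev f g (monomial (uu 0 2) α + monomial (uu s 0) ρ + φ') - (α * c⁻¹) • H) - (ρ - α * c⁻¹ * r) • f ^ s = ev f g φ' - (α * c⁻¹) • ev f g ψ' := by
        have : α * c⁻¹ * c = α := by field_simp
        rw [P1, H1, smul_add, smul_add, smul_smul, this]
        module
      rw [this]
      exact sub_mem (ev_MM hm hu') (Submodule.smul_mem _ _ hn)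
    have hdd : θ.deg (ev f g (monomial (uu 0 2) α + monomial (uu s 0) ρ + φ') - (α * c⁻¹) • H) = θ.deg e + s * δ := by
      have : θ.deg ((α * c⁻¹) • H) = θ.deg e + s * δ := by rw [θ.deg_smul (mul_ne_zero hα (inv_ne_zero hc)), Hd]
      rw [deg_sub_eq_of, this]
      rw [this]
      exact lt_of_le_of_lt d1 (by nlinarith)
    rcases MM_gap hδ hf hg hm hx with h | h <;> rw [hdd] at h <;> nlinarith
  · obtain ⟨α, r1, r0, φ', hα, rfl, hu'⟩ := c1.dec2
    push_cast at *
    obtain rfl : m = 5 := by omega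
    have P1 : ev f g (monomial (uu 0 4) α + monomial (uu 3 2) r1 + monomial (uu 6 0) r0 + φ') = α • g ^ 4 + r1 • (f ^ 3 * g ^ 2) + r0 • f ^ 6 + ev f g φ' := by
      simp [ev_monomial, map_add]
    set P := ev f g (monomial (uu 0 4) α + monomial (uu 3 2) r1 + monomial (uu 6 0) r0 + φ') with hP
    clear_value P
    obtain ⟨β, hβ⟩ : ∃ β : ℂ, β = α * (c⁻¹ * c⁻¹) := ⟨_, rfl⟩
    have hβ0 : β ≠ 0 := by rw [hβ]; exact mul_ne_zero hα (mul_ne_zero (inv_ne_zero hc) (inv_ne_zero hc))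
    obtain ⟨ρ, hρ⟩ : ∃ ρ : ℂ, ρ = (r1 - 2 * β * c * r) * c⁻¹ := ⟨_, rfl⟩
    have b1 : α = β * c ^ 2 := by rw [hβ]; field_simp
    have b2 : r1 = ρ * c + 2 * β * c * r := by rw [hρ]; field_simp; ring
    have hx : (P - β • H ^ 2 - ρ • (f ^ 3 * H)) - (r0 - β * r ^ 2 - ρ * r) • f ^ 6 ∈ MM f g 3 11 := by
      have e3 : (P - β • H ^ 2 - ρ • (f ^ 3 * H)) - (r0 - β * r ^ 2 - ρ * r) • f ^ 6 = ev f g φ' - β • (ev f g ψ' * (H + (c • g ^ 2 + r • f ^ 3))) - ρ • (f ^ 3 * ev f g ψ') := by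
        rw [P1, H1, b1, b2]
        simp only [Algebra.smul_def, map_mul, map_ofNat, map_sub, map_add, map_pow]
        ring
      rw [e3]
      have m1 : g ^ 2 ∈ MM f g 3 6 := by simpa using MM_mem (f := f) (g := g) (s := 3) (n := 6) (i := 0) (j := 2) (by norm_num)
      have m2 : f ^ 3 ∈ MM f g 3 6 := by simpa using MM_mem (f := f) (g := g) (s := 3) (n := 6) (i := 3) (j := 0) (by norm_num)
      have m3 : c • g ^ 2 + r • f ^ 3 ∈ MM f g 3 6 := add_mem (Submodule.smul_mem _ _ m1) (Submodule.smul_mem _ _ m2)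
      have m4 : H ∈ MM f g 3 6 := by rw [H1]; exact add_mem m3 (MM_mono (by norm_num) hn)
      refine sub_mem (sub_mem (ev_MM (by norm_num) hu') (Submodule.smul_mem _ _ ?_)) (Submodule.smul_mem _ _ ?_)
      · exact MM_mul (by norm_num) hn (add_mem m4 m3)
      · exact MM_mul (by norm_num) m2 hn
    have hH0 : H ≠ 0 := θ.ne_zero_of_deg_pos (by rw [Hd]; linarith)
    have hf0 : f ≠ 0 := θ.ne_zero_of_deg_pos (by rw [hf]; linarith)
    have k1 : θ.deg (β • H ^ 2) = 2 * θ.deg e + 6 * δ := by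
      rw [θ.deg_smul hβ0, θ.deg_pow, Hd]; push_cast; ring
    have k2 : θ.deg (P - β • H ^ 2) = 2 * θ.deg e + 6 * δ := by
      rw [deg_sub_eq_of, k1]; rw [k1]; linarith
    have k3 : θ.deg (P - β • H ^ 2 - ρ • (f ^ 3 * H)) = 2 * θ.deg e + 6 * δ ∨ θ.deg (P - β • H ^ 2 - ρ • (f ^ 3 * H)) = 9 * δ + θ.deg e := by
      by_cases hr : ρ = 0
      · left; rw [hr, zero_smul, sub_zero, k2]
      · right
        have : θ.deg (ρ • (f ^ 3 * H)) = 9 * δ + θ.deg e := by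
          rw [θ.deg_smul hr, θ.deg_mul (pow_ne_zero _ hf0) hH0, θ.deg_pow, hf, Hd]; push_cast; ring
        rw [deg_sub_eq_of, this]
        rw [this, k2]; linarith
    rcases MM_gap hδ hf (by push_cast; exact hg) (n := 6) (m := 11) (by norm_num) hx with h | h <;> push_cast at h <;> rcases k3 with h' | h' <;> linarith

end Wt


namespace Wt
variable {θ : Wt}

lemma Good.of_deg {f g e e' : P3} (hg : θ.Good f g e) (ht : Tri f g e') (h : θ.deg e' = θ.deg e) : θ.Good f g e' :=
  ⟨ht, hg.2.1, by rw [h]; exact hg.2.2.1, by rw [h]; exact hg.2.2.2⟩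

lemma TT.T2res {d : ℝ} {f g h e P Q : P3} {γ : ℂ} (t : θ.TT d f g h e γ P Q) {l : ℕ} (hl : θ.deg e = l * θ.deg f) :
    θ.Lnk d (_root_.Sp f g (e + P)) (_root_.Sp f h (e + Q)) := by
  obtain ⟨e', m, l, c, hc, he'⟩ := exists_pow hl (θ.Tri_deg_pos t.G1.tri.rot.rot)
  have hd := t.hd
  have hgh := t.hgh
  have tg : Tri f g e' := t.G1.tri.of_sub_Alg (Al1_le_left m)
  have th : Tri f h e' := t.G2.tri.of_sub_Alg (Al1_le_left m)
  have a1 : Adj (_root_.Sp f g (e + P)) (_root_.Sp f g e') :=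
    t.G1.tri.adj2 (by rw [add_sub_cancel_left]; exact t.hP) (Al1_le_left m)
  have a2 : Adj (_root_.Sp f h (e + Q)) (_root_.Sp f h e') :=
    t.G2.tri.adj2 (by rw [add_sub_cancel_left]; exact t.hQ) (Al1_le_left m)
  have a3 : Adj (_root_.Sp f g e') (_root_.Sp f h e') := by
    rw [Sp_swap23 f g, Sp_swap23 f h]
    refine tg.swap23.adj ?_
    rw [t.hh, add_sub_cancel_left]
    refine Subalgebra.smul_mem _ ?_ _
    have := sub_mem (right_mem_Alg f e') (Al1_le_left (g := e') m)
    rwa [sub_sub_cancel] at this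
  refine (t.hI.lnk a1).trans ((t.hI.lnk a3).trans (t.hI.lnk a2.symm) ?_) ?_
  · exact lt_of_le_of_lt (θ.Tri_dg_le th) (by linarith)
  · exact lt_of_le_of_lt (θ.Tri_dg_le tg) (by linarith)

lemma TT.T2nc {d : ℝ} {f g h e P Q : P3} {γ : ℂ} (t : θ.TT d f g h e γ P Q) (hP : P ∈ Al1 f) (hlt : θ.deg P < θ.deg e) :
    θ.Lnk d (_root_.Sp f g (e + P)) (_root_.Sp f h (e + Q)) := by
  have hd := t.hd
  have hgh := t.hgh
  have heg := t.heg
  have l2 := add_le_of t.hQd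
  have tX : Tri f g (e + P) := t.G1.tri.of_sub_Alg (by rw [add_sub_cancel_left]; exact t.hP)
  have tY : Tri f h (e + Q) := t.G2.tri.of_sub_Alg (by rw [add_sub_cancel_left]; exact t.hQ)
  constructor
  · intro _ hX
    exfalso
    have e1 : θ.deg (e + P) = θ.deg e := θ.deg_add_eq hlt
    rw [(t.G1.of_deg tX e1).dg, e1] at hX
    linarith
  · intro hY hYd
    have hQlt : θ.deg (e + Q) < θ.deg e := by
      rcases l2.lt_or_eq with h1 | h1
      · exact h1
      · exfalso
        rw [(t.G2.of_deg tY h1).dg, h1] at hYd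
        linarith
    have mP : (h + γ • P) - h ∈ Al1 f := by
      rw [add_sub_cancel_left]; exact Subalgebra.smul_mem _ hP _
    have tM : Tri f (h + γ • P) (e + Q) := (tY.swap23.of_sub_Alg (Al1_le_left mP)).swap23
    have a1 : Adj (_root_.Sp f h (e + Q)) (_root_.Sp f (h + γ • P) (e + Q)) := by
      rw [Sp_swap23 f h, Sp_swap23 f (h + γ • P)]
      exact tY.swap23.adj (Al1_le_left mP)
    have eX : _root_.Sp f g (e + P) = _root_.Sp f (h + γ • P) (e + P) := by
      rw [Sp_swap23 f g, Sp_swap23 f (h + γ • P)]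
      symm
      exact Sp_third (k := 1) one_ne_zero (x := γ • (e + P)) (Submodule.smul_mem _ _ (right_mem_Pl _ _)) (by rw [t.hh]; module)
    have a2 : Adj (_root_.Sp f (h + γ • P) (e + Q)) (_root_.Sp f g (e + P)) := by
      rw [eX]
      refine tM.adj ?_
      have h1 : h ∈ Alg f (h + γ • P) := by
        have := sub_mem (right_mem_Alg f (h + γ • P)) (Al1_le_left (g := h + γ • P) mP)
        rwa [sub_sub_cancel] at this
      have := sub_mem (Al1_le_left (g := h + γ • P) hP) (Alg_le (left_mem_Alg _ _) h1 t.hQ)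
      rwa [show P - Q = e + P - (e + Q) by ring] at this
    have hM : θ.dg (_root_.Sp f (h + γ • P) (e + Q)) < d := by
      refine lt_of_le_of_lt (θ.Tri_dg_le tM) ?_
      have : θ.deg (h + γ • P) ≤ θ.deg h := add_le_of ((θ.deg_smul_le _ _).trans (by linarith))
      linarith
    exact t.hI.N (t.hI.N hY a1 hYd) a2 hM

lemma TT.T2half {d : ℝ} {f g h e P Q : P3} {γ : ℂ} (t : θ.TT d f g h e γ P Q) (hef : θ.deg f < θ.deg e) 
    (hne : ¬ ∃ l : ℕ, θ.deg e = l * θ.deg f) :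
    θ.Lnk d (_root_.Sp f g (e + P)) (_root_.Sp f h (e + Q)) ∨
    ∃ s k φ δ, 3 ≤ s ∧ θ.Canc f g φ 2 s k 0 0 δ ∧ ev f g φ = P ∧ (k = 1 ∨ (k = 2 ∧ s = 3)) ∧ k * ((s - 2) * δ + θ.om f g) ≤ θ.deg e := by
  have hf0 := θ.Tri_deg_pos t.G1.tri
  have hg0 := θ.Tri_deg_pos t.G1.tri.rot
  have he0 := θ.Tri_deg_pos t.G1.tri.rot.rot
  have hPd := t.hPd
  have heg := t.heg
  rcases nc_cn t.G1.tri.Jc_ne t.hP with hn | ⟨φ, p, q, k, i, j, ε, cc, e'⟩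
  · left
    have hj : ∀ i j : ℕ, (i : ℝ) * θ.deg f + j * θ.deg g ≤ θ.deg P → j = 0 := by
      intro i j hij
      have := jlt (n := 1) (by linarith) (by linarith) hij (by push_cast; linarith)
      omega
    refine t.T2nc (hn.al1 hj) (lt_of_le_of_ne hPd ?_)
    intro hh
    obtain ⟨i, j, hij⟩ := hn.2 (θ.ne_zero_of_deg_pos (by linarith))
    obtain rfl := hj i j hij.le
    apply hne
    refine ⟨i, ?_⟩
    push_cast at hij
    linarith
  · rcases cc.cases' t.G1.2.1 with ⟨hq, h'⟩ | ⟨hq, h'⟩ | ⟨h1, h2⟩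
    · exact Or.inl (t.res_gf h')
    · exact Or.inl (t.res_fg h')
    · right
      have hge := cc.ge
      obtain ⟨g1, g2⟩ := cc.ge1 h1 h2
      rw [e'] at g1 g2 hge
      have o := θ.two_le_om t.G1.tri.Jc_ne
      have hε := cc.hε
      have e1 := cc.hf
      have e2 := cc.hg
      have k2 : ((q : ℝ) - 1) * p < 2 * q := by
        have : ((q : ℝ) - 1) * θ.deg f < 2 * θ.deg g := by linarith
        rw [e1, e2] at this
        nlinarith
      rcases ni_small h1 h2 k2 with rfl | ⟨rfl, rfl⟩
      · push_cast at e1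
        have hqo : ¬ 2 ∣ q := by
          intro h
          have := Nat.eq_one_of_dvd_coprimes cc.cop (dvd_refl 2) h
          omega
        have hq3 : 3 ≤ q := by
          rcases Nat.lt_or_ge q 3 with h | h
          · obtain rfl : q = 2 := by omega
            omega
          · exact h
        have hq3' : (3 : ℝ) ≤ q := by exact_mod_cast hq3
        have hk1 : (1 : ℝ) ≤ k := by exact_mod_cast cc.hk
        push_cast at hge
        rw [e1, e2] at hge
        have hge' : (k : ℝ) * ((q - 2) * ε + θ.om f g) + i * (2 * ε) + j * (q * ε) ≤ θ.deg P := by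
          refine le_trans (le_of_eq ?_) hge
          ring
        have p1 : 0 ≤ (i : ℝ) * (2 * ε) := by positivity
        have p2 : 0 ≤ (j : ℝ) * (q * ε) := by positivity
        have p3 : 0 ≤ ((q : ℝ) - 2) * ε := mul_nonneg (by linarith) hε.le
        have p4 : (q - 2) * ε + θ.om f g ≤ (k : ℝ) * ((q - 2) * ε + θ.om f g) := by nlinarith
        have hj : j < 1 := by
          by_contra hc
          push Not at hc
          have : (1 : ℝ) ≤ j := by exact_mod_cast hc
          have : q * ε ≤ j * (q * ε) := by nlinarith
          linarith
        have hi : i < 1 := by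
          by_contra hc
          push Not at hc
          have : (1 : ℝ) ≤ i := by exact_mod_cast hc
          have : 2 * ε ≤ i * (2 * ε) := by nlinarith
          linarith
        obtain rfl : i = 0 := by omega
        obtain rfl : j = 0 := by omega
        refine ⟨q, k, φ, ε, hq3, cc, e', ?_, by linarith⟩
        have hkq : (k : ℝ) * (q - 2) < q := by
          have : (k : ℝ) * ((q - 2) * ε) ≤ (k : ℝ) * ((q - 2) * ε + θ.om f g) := by nlinarith
          have : ((k : ℝ) * (q - 2)) * ε < q * ε := by linarith
          exact lt_of_mul_lt_mul_right this hε.le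
        obtain ⟨r, rfl⟩ : ∃ r, q = r + 2 := ⟨q - 2, by omega⟩
        have hkr : k * r < r + 2 := by
          push_cast at hkq
          rw [add_sub_cancel_right] at hkq
          exact_mod_cast hkq
        have hk0 := cc.hk
        rcases (show k = 1 ∨ 2 ≤ k by omega) with rfl | hk2
        · exact Or.inl rfl
        · right
          have : r < 2 := by nlinarith
          obtain rfl : r = 1 := by omega
          exact ⟨by omega, rfl⟩
      · exfalso
        push_cast at e1 e2; linarith

lemma TT.T2 {d : ℝ} {f g h e P Q : P3} {γ : ℂ} (t : θ.TT d f g h e γ P Q) (hef : θ.deg f < θ.deg e) :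
    θ.Lnk d (_root_.Sp f g (e + P)) (_root_.Sp f h (e + Q)) := by
  by_cases hne : ∃ l : ℕ, θ.deg e = l * θ.deg f
  · obtain ⟨l, hl⟩ := hne
    exact t.T2res hl
  rcases t.T2half hef hne with h1 | ⟨s, k, φ, δ, h1, h2, rfl, h4, h5⟩
  · exact h1
  rcases t.symm.T2half hef hne with h1' | ⟨s', k', ψ, δ', h1', h2', rfl, h4', h5'⟩
  · exact h1'.symm
  exfalso
  have hgh := t.hgh
  have heg := t.heg
  have f1 := h2.hf
  have f2 := h2'.hf
  have f3 := h2.hg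
  have f4 := h2'.hg
  have hδ := h2.hε
  push_cast at f1 f2
  obtain rfl : δ' = δ := by linarith
  obtain rfl : s' = s := by
    have : (s' : ℝ) * δ' = s * δ' := by linarith
    exact_mod_cast mul_right_cancel₀ hδ.ne' this
  have hs : (3 : ℝ) ≤ s' := by exact_mod_cast h1
  have cr := θ.cross t.G1.tri
  have cr' := θ.cross t.G2.tri
  have hw := θ.W0_ge
  have ho := θ.vdeg_nonneg (Jc f g)
  have ho' := θ.vdeg_nonneg (Jc f h)
  change 0 ≤ θ.om f g at ho
  change 0 ≤ θ.om f h at ho'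
  have omx := t.om_fe
  have p3 : 0 ≤ ((s' : ℝ) - 2) * δ' := mul_nonneg (by linarith) hδ.le
  have w1 : θ.om f g ≤ θ.deg e - (s' - 2) * δ' := by
    rcases h4 with rfl | ⟨rfl, -⟩ <;> push_cast at h5 <;> linarith
  have w2 : θ.om f h ≤ θ.deg e - (s' - 2) * δ' := by
    rcases h4' with rfl | ⟨rfl, -⟩ <;> push_cast at h5' <;> linarith
  have w3 : θ.om f e ≤ θ.deg e - (s' - 2) * δ' := omx.trans (max_le w1 w2)
  have hes : (s' - 1) * δ' < θ.deg e := by linarith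
  have hes2 : θ.deg e < s' * δ' := by linarith
  rcases h4 with rfl | ⟨rfl, rfl⟩
  · rcases h4' with rfl | ⟨rfl, rfl⟩
    · exact T2core t.hγ t.hh h1 h2 h2' (Or.inl rfl) t.hPd t.hQd hes hes2
    · refine T2core t.symm.hγ t.symm.hh h1 h2' h2 (Or.inr ⟨rfl, rfl, ?_⟩) t.hQd t.hPd hes hes2
      push_cast at *; linarith
  · rcases h4' with rfl | ⟨rfl, -⟩
    · refine T2core t.hγ t.hh h1 h2 h2' (Or.inr ⟨rfl, rfl, ?_⟩) t.hPd t.hQd hes hes2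
      push_cast at *; linarith
    · have w4 : θ.om f e ≤ (θ.deg e - 2 * δ') / 2 := omx.trans (max_le (by push_cast at *; linarith) (by push_cast at *; linarith))
      push_cast at *; linarith

lemma TT.T {d : ℝ} {f g h e P Q : P3} {γ : ℂ} (t : θ.TT d f g h e γ P Q) :
    θ.Lnk d (_root_.Sp f g (e + P)) (_root_.Sp f h (e + Q)) := by
  rcases lt_or_gt_of_ne t.G1.2.2.1 with h | h
  · exact t.T2 h
  · exact t.T1 h

end Wt


lemma two_planes {a b c a2 b2 c2 : P3} (ht : Tri a b c) (e : Sp a2 b2 c2 = Sp a b c) :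
    Pl a b = Pl a2 b2 ∨ ∃ f g h, Pl f g = Pl a b ∧ Pl f h = Pl a2 b2 ∧ Sp f g h = Sp a b c := by
  rcases plane3 ht e with ⟨s, t, hP⟩ | ⟨s, hP⟩ | hP
  · by_cases h1 : t = 0
    · subst h1
      by_cases h2 : s = 0
      · subst h2
        left; simpa using hP
      · right
        refine ⟨b, a, a + s • c, Pl_comm _ _, ?_, ?_⟩
        · rw [← hP, Pl_comm, zero_smul, add_zero]
        · have : Sp b a (a + s • c) = Sp b a c := Sp_third h2 (left_mem_Pl a b |> fun h => by rw [Pl_comm]; exact h) (by module)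
          rw [this, Sp_swap]
    · right
      refine ⟨a - (s * t⁻¹) • b, b, b + t • c, ?_, ?_, ?_⟩
      · exact Pl_eq (mem_Pl.2 ⟨1, -(s * t⁻¹), 0, by module⟩) (right_mem_Pl _ _) (mem_Pl.2 ⟨1, s * t⁻¹, 0, by module⟩) (right_mem_Pl _ _)
      · rw [← hP]
        have hst : s * t⁻¹ * t = s := by field_simp
        refine Pl_eq (mem_Pl.2 ⟨1, -(s * t⁻¹), 0, ?_⟩) (right_mem_Pl _ _) (mem_Pl.2 ⟨1, s * t⁻¹, 0, ?_⟩) (right_mem_Pl _ _)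
        · rw [smul_add (-(s * t⁻¹)), smul_smul (-(s * t⁻¹)), neg_mul, hst]; module
        · rw [smul_add, smul_smul (s * t⁻¹) t, hst]; module
      · have h3 : Pl (a - (s * t⁻¹) • b) b = Pl a b := 
          Pl_eq (mem_Pl.2 ⟨1, -(s * t⁻¹), 0, by module⟩) (right_mem_Pl _ _) (mem_Pl.2 ⟨1, s * t⁻¹, 0, by module⟩) (right_mem_Pl _ _)
        rw [Sp_congr_Pl h3]
        exact Sp_third h1 (right_mem_Pl a b) (by module)
  · right
    have h3 : Pl (a + s • b) b = Pl a b :=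
      Pl_eq (mem_Pl.2 ⟨1, s, 0, by module⟩) (right_mem_Pl _ _) (mem_Pl.2 ⟨1, -s, 0, by module⟩) (right_mem_Pl _ _)
    exact ⟨a + s • b, b, c, h3, hP, Sp_congr_Pl h3 c⟩
  · right
    exact ⟨b, a, c, Pl_comm _ _, hP, Sp_swap _ _ _⟩

namespace Wt
variable {θ : Wt}

lemma partI' {d : ℝ} (hI : θ.IH d) {f g h h' g' : P3} (ht : Tri f g h) (hfg : θ.deg f ≠ θ.deg g) (hfh : θ.deg f ≠ θ.deg h)
    (hd : θ.dg (Sp f g h) = d) (hh : h' - h ∈ Alg f g) (hg : g' - g ∈ Alg f h) (hR : Red θ (Sp f g h'))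
    (hl : θ.dg (Sp f g h') < d) (hl2 : θ.dg (Sp f h g') ≤ d) : Red θ (Sp f h g') := by
  have hf0 := θ.Tri_deg_pos ht
  have hg0 := θ.Tri_deg_pos ht.rot
  by_cases hgh : θ.deg g = θ.deg h
  · obtain ⟨c, hc, hlt⟩ := θ.exists_cancel hgh hg0
    obtain ⟨e, ⟨s, κ, he⟩, hmin⟩ := θ.exists_min {x | ∃ s κ : ℂ, x = g - c • h - s • f - κ • (1 : P3)} ⟨_, 0, 0, rfl⟩
    have heg : θ.deg e < θ.deg g := lt_of_le_of_lt (hmin (g - c • h) ⟨0, 0, by module⟩) hlt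
    obtain ⟨k, hk⟩ : ∃ k, k = g - e := ⟨_, rfl⟩
    have hkg : θ.deg k = θ.deg g := by rw [hk, θ.deg_sub_eq heg]
    have hkh : k = c • h + s • f + κ • (1 : P3) := by rw [hk, he]; module
    have hPk : Pl f k = Pl f h := Pl_eq (left_mem_Pl _ _) (mem_Pl.2 ⟨s, c, κ, by rw [hkh]; module⟩) (left_mem_Pl _ _)
      (mem_Pl.2 ⟨-(c⁻¹ * s), c⁻¹, -(c⁻¹ * κ), by rw [hkh, smul_add, smul_add, smul_smul, inv_mul_cancel₀ hc]; module⟩)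
    have hS1 : Sp f g e = Sp f g h := Sp_third (k := -c) (x := g - s • f - κ • (1 : P3)) (neg_ne_zero.2 hc) (mem_Pl.2 ⟨-s, 1, -κ, by module⟩) (by rw [he]; module)
    have te : Tri f g e := ht.of_Sp hS1
    have he0 := θ.Tri_deg_pos te.rot.rot
    have hef : θ.deg f ≠ θ.deg e := by
      intro hfe
      obtain ⟨c', hc', hlt'⟩ := θ.exists_cancel hfe.symm he0
      have := hmin (e - c' • f) ⟨s + c', κ, by rw [he]; module⟩
      linarith
    have hS2 : Sp f k e = Sp f g e := by
      rw [Sp_swap23 f k, Sp_swap23 f g]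
      exact Sp_third one_ne_zero (x := -e) (mem_Pl.2 ⟨0, -1, 0, by module⟩) (by rw [hk]; module)
    have G1 : θ.Good f g e := ⟨te, hfg, hef, heg.ne'⟩
    have G2 : θ.Good f k e := ⟨te.of_Sp hS2, by rw [hkg]; exact hfg, hef, by rw [hkg]; exact heg.ne'⟩
    obtain ⟨e1, r1, r2, r3⟩ := θ.rebase_good ht hh (f := f) (g := g) (h := e) rfl hS1 hfg
    obtain ⟨e2, q1, q2, q3⟩ := θ.rebase_good ht.swap23 hg (f := f) (g := k) (h := e) hPk (hS2.trans (hS1.trans (Sp_swap23 _ _ _))) G2.2.1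
    have hd' : θ.deg f + θ.deg g + θ.deg e = d := by rw [← hd, ← hS1, G1.dg]
    rw [← r2] at hR hl
    rw [← q2] at hl2 ⊢
    have l1 := hl
    have l2 := hl2
    rw [r3.dg] at l1
    rw [q3.dg] at l2
    have t : θ.TT d f g k e (-1) (e1 - e) (e2 - e) := 
      ⟨hI, G1, G2, by simp, by rw [hk]; module, hkg, heg, hd', r1, q1, deg_sub_le_of (by linarith) le_rfl, deg_sub_le_of (by linarith) le_rfl⟩
    have := t.T
    rw [add_sub_cancel, add_sub_cancel] at this
    exact this.1 hR hl
  · have G : θ.Good f g h := ⟨ht, hfg, hfh, hgh⟩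
    have hd' : θ.deg f + θ.deg g + θ.deg h = d := by rw [← hd, G.dg]
    obtain ⟨h1, r1, r2, r3⟩ := θ.rebase_good ht hh (f := f) (g := g) (h := h) rfl rfl hfg
    obtain ⟨g1, q1, q2, q3⟩ := θ.rebase_good ht.swap23 hg (f := f) (g := h) (h := g) rfl rfl hfh
    rw [← r2] at hR hl
    rw [← q2] at hl2 ⊢
    have l1 := hl
    have l2 := hl2
    rw [r3.dg] at l1
    rw [q3.dg] at l2
    have b1 : θ.deg (h1 - h) ≤ θ.deg h := deg_sub_le_of (by linarith) le_rfl
    have b2 : θ.deg (g1 - g) ≤ θ.deg g := deg_sub_le_of (by linarith) le_rfl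
    rcases lt_or_gt_of_ne hgh with h3 | h3
    · have := caseS hI G.swap23 q1 r1 b2 b1 h3 (by linarith)
      rw [add_sub_cancel, add_sub_cancel, Sp_swap23 f h1 g] at this
      exact this.2 hR hl
    · have := caseS hI G r1 q1 b1 b2 h3 hd'
      rw [add_sub_cancel, add_sub_cancel, Sp_swap23 f g1 h] at this
      exact this.1 hR hl

lemma partI {d : ℝ} (hI : θ.IH d) {V U W : Submodule ℂ P3} (hd : θ.dg V = d) (hVU : Adj V U) (hR : Red θ U) (hU : θ.dg U < d)
    (hVW : Adj V W) (hW : θ.dg W ≤ d) : Red θ W := by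
  obtain ⟨a, b, c, c', ht, hc, e1, rfl⟩ := hVU
  obtain ⟨a2, b2, c2, c2', ht2, hc2, e2, rfl⟩ := hVW
  rcases two_planes ht (e2.symm.trans e1) with hP | ⟨f, g, h, p1, p2, p3⟩
  · obtain ⟨h', r1, r2⟩ := rebase ht2 hc2 hP (e1.symm.trans e2)
    rw [← r2]
    exact hI.N hR (ht.adj2 hc r1) hU
  · have t0 := ht.of_Sp p3
    obtain ⟨g1, s1, s2⟩ := θ.exists_good_pair t0
    obtain ⟨h1, s3, s4⟩ := θ.exists_good_pair t0.swap23
    have S : Sp f g1 h1 = Sp a b c := by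
      rw [Sp_congr_Pl s1, Sp_swap23, Sp_congr_Pl s3, Sp_swap23, p3]
    have t1 := ht.of_Sp S
    obtain ⟨h', r1, r2⟩ := rebase ht hc (s1.trans p1) S
    obtain ⟨g', q1, q2⟩ := rebase ht2 hc2 (s3.trans p2) (f := f) (g := h1) (h := g1) (by rw [Sp_swap23, S, ← e1, e2])
    rw [← r2] at hR hU
    rw [← q2] at hW ⊢
    exact partI' hI t1 s2 s4 (by rw [S, ← e1, hd]) r1 q1 hR hU hW

lemma dg_mem {V : Submodule ℂ P3} {a b c : P3} (hV : V = Sp a b c) (ht : Tri a b c) : θ.dg V ∈ Set.range θ.W := by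
  obtain ⟨b', h1, h2⟩ := θ.exists_good_pair ht
  have S : Sp a b' c = Sp a b c := Sp_congr_Pl h1 c
  obtain ⟨c', r1, r2, r3, -⟩ := θ.exists_good_third (ht.of_Sp S) h2
  rw [hV, ← S, ← r3, r2.dg]
  obtain ⟨u, hu⟩ := θ.deg_mem_range a
  obtain ⟨v, hv⟩ := θ.deg_mem_range b'
  obtain ⟨w, hw⟩ := θ.deg_mem_range c'
  exact ⟨u + v + w, by rw [θ.W_add, θ.W_add, hu, hv, hw]⟩

theorem stab (d : ℝ) (hd : d ∈ Set.range θ.W) : ∀ V V', Red θ V → Adj V V' → θ.dg V = d → θ.dg V' ≤ θ.dg V → Red θ V' := by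
  refine Set.WellFoundedOn.induction (r := (· < ·)) (s := Set.range θ.W) θ.isWF hd (P := fun d => ∀ V V', Red θ V → Adj V V' → θ.dg V = d → θ.dg V' ≤ θ.dg V → Red θ V') ?_
  intro d _ ih
  have hI : θ.IH d := by
    intro V V' hR ha hlt hle
    obtain ⟨a, b, c, e, t⟩ := hR.tri
    exact ih (θ.dg V) (dg_mem e t) hlt V V' hR ha rfl hle
  intro V V' hR ha hVd hle
  cases hR with
  | base _ a b c hV ht h =>
    obtain ⟨x, y, z, e, t⟩ := ha.symm.tri
    exact Red.base _ x y z e t (lt_of_le_of_lt hle h)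
  | elem _ U hVU hd' hr => exact partI hI hVd hVU hr (by rw [← hVd]; exact hd') ha (by rw [← hVd]; exact hle)
  | kred _ A B C C1 δ k hg hA hB hC hm hlt hom hk hV hr => exact partII hg hA hB hC hm hlt hom hk hV hr ha hle

theorem Red.adj {V V' : Submodule ℂ P3} (hR : Red θ V) (ha : Adj V V') : Red θ V' := by
  obtain ⟨a, b, c, e, t⟩ := hR.tri
  rcases le_or_gt (θ.dg V') (θ.dg V) with h | h
  · exact stab _ (dg_mem e t) V V' hR ha rfl h
  · exact Red.elem _ _ ha.symm h hR

end Wt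


lemma mem_lin {f : P3} (hf : f.totalDegree ≤ 1) : f ∈ Sp (X 0) (X 1) (X 2) := by
  rw [f.as_sum]
  refine Submodule.sum_mem _ fun m hm => ?_
  have h1 : m.sum (fun _ e => e) ≤ 1 := (le_totalDegree hm).trans hf
  rw [Finsupp.sum_fintype _ _ (by simp), Fin.sum_univ_three] at h1
  have key : ∀ i, m = Finsupp.single i 1 → monomial m (coeff m f) = coeff m f • (X i : P3) := by
    intro i hi
    rw [X, smul_monomial, smul_eq_mul, mul_one, ← hi]
  have h2 : (m 0 = 0 ∧ m 1 = 0 ∧ m 2 = 0) ∨ (m 0 = 1 ∧ m 1 = 0 ∧ m 2 = 0) ∨ (m 0 = 0 ∧ m 1 = 1 ∧ m 2 = 0) ∨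
      (m 0 = 0 ∧ m 1 = 0 ∧ m 2 = 1) := by omega
  rcases h2 with ⟨h, h', h''⟩ | ⟨h, h', h''⟩ | ⟨h, h', h''⟩ | ⟨h, h', h''⟩
  · have : m = 0 := by ext i; fin_cases i <;> simp [h, h', h'']
    rw [this]
    have e : monomial 0 (coeff 0 f) = coeff 0 f • (1 : P3) := by
      rw [← C_apply, ← mul_one (C (coeff 0 f)), C_mul']
    rw [e]; exact Submodule.smul_mem _ _ (one_mem_Sp _ _ _)
  · rw [key 0 (by ext i; fin_cases i <;> simp [h, h', h''])]
    exact Submodule.smul_mem _ _ (mem_Sp1 _ _ _)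
  · rw [key 1 (by ext i; fin_cases i <;> simp [h, h', h''])]
    exact Submodule.smul_mem _ _ (mem_Sp2 _ _ _)
  · rw [key 2 (by ext i; fin_cases i <;> simp [h, h', h''])]
    exact Submodule.smul_mem _ _ (mem_Sp3 _ _ _)

lemma map_Sp (F : P3 ≃ₐ[ℂ] P3) (a b c : P3) : (Sp a b c).map F.toLinearMap = Sp (F a) (F b) (F c) := by
  rw [Sp, Submodule.map_span, Sp]
  congr 1
  ext x
  simp [Set.image_insert_eq]

lemma aff_Sp (G : P3 ≃ₐ[ℂ] P3) (hG : ∀ i, (G (X i)).totalDegree ≤ 1) :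
    Sp (G (X 0)) (G (X 1)) (G (X 2)) = Sp (X 0) (X 1) (X 2) := by
  rw [← map_Sp]
  have hfin : FiniteDimensional ℂ (Sp (X 0) (X 1) (X 2)) := FiniteDimensional.span_of_finite ℂ (Set.toFinite _)
  apply Submodule.eq_of_le_of_finrank_eq
  · rw [map_Sp]
    exact Sp_le (one_mem_Sp _ _ _) (mem_lin (hG 0)) (mem_lin (hG 1)) (mem_lin (hG 2))
  · exact LinearEquiv.finrank_map_eq G.toLinearEquiv _

lemma elem_mem (F : P3 ≃ₐ[ℂ] P3) (S : Subalgebra ℂ P3) (i : Fin 3) (p : P3) (hp : degreeOf i p = 0)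
    (h : ∀ j, j ≠ i → F (X j) ∈ S) : F p ∈ S := by
  have h1 : p ∈ supported ℂ ({i}ᶜ : Set (Fin 3)) := by
    rw [mem_supported]
    intro j hj
    rw [Finset.mem_coe, mem_vars_iff_degreeOf_ne_zero] at hj
    rintro rfl
    exact hj hp
  have h2 : supported ℂ ({i}ᶜ : Set (Fin 3)) ≤ S.comap (F : P3 →ₐ[ℂ] P3) := by
    rw [supported_eq_adjoin_X, Algebra.adjoin_le_iff]
    rintro _ ⟨j, hj, rfl⟩
    exact h j hj
  exact h2 h1

namespace Wt
variable {θ : Wt}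

/-- The invariant propagated along tame compositions. -/
def TR (θ : Wt) (a b c : P3) : Prop := Tri a b c ∧ Red θ (Sp a b c)

lemma TR.rot {a b c : P3} (h : θ.TR a b c) : θ.TR b c a := ⟨h.1.rot, Sp_rot a b c ▸ h.2⟩
lemma TR.swap {a b c : P3} (h : θ.TR a b c) : θ.TR b a c := ⟨h.1.swap, Sp_swap a b c ▸ h.2⟩

lemma TR.step {a b c c' : P3} (h : θ.TR a b c) (hc : c' - c ∈ Alg a b) : θ.TR a b c' :=
  ⟨h.1.of_sub_Alg hc, h.2.adj (h.1.adj hc)⟩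

lemma TR.of_Sp {a b c x y z : P3} (h : θ.TR a b c) (e : Sp x y z = Sp a b c) : θ.TR x y z :=
  ⟨h.1.of_Sp e, e ▸ h.2⟩

lemma TR.one : θ.TR (X 0) (X 1) (X 2) := by
  have ht : Tri (X 0) (X 1) (X 2) := by
    refine ⟨1, one_ne_zero, ?_⟩
    simp [Det, Jc_zero, Jc_one, Jc_two, lD_apply, pderiv_X]
  refine ⟨ht, Red.base _ _ _ _ rfl ht (lt_of_le_of_lt (θ.Tri_dg_le ht) ?_)⟩
  rw [θ.deg_X, θ.deg_X, θ.deg_X]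
  have := θ.W0_le
  unfold W0 at this; linarith

lemma TR.elem_iff (F G : P3 ≃ₐ[ℂ] P3) (i : Fin 3) (p : P3) (hp : degreeOf i p = 0) (hi : G (X i) = X i + p)
    (hj : ∀ j, j ≠ i → G (X j) = X j) :
    θ.TR (F (X 0)) (F (X 1)) (F (X 2)) ↔ θ.TR ((F * G) (X 0)) ((F * G) (X 1)) ((F * G) (X 2)) := by
  have e1 : (F * G) (X i) = F (X i) + F p := by rw [AlgEquiv.mul_apply, hi, map_add]
  have e2 : ∀ j, j ≠ i → (F * G) (X j) = F (X j) := fun j h => by rw [AlgEquiv.mul_apply, hj j h]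
  have fin : ∀ {a b c c' x : P3}, c' = c + x → x ∈ Alg a b → (θ.TR a b c ↔ θ.TR a b c') := by
    rintro a b c c' x rfl hx
    refine ⟨fun h => h.step (by rwa [add_sub_cancel_left]), fun h => h.step ?_⟩
    rw [sub_add_cancel_left]; exact neg_mem hx
  have ml : ∀ a b : P3, a ∈ Alg a b := fun a b => Algebra.subset_adjoin (by simp)
  have mr : ∀ a b : P3, b ∈ Alg a b := fun a b => Algebra.subset_adjoin (by simp)
  fin_cases i
  · have m : F p ∈ Alg (F (X 1)) (F (X 2)) := by
      refine elem_mem F _ 0 p hp fun j h => ?_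
      fin_cases j
      · exact absurd rfl h
      · exact ml _ _
      · exact mr _ _
    rw [e2 1 (by simp), e2 2 (by simp)]
    have := fin e1 m
    exact ⟨fun h => (this.1 h.rot).rot.rot, fun h => (this.2 h.rot).rot.rot⟩
  · have m : F p ∈ Alg (F (X 2)) (F (X 0)) := by
      refine elem_mem F _ 1 p hp fun j h => ?_
      fin_cases j
      · exact mr _ _
      · exact absurd rfl h
      · exact ml _ _
    rw [e2 0 (by simp), e2 2 (by simp)]
    have := fin e1 m
    exact ⟨fun h => (this.1 h.rot.rot).rot, fun h => (this.2 h.rot.rot).rot⟩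
  · have m : F p ∈ Alg (F (X 0)) (F (X 1)) := by
      refine elem_mem F _ 2 p hp fun j h => ?_
      fin_cases j
      · exact ml _ _
      · exact mr _ _
      · exact absurd rfl h
    rw [e2 0 (by simp), e2 1 (by simp)]
    exact fin e1 m

lemma TR.aff_iff (F G : P3 ≃ₐ[ℂ] P3) (hG : ∀ i, (G (X i)).totalDegree ≤ 1) :
    θ.TR (F (X 0)) (F (X 1)) (F (X 2)) ↔ θ.TR ((F * G) (X 0)) ((F * G) (X 1)) ((F * G) (X 2)) := by
  have e : Sp ((F * G) (X 0)) ((F * G) (X 1)) ((F * G) (X 2)) = Sp (F (X 0)) (F (X 1)) (F (X 2)) := by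
    simp only [AlgEquiv.mul_apply]
    rw [← map_Sp, aff_Sp G hG, map_Sp]
  exact ⟨fun h => h.of_Sp e, fun h => h.of_Sp e.symm⟩

end Wt


lemma sqrt23 {a b c : ℤ} (h : (b : ℝ) * √2 + c * √3 = a) : b = 0 ∧ c = 0 := by
  have i2 : Irrational (√2) := by
    refine (irrational_sqrt_ofNat_iff (n := 2)).2 ?_
    rintro ⟨r, hr⟩
    change 2 = r * r at hr
    have : r < 3 := by nlinarith
    interval_cases r <;> omega
  have i3 : Irrational (√3) := by
    refine (irrational_sqrt_ofNat_iff (n := 3)).2 ?_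
    rintro ⟨r, hr⟩
    change 3 = r * r at hr
    have : r < 3 := by nlinarith
    interval_cases r <;> omega
  have i6 : Irrational (√6) := by
    refine (irrational_sqrt_ofNat_iff (n := 6)).2 ?_
    rintro ⟨r, hr⟩
    change 6 = r * r at hr
    have : r < 3 := by nlinarith
    interval_cases r <;> omega
  have s2 : √2 * √2 = 2 := Real.mul_self_sqrt (by norm_num)
  have s3 : √3 * √3 = 3 := Real.mul_self_sqrt (by norm_num)
  have s6 : √2 * √3 = √6 := by rw [← Real.sqrt_mul (by norm_num)]; norm_num
  have key : ∀ (s : ℝ), Irrational s → ∀ u v : ℤ, (u : ℝ) * s = v → u = 0 := by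
    intro s hs u v huv
    by_contra hu
    refine hs ⟨(v : ℚ) / u, ?_⟩
    have : (u : ℝ) ≠ 0 := by exact_mod_cast hu
    push_cast
    rw [div_eq_iff this]; linarith
  have hbc : 2 * b * c = 0 := by
    apply key _ i6 _ (a ^ 2 - 2 * b ^ 2 - 3 * c ^ 2)
    push_cast
    rw [← h, ← s6]
    linear_combination (b : ℝ) ^ 2 * -s2 - (c : ℝ) ^ 2 * s3
  rcases mul_eq_zero.1 hbc with hb | hc
  · have hb : b = 0 := by omega
    refine ⟨hb, key _ i3 _ a ?_⟩
    rw [← h, hb]; simp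
  · refine ⟨key _ i2 _ a ?_, hc⟩
    rw [← h, hc]; simp

namespace Wt

lemma exists_wt (N : ℕ) (hN : 20 ≤ N) : ∃ θ : Wt, ∀ i, θ.w i ≤ 1 + 2 / N := by
  have hN' : (20 : ℝ) ≤ N := by exact_mod_cast hN
  have hN0 : (0 : ℝ) < N := by linarith
  have s2 : √2 ≤ 2 := by rw [Real.sqrt_le_left (by norm_num)]; norm_num
  have s3 : √3 ≤ 2 := by rw [Real.sqrt_le_left (by norm_num)]; norm_num
  have p2 : 0 ≤ √2 := Real.sqrt_nonneg _
  have p3 : 0 ≤ √3 := Real.sqrt_nonneg _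
  have hle : ∀ i : Fin 3, (![1, 1 + √2 / N, 1 + √3 / N] : Fin 3 → ℝ) i ≤ 1 + 2 / N := by
    intro i
    fin_cases i
    · simp only [Fin.zero_eta, Matrix.cons_val_zero, le_add_iff_nonneg_right]; positivity
    · simp; gcongr
    · simp; gcongr
  have h20 : (2 : ℝ) / N ≤ 1 / 10 := by
    rw [div_le_div_iff₀ hN0 (by norm_num)]; linarith
  refine ⟨⟨![1, 1 + √2 / N, 1 + √3 / N], ?_, fun i => (hle i).trans (by linarith), ?_⟩, hle⟩
  · intro i
    fin_cases i
    · simp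
    · simp; positivity
    · simp; positivity
  · intro m n h
    simp [Fin.sum_univ_three] at h
    have h1 := sqrt23 (b := m 1 - n 1) (c := m 2 - n 2) (a := N * (n 0 + n 1 + n 2 - m 0 - m 1 - m 2)) (by
      push_cast
      field_simp at h
      linarith)
    have e1 : m 1 = n 1 := by omega
    have e2 : m 2 = n 2 := by omega
    rw [e1, e2] at h
    have e0 : m 0 = n 0 := by
      have : (m 0 : ℝ) = n 0 := by linarith
      exact_mod_cast this
    ext i; fin_cases i <;> assumption

/-- The size of a monomial. -/
def sz (u : Fin 3 →₀ ℕ) : ℕ := u 0 + u 1 + u 2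

lemma exists_lead' (θ : Wt) (n D : ℕ) (hn : n ≤ D) (h1 : 1 ≤ n) (hw : ∀ i, θ.w i ≤ 1 + 1 / (100 * D)) (x : P3)
    (hx : x.totalDegree = n) : ∃ u, sz u = n ∧ θ.deg x = θ.W u ∧ (n : ℝ) ≤ θ.deg x ∧ θ.deg x ≤ n + 1 / 100 := by
  have hx0 : x ≠ 0 := by
    rintro rfl; simp at hx; omega
  have hD : (0 : ℝ) < D := by exact_mod_cast (by omega : 0 < D)
  have hnD : (n : ℝ) ≤ D := by exact_mod_cast hn
  have hs : ∀ m ∈ x.support, sz m ≤ n := by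
    intro m hm
    have := le_totalDegree hm
    rw [Finsupp.sum_fintype _ _ (by simp), Fin.sum_univ_three] at this
    rw [← hx]; exact this
  have hlo : ∀ m, (sz m : ℝ) ≤ θ.W m := by
    intro m
    simp only [W, sz, Fin.sum_univ_three]
    push_cast
    have a0 := mul_le_mul_of_nonneg_left (θ.one_le 0) (Nat.cast_nonneg (α := ℝ) (m 0))
    have a1 := mul_le_mul_of_nonneg_left (θ.one_le 1) (Nat.cast_nonneg (α := ℝ) (m 1))
    have a2 := mul_le_mul_of_nonneg_left (θ.one_le 2) (Nat.cast_nonneg (α := ℝ) (m 2))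
    linarith
  have hup : ∀ m, θ.W m ≤ sz m * (1 + 1 / (100 * D)) := by
    intro m
    simp only [W, sz, Fin.sum_univ_three]
    push_cast
    have a0 := mul_le_mul_of_nonneg_left (hw 0) (Nat.cast_nonneg (α := ℝ) (m 0))
    have a1 := mul_le_mul_of_nonneg_left (hw 1) (Nat.cast_nonneg (α := ℝ) (m 1))
    have a2 := mul_le_mul_of_nonneg_left (hw 2) (Nat.cast_nonneg (α := ℝ) (m 2))
    linarith
  have hup' : ∀ m, sz m ≤ D → θ.W m ≤ sz m + 1 / 100 := by
    intro m hm
    refine (hup m).trans ?_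
    have : (sz m : ℝ) ≤ D := by exact_mod_cast hm
    have h3 : (sz m : ℝ) * (1 / (100 * D)) ≤ D * (1 / (100 * D)) :=
      mul_le_mul_of_nonneg_right this (by positivity)
    have h4 : (D : ℝ) * (1 / (100 * D)) = 1 / 100 := by field_simp
    rw [mul_add, mul_one]; linarith
  obtain ⟨m, hm, hmax⟩ : ∃ m ∈ x.support, x.totalDegree = m.sum fun _ e => e := by
    have hne : x.support.Nonempty := by
      rwa [Finset.nonempty_iff_ne_empty, Ne, MvPolynomial.support_eq_empty]
    exact Finset.exists_mem_eq_sup _ hne _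
  rw [Finsupp.sum_fintype _ _ (by simp), Fin.sum_univ_three, hx] at hmax
  have hge : (n : ℝ) ≤ θ.deg x := by
    have h5 : ((sz m : ℕ) : ℝ) = n := by exact_mod_cast hmax.symm
    rw [← h5]
    exact (hlo m).trans (θ.le_deg hm)
  obtain ⟨u, hu, hue⟩ := θ.exists_lead hx0
  have hun := hs u hu
  have hle := hup' u (hun.trans hn)
  have h6 : sz u = n := by
    refine le_antisymm hun ?_
    have : (n : ℝ) < sz u + 1 := by linarith
    have : n < sz u + 1 := by exact_mod_cast this
    omega
  refine ⟨u, h6, hue.symm, hge, ?_⟩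
  rw [← hue, ← h6]; exact hle

lemma W_smul (θ : Wt) (i : ℕ) (u : Fin 3 →₀ ℕ) : θ.W (i • u) = i * θ.W u := by
  simp [W, Fin.sum_univ_three]; ring

lemma rel (θ : Wt) {i j k : ℕ} {u v w : Fin 3 →₀ ℕ} (h : (i : ℝ) * θ.W u + j * θ.W v = k * θ.W w) :
    i * sz u + j * sz v = k * sz w := by
  rw [← W_smul, ← W_smul, ← W_smul, ← W_add] at h
  have := θ.W_inj h
  have h0 := DFunLike.congr_fun this 0
  have h1 := DFunLike.congr_fun this 1
  have h2 := DFunLike.congr_fun this 2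
  simp at h0 h1 h2
  simp only [sz]
  linarith

end Wt


namespace Wt
variable {θ : Wt}

/-- `x` has a leading monomial of size `n`, and weighted degree close to `n`. -/
def Ld (θ : Wt) (n : ℕ) (x : P3) : Prop :=
  ∃ u, sz u = n ∧ θ.deg x = θ.W u ∧ (n : ℝ) ≤ θ.deg x ∧ θ.deg x ≤ n + 1 / 100

lemma Ld.congr {n : ℕ} {x y : P3} (h : θ.Ld n x) (e : θ.deg y = θ.deg x) : θ.Ld n y := by
  unfold Ld; rw [e]; exact h

lemma core {n m k : ℕ} {f g x : P3} (hk : 1 ≤ k) (lf : θ.Ld n f) (lg : θ.Ld m g) (lx : θ.Ld k x) (hJ : Jc f g ≠ 0)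
    (hne : θ.deg f ≠ θ.deg g) (hx : x ∈ Alg f g) :
    (∃ i j : ℕ, i * n + j * m = k) ∨ (∃ q : ℕ, 2 ≤ q ∧ m = q * n) ∨ (∃ p : ℕ, 2 ≤ p ∧ n = p * m) ∨
    (∃ p q : ℕ, 2 ≤ p ∧ 2 ≤ q ∧ q * n = p * m ∧ q * n + 2 ≤ k + m + n) := by
  obtain ⟨u, eu, du, ul, uu⟩ := lf
  obtain ⟨v, ev', dv, vl, vu⟩ := lg
  obtain ⟨w, ew, dw, wl, wu⟩ := lx
  have hk1 : (1 : ℝ) ≤ k := by exact_mod_cast hk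
  have hx0 : x ≠ 0 := θ.ne_zero_of_deg_pos (by linarith)
  rcases θ.nc_cn hJ hx with hN | ⟨φ, p, q, l, i, j, ε, cc, e⟩
  · left
    obtain ⟨i, j, hij⟩ := hN.2 hx0
    refine ⟨i, j, ?_⟩
    have := θ.rel (i := i) (j := j) (k := 1) (u := u) (v := v) (w := w) (by rw [← du, ← dv, ← dw, hij]; simp)
    rw [eu, ev', ew, one_mul] at this; exact this
  · right
    rcases cc.cases' hne with ⟨hq, h⟩ | ⟨hp, h⟩ | ⟨hp, hq⟩
    · left
      refine ⟨q, hq, ?_⟩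
      have := θ.rel (i := q) (j := 0) (k := 1) (u := u) (v := v) (w := v) (by rw [← du, ← dv, h]; simp)
      rw [eu, ev'] at this; omega
    · right; left
      refine ⟨p, hp, ?_⟩
      have := θ.rel (i := p) (j := 0) (k := 1) (u := v) (v := v) (w := u) (by rw [← du, ← dv, h]; simp)
      rw [eu, ev'] at this; omega
    · right; right
      refine ⟨p, q, hp, hq, ?_, ?_⟩
      · have := θ.rel (i := q) (j := 0) (k := p) (u := u) (v := v) (w := v) (by
          rw [← du, ← dv, cc.hf, cc.hg]; simp; ring)
        rw [eu, ev'] at this; omega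
      · have h1 := (cc.ge1 hp hq).1
        have h2 := θ.two_le_om hJ
        rw [e] at h1
        have hq' : (2 : ℝ) ≤ q := by exact_mod_cast hq
        have h3 : ((q : ℝ) - 1) * n ≤ (q - 1) * θ.deg f := mul_le_mul_of_nonneg_left ul (by linarith)
        have h4 : (q : ℝ) * n + 2 < k + m + n + 1 := by linarith
        have h5 : q * n + 2 < k + m + n + 1 := by exact_mod_cast h4
        omega

lemma final {d2 d3 : ℕ} (h2 : 3 ≤ d2) (h23 : d2 ≤ d3)
    (hdvd : ¬ 3 ∣ d2) (hmem : ¬ ∃ a b : ℕ, d3 = 3 * a + b * d2) {x y z : P3} (lx : θ.Ld d3 x) (ly : θ.Ld d2 y)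
    (lz : θ.Ld 3 z) (hT : Tri x y z) (hR : Red θ (Sp x y z)) : False := by
  have hd3 : d2 < d3 := by
    refine lt_of_le_of_ne h23 fun h => hmem ⟨0, 1, by omega⟩
  have hd2 : 4 ≤ d2 := by omega
  have hd3' : ¬ 3 ∣ d3 := fun ⟨a, ha⟩ => hmem ⟨a, 0, by omega⟩
  have hd3'' : ¬ ∃ a, d3 = 3 * a + d2 := fun ⟨a, ha⟩ => hmem ⟨a, 1, by omega⟩
  have hd3''' : ¬ ∃ a, d3 = 3 * a + 2 * d2 := fun ⟨a, ha⟩ => hmem ⟨a, 2, by omega⟩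
  have q3 : ∀ {q n p : ℕ}, ¬ 3 ∣ n → 2 ≤ q → q * n = p * 3 → 3 ≤ q := by
    intro q n p hn hq h
    have h1 : 3 ∣ q * n := ⟨p, by omega⟩
    rcases (Nat.Prime.dvd_mul Nat.prime_three).1 h1 with h1 | h1
    · exact Nat.le_of_dvd (by omega) h1
    · exact absurd h1 hn
  obtain ⟨-, -, -, xl, xu⟩ := id lx
  obtain ⟨-, -, -, yl, yu⟩ := id ly
  obtain ⟨-, -, -, zl, zu⟩ := id lz
  have c1 : (4 : ℝ) ≤ d2 := by exact_mod_cast hd2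
  have c2 : (d2 : ℝ) + 1 ≤ d3 := by exact_mod_cast hd3
  push_cast at zl zu
  have hzy : θ.deg z < θ.deg y := by linarith
  have hyx : θ.deg y < θ.deg x := by linarith
  have hg : θ.Good x y z := ⟨hT, hyx.ne', (hzy.trans hyx).ne', hzy.ne'⟩
  generalize hV : Sp x y z = V at hR
  cases hR with
  | base _ a b c e ht h =>
    rw [← hV, hg.dg] at h; linarith
  | kred _ A B C C' δ k hg' hA hB hC hm hlt hom hk e hr =>
    obtain ⟨f1, f2, f3, -, -, -, f4, f5, f6⟩ := kfacts hg' hA hB hC hm hlt hom hk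
    have hG : θ.Good (A + k • C ^ 2) B C := ⟨f6, ne_of_gt (by linarith), ne_of_gt (by linarith), ne_of_gt (by linarith)⟩
    have hz : z ∈ Sp (A + k • C ^ 2) B C := by rw [← e, ← hV]; exact mem_Sp3 _ _ _
    rcases hG.deg_mem hz with h | h | h | h <;> linarith
  | elem _ V1 ha hd hr =>
    subst hV
    rcases Adj.norm hg hzy hyx ha with ⟨s, t, h', G, dx, dy, hm, -, -, -, dd⟩ | ⟨s, h', G, dx, hm, -, -, -, dd⟩ | ⟨h', hm, -, -, dd⟩
    · have dl : θ.deg h' < θ.deg z := by linarith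
      have lh : θ.Ld 3 (h' - z) := lz.congr (deg_sub_eq_of dl)
      rcases core (by norm_num) (lx.congr dx) (ly.congr dy) lh G.tri.Jc_ne G.2.1 hm with
        ⟨i, j, h⟩ | ⟨q, hq, h⟩ | ⟨p, hp, h⟩ | ⟨p, q, hp, hq, h, h'⟩
      · rcases Nat.eq_zero_or_pos i with rfl | hi
        · rcases Nat.eq_zero_or_pos j with rfl | hj
          · omega
          · nlinarith
        · nlinarith
      · nlinarith
      · exact hmem ⟨0, p, by omega⟩
      · have : q < 3 := by
          by_contra hc
          have : 3 ≤ q := by omega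
          nlinarith
        have hq2 : q = 2 := by omega
        subst hq2
        have e3 : d3 = d2 + 1 := by omega
        subst e3
        rcases Nat.lt_or_ge p 3 with hp3 | hp3
        · have : p = 2 := by omega
          subst this; omega
        · nlinarith
    · have dl : θ.deg h' < θ.deg y := by linarith
      have lh : θ.Ld d2 (h' - y) := ly.congr (deg_sub_eq_of dl)
      rcases core (by omega) (lx.congr dx) lz lh G.tri.Jc_ne G.2.1 hm with
        ⟨i, j, h⟩ | ⟨q, hq, h⟩ | ⟨p, hp, h⟩ | ⟨p, q, hp, hq, h, h'⟩
      · rcases Nat.eq_zero_or_pos i with rfl | hi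
        · omega
        · nlinarith
      · nlinarith
      · exact hd3' ⟨p, by omega⟩
      · have := q3 hd3' hq h
        nlinarith
    · have dl : θ.deg h' < θ.deg x := by linarith
      have lh : θ.Ld d3 (h' - x) := lx.congr (deg_sub_eq_of dl)
      rcases core (by omega) ly lz lh hT.rot.Jc_ne hzy.ne' hm with
        ⟨i, j, h⟩ | ⟨q, hq, h⟩ | ⟨p, hp, h⟩ | ⟨p, q, hp, hq, h, h'⟩
      · exact hmem ⟨j, i, by omega⟩
      · nlinarith
      · exact hdvd ⟨p, by omega⟩
      · have := q3 hdvd hq h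
        have h5 : 2 * d2 ≤ d3 + 1 := by nlinarith
        have a1 : (d3 - d2) % 3 ≠ 0 := fun h0 => hd3'' ⟨(d3 - d2) / 3, by omega⟩
        have a2 : 2 * d2 ≤ d3 → (d3 - 2 * d2) % 3 ≠ 0 := fun h00 h0 => hd3''' ⟨(d3 - 2 * d2) / 3, by omega⟩
        rcases Nat.lt_or_ge d3 (2 * d2) with h6 | h6
        · have h7 : d3 = 2 * d2 - 1 := by omega
          have h8 : d2 % 3 = 1 ∨ d2 % 3 = 2 := by omega
          rcases h8 with h8 | h8
          · apply a1; omega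
          · apply hd3'; omega
        · have h7 := a2 h6
          obtain ⟨t, rfl⟩ := Nat.exists_eq_add_of_le h6
          rw [show 2 * d2 + t - 2 * d2 = t by omega] at h7
          rw [show 2 * d2 + t - d2 = d2 + t by omega] at a1
          have h8 : d2 % 3 = 1 ∨ d2 % 3 = 2 := by omega
          have h9 : t % 3 = 1 ∨ t % 3 = 2 := by omega
          rcases h8 with h8 | h8 <;> rcases h9 with h9 | h9 <;> omega

end Wt

/-- If `3 ≤ d2 ≤ d3`, `3 ∤ d2` and `d3 ∉ 3ℕ + d2ℕ`, then there is no tame automorphism of `ℂ³`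
with multidegree `(3, d2, d3)`. -/
theorem not_exists_tame_of_not_dvd_of_not_mem (d2 d3 : ℕ) (h2 : 3 ≤ d2) (h23 : d2 ≤ d3)
    (hdvd : ¬ 3 ∣ d2) (hmem : ¬ ∃ a b : ℕ, d3 = 3 * a + b * d2) :
    ¬ ∃ F : MvPolynomial (Fin 3) ℂ ≃ₐ[ℂ] MvPolynomial (Fin 3) ℂ,
      IsTameAut F ∧ polyMdeg F = ![3, d2, d3] := by
  rintro ⟨F, hF, hd⟩
  obtain ⟨θ, hθ⟩ := Wt.exists_wt (200 * d3) (by omega)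
  have hD : (0 : ℝ) < d3 := by exact_mod_cast (by omega : 0 < d3)
  have hw : ∀ i, θ.w i ≤ 1 + 1 / (100 * d3) := by
    intro i
    refine (hθ i).trans (le_of_eq ?_)
    push_cast
    field_simp
    ring
  have hTR : θ.TR (F (X 0)) (F (X 1)) (F (X 2)) := by
    clear hd
    unfold IsTameAut at hF
    have step : ∀ (H G : P3 ≃ₐ[ℂ] P3), (IsAffineAut G ∨ IsElementaryAut G) →
        (θ.TR (H (X 0)) (H (X 1)) (H (X 2)) ↔ θ.TR ((H * G) (X 0)) ((H * G) (X 1)) ((H * G) (X 2))) := by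
      rintro H G (hG | ⟨i, p, hp, hi, hj⟩)
      · exact Wt.TR.aff_iff H G hG
      · exact Wt.TR.elem_iff H G i p hp hi hj
    induction hF using Subgroup.closure_induction_right with
    | one => exact Wt.TR.one
    | mul_right x hx y hy ih => exact (step x y hy).1 ih
    | mul_inv_cancel x hx y hy ih =>
      refine (step (x * y⁻¹) y hy).2 ?_
      rw [inv_mul_cancel_right]
      exact ih
  have h0 : (F (X 0)).totalDegree = 3 := by simpa [polyMdeg] using congrFun hd 0
  have h1 : (F (X 1)).totalDegree = d2 := by simpa [polyMdeg] using congrFun hd 1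
  have h3 : (F (X 2)).totalDegree = d3 := by simpa [polyMdeg] using congrFun hd 2
  have hfin : θ.TR (F (X 2)) (F (X 1)) (F (X 0)) := hTR.swap.rot.rot
  exact Wt.final h2 h23 hdvd hmem (θ.exists_lead' d3 d3 le_rfl (by omega) hw _ h3)
    (θ.exists_lead' d2 d3 h23 (by omega) hw _ h1) (θ.exists_lead' 3 d3 (by omega) (by omega) hw _ h0)
    hfin.1 hfin.2
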